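/- Assume the local multiplier setup with g of the standard form, and let ε, d be the ball exponents of g with ε < 1/2. Let δ = min over all unit vectors v of the strip exponent δ_v, and let e be the maximum of e_v over those unit vectors v with δ_v = δ. Then, provided the support of φ is sufficiently small, there is a constant C' (depending on g, φ, and A) such that for every (t,u) ∈ ℝ² one has |K_φ(t,u)| ≤ C' (2+|(t,u)|)^{−δ} (ln(2+|(t,u)|))^{e}. -/

import Mathlib

open MeasureTheory Real Set Filter Metric
open scoped Topology ENNReal

noncomputable section

/-- The Euclidean magnitude `|(x,y)| = √(x²+y²)` of a point of `ℝ²`. -/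
def nrm2 (p : ℝ × ℝ) : ℝ := Real.sqrt (p.1 ^ 2 + p.2 ^ 2)

/-- The open Euclidean disk `{(x,y) : x²+y² < r²}` centered at the origin. -/
def disk2 (r : ℝ) : Set (ℝ × ℝ) := {p : ℝ × ℝ | p.1 ^ 2 + p.2 ^ 2 < r ^ 2}

/-- The closed Euclidean disk `{(x,y) : x²+y² ≤ r²}` centered at the origin. -/
def closedDisk2 (r : ℝ) : Set (ℝ × ℝ) := {p : ℝ × ℝ | p.1 ^ 2 + p.2 ^ 2 ≤ r ^ 2}

/-- The circle `{(x,y) : x²+y² = r²}` centered at the origin. -/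
def circle2 (r : ℝ) : Set (ℝ × ℝ) := {p : ℝ × ℝ | p.1 ^ 2 + p.2 ^ 2 = r ^ 2}

/-- Dot product on `ℝ²`. -/
def dot2 (p q : ℝ × ℝ) : ℝ := p.1 * q.1 + p.2 * q.2

/-- The perpendicular vector `v^⊥ = (v₂, −v₁)`. -/
def perp2 (v : ℝ × ℝ) : ℝ × ℝ := (v.2, -v.1)

/-- The function `g = χ_E · ∏ᵢ |fᵢ|^(γᵢ)`. -/
def stdFun (n : ℕ) (f : Fin n → ℝ × ℝ → ℝ) (γ : Fin n → ℝ) (E : Set (ℝ × ℝ)) :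
    ℝ × ℝ → ℝ :=
  E.indicator fun p => ∏ i, |f i p| ^ (γ i)

/-- A boundary curve for the region `E`: one half of a graph `y = h(|x|^{1/N})` or
`x = h(|y|^{1/N})` with `h` real analytic, `h 0 = 0`, joining the origin to the circle
of radius `r₀`. -/
def IsPuiseuxBdryCurve (r₀ : ℝ) (C : Set (ℝ × ℝ)) : Prop :=
  ∃ (N : ℕ) (h : ℝ → ℝ) (I : Set ℝ) (σ : ℝ),
    0 < N ∧ (σ = 1 ∨ σ = -1) ∧ IsOpen I ∧ Icc (0:ℝ) (r₀ ^ ((N:ℝ)⁻¹)) ⊆ I ∧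
    AnalyticOnNhd ℝ h I ∧ h 0 = 0 ∧
    (C = {p : ℝ × ℝ | p ∈ closedDisk2 r₀ ∧ 0 ≤ σ * p.1 ∧
            p.2 = h (|p.1| ^ ((N:ℝ)⁻¹))} ∨
     C = {p : ℝ × ℝ | p ∈ closedDisk2 r₀ ∧ 0 ≤ σ * p.2 ∧
            p.1 = h (|p.2| ^ ((N:ℝ)⁻¹))}) ∧
    (0:ℝ×ℝ) ∈ C ∧ ∃ p ∈ C, nrm2 p = r₀

/-- The admissible form of the set `E`: either a disk centered at the origin, or a finite
disjoint union of open regions, each bounded by two Puiseux boundary curves joining the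
origin to the circle of radius `r₀` together with an arc of that circle, where all the
boundary curves are pairwise disjoint in the closed disk minus the origin. -/
def IsStdDomain (E : Set (ℝ × ℝ)) : Prop :=
  (∃ r₀ > (0:ℝ), E = disk2 r₀) ∨
  (∃ r₀ > (0:ℝ), ∃ m : ℕ, ∃ Es : Fin m → Set (ℝ × ℝ), ∃ Cs : Fin m → Fin 2 → Set (ℝ × ℝ),
    E = Set.iUnion Es ∧
    (Pairwise fun i j => Disjoint (Es i) (Es j)) ∧
    (∀ i, IsOpen (Es i) ∧ Es i ⊆ disk2 r₀ ∧ (0:ℝ×ℝ) ∈ closure (Es i) ∧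
      frontier (Es i) ⊆ Cs i 0 ∪ Cs i 1 ∪ circle2 r₀) ∧
    (∀ i j, IsPuiseuxBdryCurve r₀ (Cs i j)) ∧
    (Pairwise fun (q q' : Fin m × Fin 2) =>
      Disjoint (Cs q.1 q.2 ∩ (closedDisk2 r₀ \ {0}))
               (Cs q'.1 q'.2 ∩ (closedDisk2 r₀ \ {0}))))

/-- The standard form of the paper: the `fᵢ` are real analytic and not identically zero
near the origin, `g = χ_E ∏ |fᵢ|^(γᵢ)` is integrable near the origin, and `E` is an
admissible domain. -/
structure StandardForm (n : ℕ) (f : Fin n → ℝ × ℝ → ℝ) (γ : Fin n → ℝ)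
    (E : Set (ℝ × ℝ)) : Prop where
  analytic : ∃ U ∈ 𝓝 (0 : ℝ × ℝ), ∀ i, AnalyticOnNhd ℝ (f i) U
  nontriv : ∀ i, ¬ (∀ᶠ p in 𝓝 (0 : ℝ × ℝ), f i p = 0)
  integ : ∃ U ∈ 𝓝 (0 : ℝ × ℝ), IntegrableOn (stdFun n f γ E) U
  domain : IsStdDomain E

/-- The two-sided bound `c₁ rᵉ |log r|^d ≤ ∫_{x²+y²<r²} g ≤ c₂ rᵉ |log r|^d` for all small
`r` ("ball exponents" `ε`, `d` of `g`, as in Lemma 1.1). -/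
def BallBound (g : ℝ × ℝ → ℝ) (ε : ℝ) (d : ℕ) : Prop :=
  0 < ε ∧ d ≤ 1 ∧ ∃ c₁ > (0:ℝ), ∃ c₂ > (0:ℝ), ∃ c₃ > (0:ℝ), ∀ r : ℝ, 0 < r → r < c₃ →
    c₁ * r ^ ε * |Real.log r| ^ d ≤ (∫ p in disk2 r, g p) ∧
    (∫ p in disk2 r, g p) ≤ c₂ * r ^ ε * |Real.log r| ^ d

/-- The strip `{(x,y) : |(x,y)·v| < r, |(x,y)·v^⊥| < c}`. -/
def strip2 (v : ℝ × ℝ) (r c : ℝ) : Set (ℝ × ℝ) :=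
  {p : ℝ × ℝ | |dot2 p v| < r ∧ |dot2 p (perp2 v)| < c}

/-- The two-sided bound `a r^δ |log r|^e ≤ ∫_{strip} g ≤ b r^δ |log r|^e` for all small `r`,
for every small `c` ("strip exponents" `δ_v`, `e_v` of `g` in the direction `v`, as in
Lemma 1.2). -/
def StripBound (g : ℝ × ℝ → ℝ) (v : ℝ × ℝ) (δ : ℝ) (e : ℕ) : Prop :=
  0 < δ ∧ e ≤ 1 ∧ ∃ cv > (0:ℝ), ∀ c : ℝ, 0 < c → c < cv →
    ∃ a > (0:ℝ), ∃ b > (0:ℝ), ∀ r : ℝ, 0 < r → r < c →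
      a * r ^ δ * |Real.log r| ^ e ≤ (∫ p in strip2 v r c, g p) ∧
      (∫ p in strip2 v r c, g p) ≤ b * r ^ δ * |Real.log r| ^ e

/-- The order of vanishing of `f` at the origin. -/
def vanishingOrder (f : ℝ × ℝ → ℝ) : ℕ :=
  sInf {k : ℕ | iteratedFDeriv ℝ k f 0 ≠ 0}

/-- (A constant multiple of) the sum of the terms of lowest total degree in the Taylor
expansion of `f` at the origin, as a homogeneous function on `ℝ²`. -/
def lowestPart (f : ℝ × ℝ → ℝ) (p : ℝ × ℝ) : ℝ :=
  iteratedFDeriv ℝ (vanishingOrder f) f 0 (fun _ => p)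

/-- `w` is a tangent direction of the set `C` at the origin. -/
def IsTangentDirAt (C : Set (ℝ × ℝ)) (w : ℝ × ℝ) : Prop :=
  ∃ p : ℕ → ℝ × ℝ, (∀ k, p k ∈ C ∧ p k ≠ 0) ∧
    Tendsto p atTop (𝓝 (0:ℝ×ℝ)) ∧
    (Tendsto (fun k => (nrm2 (p k))⁻¹ • p k) atTop (𝓝 w) ∨
     Tendsto (fun k => (nrm2 (p k))⁻¹ • p k) atTop (𝓝 (-w)))

/-- `w` is the direction of one of the lines `l₁, …, l_p`: a line through the origin in the
zero set of the lowest-degree Taylor part of some `fᵢ`, or a tangent line at the origin to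
one of the boundary curves of `E`. -/
def ExceptionalDir (n : ℕ) (f : Fin n → ℝ × ℝ → ℝ) (E : Set (ℝ × ℝ)) (w : ℝ × ℝ) : Prop :=
  (∃ i, lowestPart (f i) w = 0) ∨ IsTangentDirAt (frontier E) w

/-- Conditions (1.2)-(1.3) on the factor `α`: `C¹` away from the origin, bounded by `A`,
with gradient bounded by `A (x²+y²)^{-1/2}`. -/
def AlphaBound (α : ℝ × ℝ → ℝ) (A : ℝ) : Prop :=
  ContDiffOn ℝ 1 α {(0:ℝ×ℝ)}ᶜ ∧ (∀ p, |α p| ≤ A) ∧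
  ∀ p : ℝ × ℝ, p ≠ 0 → ‖fderiv ℝ α p‖ ≤ A * (nrm2 p)⁻¹

/-- A smooth bump function equal to `1` near `(x₀, y₀)`, supported within (Euclidean)
distance `r` of `(x₀, y₀)`. -/
def IsBump (φ : ℝ × ℝ → ℝ) (x₀ y₀ : ℝ) (r : ℝ) : Prop :=
  ContDiff ℝ (⊤ : ℕ∞) φ ∧ HasCompactSupport φ ∧ (∀ᶠ p in 𝓝 ((x₀, y₀) : ℝ × ℝ), φ p = 1) ∧
    tsupport φ ⊆ {p : ℝ × ℝ | (p.1 - x₀) ^ 2 + (p.2 - y₀) ^ 2 < r ^ 2}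

/-- The oscillatory integral `∫_S h(x,y) e^{i(tx+uy)} dx dy`. -/
def oscInt (h : ℝ × ℝ → ℝ) (S : Set (ℝ × ℝ)) (t u : ℝ) : ℂ :=
  ∫ p in S, (h p : ℂ) * Complex.exp (Complex.I * ((t : ℂ) * (p.1 : ℂ) + (u : ℂ) * (p.2 : ℂ)))

/-- The convolution kernel `K(t,u) = ∫ m(x,y) e^{i(tx+uy)} dx dy`. -/
def Kfull (m : ℝ × ℝ → ℝ) (t u : ℝ) : ℂ :=
  oscInt m Set.univ t u

/-- The localized kernel `K_φ(t,u) = ∫ φ(x,y) m(x,y) e^{i(tx+uy)} dx dy`. -/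
def Kphi (φ m : ℝ × ℝ → ℝ) (t u : ℝ) : ℂ :=
  oscInt (fun p => φ p * m p) Set.univ t u

/-- `k` is a Puiseux function of index `N` on `[0,a]`: `k(x) = k'(x^{1/N})` for a function
`k'` real analytic on an open set containing `[0, a^{1/N}]`; equivalently `x ↦ k(x^N)` is
real analytic. -/
def PuiseuxOn (N : ℕ) (a : ℝ) (k : ℝ → ℝ) : Prop :=
  ∃ (k' : ℝ → ℝ) (I : Set ℝ), IsOpen I ∧ Icc (0:ℝ) (a ^ ((N:ℝ)⁻¹)) ⊆ I ∧
    AnalyticOnNhd ℝ k' I ∧ ∀ x ∈ Icc (0:ℝ) a, k x = k' (x ^ ((N:ℝ)⁻¹))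

/-- `k(x) = l·x^s + higher order terms` as `x → 0⁺`. -/
def LeadingTerm (k : ℝ → ℝ) (l s : ℝ) : Prop :=
  Tendsto (fun x => k x / x ^ s) (𝓝[>] (0:ℝ)) (𝓝 l)

/-- The mixed partial derivative `∂_x^l ∂_y^m F`. -/
def pderiv2 (l m : ℕ) (F : ℝ × ℝ → ℝ) (p : ℝ × ℝ) : ℝ :=
  iteratedDeriv l (fun x => iteratedDeriv m (fun y => F (x, y)) p.2) p.1

/-- The descending product `α(α−1)⋯(α−l+1)`. -/
def descProd (α : ℝ) (l : ℕ) : ℝ := ∏ j ∈ Finset.range l, (α - (j : ℝ))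

/-- The sliver `{(x,y) : 0 < x < a, g(x) < y < G(x)}`. -/
def sliverSet (a : ℝ) (g G : ℝ → ℝ) : Set (ℝ × ℝ) :=
  {q : ℝ × ℝ | 0 < q.1 ∧ q.1 < a ∧ g q.1 < q.2 ∧ q.2 < G q.1}

/-- A wedge of radius `r₀` at the origin: a region bounded by two lines through the origin
and the circle of radius `r₀`. -/
def IsWedge (r₀ : ℝ) (W : Set (ℝ × ℝ)) : Prop :=
  ∃ θ₁ θ₂ : ℝ, θ₁ < θ₂ ∧ θ₂ ≤ θ₁ + 2 * π ∧
    W = {p : ℝ × ℝ | ∃ ρ θ : ℝ, 0 < ρ ∧ ρ < r₀ ∧ θ₁ < θ ∧ θ < θ₂ ∧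
      p = (ρ * Real.cos θ, ρ * Real.sin θ)}

local notation "RR" => ℝ × ℝ

lemma vdc_side {a b M M1 μ : ℝ} (hab : a ≤ b) (hμ : 0 < μ)
    {φ ψ ψ' ρ G G' : ℝ → ℝ}
    (hφ : ∀ x ∈ Icc a b, HasDerivAt φ (ψ x * ρ x) x)
    (hψ : ∀ x ∈ Icc a b, HasDerivAt ψ (ψ' x) x)
    (hG : ∀ x ∈ Icc a b, HasDerivAt G (G' x) x)
    (hρc : ContinuousOn ρ (Icc a b)) (hψc : ContinuousOn ψ' (Icc a b))
    (hGc : ContinuousOn G' (Icc a b))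
    (hs : (∀ x ∈ Icc a b, 0 ≤ ψ' x) ∨ (∀ x ∈ Icc a b, ψ' x ≤ 0))
    (hM : ∀ x ∈ Icc a b, |G x| ≤ M) (hM1 : ∀ x ∈ Icc a b, |G' x| ≤ M1)
    (hl : ∀ x ∈ Icc a b, μ ≤ |ψ x|) :
    ‖∫ x in a..b, ((G x * ρ x : ℝ) : ℂ) * Complex.exp (Complex.I * (φ x : ℂ))‖
      ≤ (4 * M + M1 * (b - a)) / μ := by
  have huI : uIcc a b = Icc a b := uIcc_of_le hab
  have hψ0 : ∀ x ∈ Icc a b, ψ x ≠ 0 := fun x hx h0 => by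
    have := hl x hx; rw [h0, abs_zero] at this; linarith
  have hM0 : 0 ≤ M := (abs_nonneg _).trans (hM a ⟨le_rfl, hab⟩)
  set E : ℝ → ℂ := fun x => Complex.exp (Complex.I * (φ x : ℂ)) with hE
  have hEn : ∀ x, ‖E x‖ = 1 := fun x => by
    simp only [hE]; rw [mul_comm]; exact Complex.norm_exp_ofReal_mul_I _
  have hE' : ∀ x ∈ Icc a b, HasDerivAt E (Complex.I * ((ψ x * ρ x : ℝ) : ℂ) * E x) x := by
    intro x hx
    have h1 := ((hφ x hx).ofReal_comp.const_mul Complex.I).cexp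
    convert h1 using 1
    simp only [hE]; ring
  set K : ℝ → ℝ := fun x => G x / ψ x with hK
  set K' : ℝ → ℝ := fun x => (G' x * ψ x - G x * ψ' x) / (ψ x) ^ 2 with hK'
  have hKd : ∀ x ∈ Icc a b, HasDerivAt K (K' x) x := fun x hx =>
    (hG x hx).div (hψ x hx) (hψ0 x hx)
  have hGcont : ContinuousOn G (Icc a b) := fun x hx => (hG x hx).continuousAt.continuousWithinAt
  have hψcont : ContinuousOn ψ (Icc a b) := fun x hx => (hψ x hx).continuousAt.continuousWithinAt
  have hEcont : ContinuousOn E (Icc a b) := fun x hx => (hE' x hx).continuousAt.continuousWithinAt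
  have hK'c : ContinuousOn K' (Icc a b) := by
    refine ContinuousOn.div ((hGc.mul hψcont).sub (hGcont.mul hψc)) (hψcont.pow 2) ?_
    intro x hx; exact pow_ne_zero _ (hψ0 x hx)
  have ibp := intervalIntegral.integral_mul_deriv_eq_deriv_mul (a := a) (b := b)
    (u := fun x => (K x : ℂ)) (u' := fun x => (K' x : ℂ)) (v := E)
    (v' := fun x => Complex.I * ((ψ x * ρ x : ℝ) : ℂ) * E x)
    (fun x hx => (hKd x (huI ▸ hx)).ofReal_comp) (fun x hx => hE' x (huI ▸ hx))
    (by
      apply ContinuousOn.intervalIntegrable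
      rw [huI]; exact Complex.continuous_ofReal.comp_continuousOn hK'c)
    (by
      apply ContinuousOn.intervalIntegrable
      rw [huI]
      exact (continuousOn_const.mul (Complex.continuous_ofReal.comp_continuousOn (hψcont.mul hρc))).mul hEcont)
  have e1 : ∫ x in a..b, ((G x * ρ x : ℝ) : ℂ) * E x
      = -Complex.I * ∫ x in a..b, (K x : ℂ) * (Complex.I * ((ψ x * ρ x : ℝ) : ℂ) * E x) := by
    rw [← intervalIntegral.integral_const_mul]
    apply intervalIntegral.integral_congr
    intro x hx
    rw [huI] at hx
    have h0 : (ψ x : ℂ) ≠ 0 := by exact_mod_cast hψ0 x hx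
    simp only [hK]
    push_cast
    field_simp
    ring_nf
    simp
  have hKb : ∀ x ∈ Icc a b, |K x| ≤ M / μ := by
    intro x hx
    simp only [hK, abs_div]
    exact div_le_div₀ hM0 (hM x hx) hμ (hl x hx)
  -- integral of |psi'|/psi^2
  have hint : ∃ σ : ℝ, |σ| = 1 ∧ ∀ x ∈ Icc a b, |ψ' x| = σ * ψ' x := by
    rcases hs with h | h
    · exact ⟨1, by simp, fun x hx => by rw [abs_of_nonneg (h x hx)]; ring⟩
    · exact ⟨-1, by simp, fun x hx => by rw [abs_of_nonpos (h x hx)]; ring⟩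
  obtain ⟨σ, hσ, hσ'⟩ := hint
  have hJ : ∫ x in a..b, ψ' x / (ψ x) ^ 2 = (-(ψ b)⁻¹) - (-(ψ a)⁻¹) := by
    apply intervalIntegral.integral_eq_sub_of_hasDerivAt (f := fun x => -(ψ x)⁻¹)
    · intro x hx; rw [huI] at hx
      have := ((hψ x hx).inv (hψ0 x hx)).neg
      rw [neg_div, neg_neg] at this
      exact this
    · apply ContinuousOn.intervalIntegrable
      rw [huI]; exact hψc.div (hψcont.pow 2) fun x hx => pow_ne_zero _ (hψ0 x hx)
  have hinv : ∀ x ∈ Icc a b, |(ψ x)⁻¹| ≤ 1 / μ := fun x hx => by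
    rw [abs_inv, ← one_div]; exact one_div_le_one_div_of_le hμ (hl x hx)
  have hJb : |∫ x in a..b, ψ' x / (ψ x) ^ 2| ≤ 2 / μ := by
    rw [hJ]
    have h1 := hinv a ⟨le_rfl, hab⟩
    have h2 := hinv b ⟨hab, le_rfl⟩
    have : (2:ℝ)/μ = 1/μ + 1/μ := by ring
    rw [this, abs_le]; rw [abs_le] at h1 h2; constructor <;> linarith [h1.1, h1.2, h2.1, h2.2]
  have hKi : ‖∫ x in a..b, (K' x : ℂ) * E x‖ ≤ M1 * (b - a) / μ + M * (2 / μ) := by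
    have hle : ∀ x ∈ Icc a b, ‖(K' x : ℂ) * E x‖ ≤ M1 / μ + M * (σ * (ψ' x / (ψ x)^2)) := by
      intro x hx
      rw [norm_mul, hEn, mul_one, Complex.norm_real, norm_eq_abs]
      have : K' x = G' x / ψ x - G x * (ψ' x / (ψ x)^2) := by
        simp only [hK']; field_simp [hψ0 x hx]
      rw [this]
      refine (abs_sub _ _).trans (add_le_add ?_ ?_)
      · rw [abs_div]
        exact div_le_div₀ ((abs_nonneg _).trans (hM1 x hx)) (hM1 x hx) hμ (hl x hx)
      · rw [abs_mul, abs_div, hσ' x hx, abs_of_nonneg (sq_nonneg (ψ x)), ← mul_div_assoc σ]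
        apply mul_le_mul_of_nonneg_right (hM x hx)
        rw [← hσ' x hx]; positivity
    have hci : IntervalIntegrable (fun x => M1 / μ + M * (σ * (ψ' x / (ψ x)^2))) volume a b := by
      apply ContinuousOn.intervalIntegrable
      rw [huI]
      exact continuousOn_const.add (continuousOn_const.mul (continuousOn_const.mul
        (hψc.div (hψcont.pow 2) fun x hx => pow_ne_zero _ (hψ0 x hx))))
    refine (intervalIntegral.norm_integral_le_of_norm_le hab
      (ae_of_all _ fun x hx => hle x (Ioc_subset_Icc_self hx)) hci).trans ?_
    rw [intervalIntegral.integral_add (by simp) ]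
    · rw [intervalIntegral.integral_const, intervalIntegral.integral_const_mul,
        intervalIntegral.integral_const_mul]
      refine add_le_add (by simp; apply le_of_eq; ring) (mul_le_mul_of_nonneg_left ?_ hM0)
      refine (le_abs_self _).trans ?_
      rw [abs_mul, hσ, one_mul]; exact hJb
    · have := hci.sub (intervalIntegrable_const (c := M1 / μ)); simpa using this
  rw [e1, ibp, norm_mul]
  simp only [norm_neg, Complex.norm_I, one_mul]
  refine (norm_sub_le _ _).trans ?_
  have hb1 : ∀ x ∈ Icc a b, ‖(K x : ℂ) * E x‖ ≤ M / μ := fun x hx => by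
    rw [norm_mul, hEn, mul_one, Complex.norm_real]; exact hKb x hx
  have := norm_sub_le ((K b : ℂ) * E b) ((K a : ℂ) * E a)
  have h3 := hb1 a ⟨le_rfl, hab⟩
  have h4 := hb1 b ⟨hab, le_rfl⟩
  calc _ ≤ (M/μ + M/μ) + (M1 * (b - a) / μ + M * (2 / μ)) := by linarith
    _ = _ := by ring

lemma vdc2 {a b M M1 Λ R : ℝ} (hab : a ≤ b) (hΛ : 0 < Λ) (hR : 0 < R)
    {φ ψ ψ' ρ G G' : ℝ → ℝ}
    (hφ : ∀ x ∈ Icc a b, HasDerivAt φ (ψ x * ρ x) x)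
    (hψ : ∀ x ∈ Icc a b, HasDerivAt ψ (ψ' x) x)
    (hG : ∀ x ∈ Icc a b, HasDerivAt G (G' x) x)
    (hρc : ContinuousOn ρ (Icc a b)) (hψc : ContinuousOn ψ' (Icc a b))
    (hGc : ContinuousOn G' (Icc a b))
    (hM : ∀ x ∈ Icc a b, |G x| ≤ M) (hM1 : ∀ x ∈ Icc a b, |G' x| ≤ M1)
    (hρ : ∀ x ∈ Icc a b, |ρ x| ≤ R)
    (hl : ∀ x ∈ Icc a b, Λ ≤ |ψ' x|) :
    ‖∫ x in a..b, ((G x * ρ x : ℝ) : ℂ) * Complex.exp (Complex.I * (φ x : ℂ))‖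
      ≤ 5 * (4 * M + M1 * (b - a)) * √(R / Λ) := by
  have hs : (∀ x ∈ Icc a b, 0 ≤ ψ' x) ∨ (∀ x ∈ Icc a b, ψ' x ≤ 0) := by
    by_contra hcon
    push Not at hcon
    obtain ⟨⟨x, hx, hx'⟩, ⟨y, hy, hy'⟩⟩ := hcon
    obtain ⟨z, hz, hz'⟩ := (isPreconnected_Icc (a := a) (b := b)).intermediate_value hx hy hψc
      ⟨hx'.le, hy'.le⟩
    have := hl z hz; rw [hz', abs_zero] at this; linarith
  have hM0 : 0 ≤ M := (abs_nonneg _).trans (hM a ⟨le_rfl, hab⟩)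
  have hM10 : 0 ≤ M1 := (abs_nonneg _).trans (hM1 a ⟨le_rfl, hab⟩)
  have hψcont : ContinuousOn ψ (Icc a b) := fun x hx => (hψ x hx).continuousAt.continuousWithinAt
  obtain ⟨x0, hx0, hmin⟩ := isCompact_Icc.exists_isMinOn (nonempty_Icc.2 hab) hψcont.abs
  have hmin : ∀ x ∈ Icc a b, |ψ x0| ≤ |ψ x| := fun x hx => hmin hx
  have hlow : ∀ x ∈ Icc a b, Λ * |x - x0| ≤ 2 * |ψ x| := by
    intro x hx
    have key : Λ * |x - x0| ≤ |ψ x - ψ x0| := by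
      rcases lt_trichotomy x x0 with h | h | h
      · obtain ⟨c, hc, hc'⟩ := exists_hasDerivAt_eq_slope ψ ψ' h
          (hψcont.mono (Icc_subset_Icc hx.1 hx0.2)) (fun y hy => hψ y ⟨hx.1.trans hy.1.le, hy.2.le.trans hx0.2⟩)
        have := hl c ⟨hx.1.trans hc.1.le, hc.2.le.trans hx0.2⟩
        rw [hc', abs_div, le_div_iff₀ (abs_pos.2 (sub_ne_zero.2 h.ne'))] at this
        rw [abs_sub_comm x, abs_sub_comm (ψ x)]; exact this
      · subst h; simp
      · obtain ⟨c, hc, hc'⟩ := exists_hasDerivAt_eq_slope ψ ψ' h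
          (hψcont.mono (Icc_subset_Icc hx0.1 hx.2)) (fun y hy => hψ y ⟨hx0.1.trans hy.1.le, hy.2.le.trans hx.2⟩)
        have := hl c ⟨hx0.1.trans hc.1.le, hc.2.le.trans hx.2⟩
        rw [hc', abs_div, le_div_iff₀ (abs_pos.2 (sub_ne_zero.2 h.ne'))] at this
        exact this
    have h1 := abs_sub (ψ x) (ψ x0)
    have h2 := hmin x hx
    linarith
  set η : ℝ := 1 / √(Λ * R) with hη
  have hηp : 0 < η := by positivity
  set a' := max a (x0 - η)
  set b' := min b (x0 + η)
  have ha' : a ≤ a' := le_max_left _ _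
  have hb' : b' ≤ b := min_le_left _ _
  have hab' : a' ≤ b' := by
    apply max_le <;> apply le_min <;> linarith [hx0.1, hx0.2]
  set F : ℝ → ℂ := fun x => ((G x * ρ x : ℝ) : ℂ) * Complex.exp (Complex.I * (φ x : ℂ)) with hF
  have hFc : ContinuousOn F (Icc a b) := by
    have hGcont : ContinuousOn G (Icc a b) := fun x hx => (hG x hx).continuousAt.continuousWithinAt
    have hφcont : ContinuousOn φ (Icc a b) := fun x hx => (hφ x hx).continuousAt.continuousWithinAt
    exact (Complex.continuous_ofReal.comp_continuousOn (hGcont.mul hρc)).mul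
      (Complex.continuous_exp.comp_continuousOn (continuousOn_const.mul
        (Complex.continuous_ofReal.comp_continuousOn hφcont)))
  have hii : ∀ c d, c ≤ d → a ≤ c → d ≤ b → IntervalIntegrable F volume c d := by
    intro c d hcd h1 h2
    apply ContinuousOn.intervalIntegrable
    rw [uIcc_of_le hcd]; exact hFc.mono (Icc_subset_Icc h1 h2)
  have side : ∀ c d, c ≤ d → a ≤ c → d ≤ b → (c < d → ∀ x ∈ Icc c d, η ≤ |x - x0|) →
      ‖∫ x in c..d, F x‖ ≤ (4 * M + M1 * (b - a)) / (Λ * η / 2) := by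
    intro c d hcd h1 h2 h3
    have hsub : Icc c d ⊆ Icc a b := Icc_subset_Icc h1 h2
    rcases hcd.eq_or_lt with h | h
    · rw [h]; simp; have : 0 ≤ b - a := by linarith
      positivity
    refine (vdc_side (M := M) (M1 := M1) (μ := Λ * η / 2) hcd (by positivity) (fun x hx => hφ x (hsub hx)) (fun x hx => hψ x (hsub hx))
      (fun x hx => hG x (hsub hx)) (hρc.mono hsub) (hψc.mono hsub) (hGc.mono hsub)
      (hs.imp (fun h x hx => h x (hsub hx)) (fun h x hx => h x (hsub hx)))
      (fun x hx => hM x (hsub hx)) (fun x hx => hM1 x (hsub hx)) ?_).trans ?_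
    · intro x hx
      have h4 := hlow x (hsub hx)
      have h5 := mul_le_mul_of_nonneg_left (h3 h x hx) hΛ.le
      linarith
    · gcongr
  have s1 := side a a' ha' le_rfl (hab'.trans hb') (fun h x hx => by
    have h1 : a' = x0 - η := by
      rcases max_choice a (x0 - η) with h' | h'
      · exact absurd h' (by change ¬ a' = a; exact h.ne')
      · exact h'
    rw [abs_sub_comm]; refine le_trans ?_ (le_abs_self _); have := hx.2; linarith)
  have s2 := side b' b hb' (ha'.trans hab') le_rfl (fun h x hx => by
    have h1 : b' = x0 + η := by
      rcases min_choice b (x0 + η) with h' | h'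
      · exact absurd h' (by change ¬ b' = b; exact h.ne)
      · exact h'
    refine le_trans ?_ (le_abs_self _); have := hx.1; linarith)
  have s3 : ‖∫ x in a'..b', F x‖ ≤ M * R * (2 * η) := by
    have h1 : ∀ x ∈ uIoc a' b', ‖F x‖ ≤ M * R := by
      intro x hx
      rw [uIoc_of_le hab'] at hx
      have hx' : x ∈ Icc a b := ⟨ha'.trans hx.1.le, hx.2.trans hb'⟩
      simp only [hF]
      rw [norm_mul, mul_comm Complex.I, Complex.norm_exp_ofReal_mul_I, mul_one, Complex.norm_real,
        norm_mul]
      exact mul_le_mul (hM x hx') (hρ x hx') (norm_nonneg _) hM0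
    refine (intervalIntegral.norm_integral_le_of_norm_le_const h1).trans ?_
    apply mul_le_mul_of_nonneg_left _ (by positivity)
    rw [abs_of_nonneg (by linarith)]
    have h2 : b' ≤ x0 + η := min_le_right _ _
    have h3 : x0 - η ≤ a' := le_max_right _ _
    linarith
  have hsplit : ∫ x in a..b, F x = (∫ x in a..a', F x) + (∫ x in a'..b', F x) + ∫ x in b'..b, F x := by
    rw [intervalIntegral.integral_add_adjacent_intervals (hii a a' ha' le_rfl (hab'.trans hb'))
      (hii a' b' hab' ha' hb'), intervalIntegral.integral_add_adjacent_intervals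
      (hii a b' (ha'.trans hab') le_rfl hb') (hii b' b hb' (ha'.trans hab') le_rfl)]
  rw [hsplit]
  refine (norm_add₃_le).trans ?_
  have e1 : √(R / Λ) = R * η := by
    rw [hη, Real.sqrt_div hR.le, Real.sqrt_mul hΛ.le]
    have := Real.mul_self_sqrt hR.le
    have h1 : 0 < √R := Real.sqrt_pos.2 hR
    have h2 : 0 < √Λ := Real.sqrt_pos.2 hΛ
    field_simp; nlinarith
  have e2 : 1 / (Λ * η) = R * η := by
    have := Real.mul_self_sqrt (show 0 ≤ Λ * R by positivity)
    have h1 : 0 < √(Λ * R) := by positivity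
    rw [hη]; field_simp; nlinarith
  set K := 4 * M + M1 * (b - a) with hK
  have hKM : 4 * M ≤ K := by have : 0 ≤ b - a := by linarith
                             have := mul_nonneg hM10 this; linarith
  have e3 : K / (Λ * η / 2) = 2 * K * (R * η) := by rw [← e2]; field_simp
  rw [e3] at s1 s2
  rw [e1]
  have : M * R * (2 * η) ≤ K * (R * η) := by
    have : 0 ≤ R * η := by positivity
    nlinarith
  linarith

/-- decay factor -/
def gain (μ : ℝ) : ℝ := (√(1 + μ))⁻¹

lemma gain_nonneg (μ : ℝ) : 0 ≤ gain μ := by unfold gain; positivity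

lemma gain_le_one {μ : ℝ} (h : 0 ≤ μ) : gain μ ≤ 1 := by
  unfold gain; apply inv_le_one_of_one_le₀; rw [Real.one_le_sqrt]; linarith

lemma gain_anti {μ ν : ℝ} (h0 : 0 ≤ μ) (h : μ ≤ ν) : gain ν ≤ gain μ := by
  unfold gain; apply inv_anti₀; positivity
  exact Real.sqrt_le_sqrt (by linarith)

/-- scaling -/
lemma gain_scale {c μ : ℝ} (hc : 1 ≤ c) (h0 : 0 ≤ μ) : gain μ ≤ c * gain (c * μ) := by
  unfold gain
  rw [← div_eq_mul_inv, inv_eq_one_div, div_le_div_iff₀ (by positivity) (by positivity), one_mul]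
  rw [Real.sqrt_le_left (by positivity), mul_pow, sq_sqrt (by positivity)]
  nlinarith [mul_nonneg h0 (by linarith : 0 ≤ c - 1), mul_nonneg (mul_nonneg h0 (by linarith : 0 ≤ c - 1)) (by linarith : 0 ≤ c)]

lemma gain_scale' {a b c : ℝ} (hc : 1 ≤ c) (ha : 0 ≤ a) (hb : 0 ≤ b) (hab : b ≤ c * a) :
    gain a ≤ c * gain b := by
  refine (gain_scale hc ha).trans ?_
  gcongr; exact gain_anti hb hab

lemma measurable_gain : Measurable gain := by unfold gain; fun_prop

lemma rpow_bd12 {x : ℝ} (hx : x ∈ Icc (1:ℝ) 2) (a : ℝ) :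
    x ^ a ≤ 2 ^ |a| ∧ ((2:ℝ) ^ |a|)⁻¹ ≤ x ^ a := by
  have h0 : (0:ℝ) < x := by linarith [hx.1]
  have h1 : ∀ a : ℝ, x ^ a ≤ 2 ^ |a| := fun a =>
    (rpow_le_rpow_of_exponent_le hx.1 (le_abs_self a)).trans
      (rpow_le_rpow h0.le hx.2 (abs_nonneg a))
  refine ⟨h1 a, ?_⟩
  have := h1 (-a)
  rw [rpow_neg h0.le, abs_neg] at this
  exact inv_le_of_inv_le₀ (by positivity) this

lemma unit_vdc (b κ : ℝ) : ∃ C : ℝ, 0 < C ∧ ∀ (B μ : ℝ) (A A1 φ φ1 φ2 : ℝ → ℝ), 0 ≤ μ →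
    (∀ x ∈ Icc (1:ℝ) 2, HasDerivAt A (A1 x / x) x) → ContinuousOn A1 (Icc 1 2) →
    (∀ x ∈ Icc (1:ℝ) 2, |A x| ≤ B) → (∀ x ∈ Icc (1:ℝ) 2, |A1 x| ≤ B) →
    (∀ x ∈ Icc (1:ℝ) 2, HasDerivAt φ (φ1 x / x) x) →
    (∀ x ∈ Icc (1:ℝ) 2, HasDerivAt φ1 (φ2 x / x) x) → ContinuousOn φ2 (Icc 1 2) →
    (∀ x ∈ Icc (1:ℝ) 2, μ ≤ |φ2 x - κ * φ1 x|) →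
    ‖∫ x in (1:ℝ)..2, ((A x * x ^ b : ℝ) : ℂ) * Complex.exp (Complex.I * (φ x : ℂ))‖
      ≤ C * B * gain μ := by
  set C1 : ℝ := 5 * (4 * 2 ^ |b+1-κ| + (2 ^ |b+1-κ| + |b+1-κ| * 2 ^ |b-κ|)) *
    √(2 ^ |κ-1| * 2 ^ |-κ-1|) with hC1
  have hC1p : 0 < C1 := by positivity
  refine ⟨2 * (C1 + 2 ^ |b|), by positivity, ?_⟩
  intro B μ A A1 φ φ1 φ2 hμ hA hA1c hAb hA1b hφ hφ1 hφ2c hl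
  have hB : 0 ≤ B := (abs_nonneg _).trans (hAb 1 (by norm_num))
  have pos : ∀ x ∈ Icc (1:ℝ) 2, 0 < x := fun x hx => by linarith [hx.1]
  have rc : ∀ a : ℝ, ContinuousOn (fun x : ℝ => x ^ a) (Icc 1 2) := fun a x hx =>
    (Real.continuousAt_rpow_const x a (Or.inl (pos x hx).ne')).continuousWithinAt
  have rd : ∀ a : ℝ, ∀ x ∈ Icc (1:ℝ) 2, HasDerivAt (fun x : ℝ => x ^ a) (a * x ^ (a-1)) x :=
    fun a x hx => Real.hasDerivAt_rpow_const (Or.inl (pos x hx).ne')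
  have hAc : ContinuousOn A (Icc 1 2) := fun x hx => (hA x hx).continuousAt.continuousWithinAt
  have hφ1c : ContinuousOn φ1 (Icc 1 2) := fun x hx => (hφ1 x hx).continuousAt.continuousWithinAt
  have triv : ‖∫ x in (1:ℝ)..2, ((A x * x ^ b : ℝ) : ℂ) * Complex.exp (Complex.I * (φ x : ℂ))‖
      ≤ B * 2 ^ |b| := by
    have h1 : ∀ x ∈ uIoc (1:ℝ) 2, ‖((A x * x ^ b : ℝ) : ℂ) * Complex.exp (Complex.I * (φ x : ℂ))‖ ≤ B * 2 ^ |b| := by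
      intro x hx
      rw [uIoc_of_le (by norm_num)] at hx
      have hx' := Ioc_subset_Icc_self hx
      rw [norm_mul, mul_comm Complex.I, Complex.norm_exp_ofReal_mul_I, mul_one, Complex.norm_real,
        norm_mul]
      refine mul_le_mul (hAb x hx') ?_ (norm_nonneg _) hB
      rw [norm_eq_abs, abs_of_pos (rpow_pos_of_pos (pos x hx') b)]
      exact (rpow_bd12 hx' b).1
    have := intervalIntegral.norm_integral_le_of_norm_le_const h1
    rw [show |(2:ℝ) - 1| = 1 by norm_num, mul_one] at this; exact this
  rcases lt_or_ge μ 1 with h1 | h1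
  · refine triv.trans ?_
    have : 1 / 2 ≤ gain μ := by
      unfold gain; rw [one_div]; apply inv_anti₀ (by positivity)
      rw [Real.sqrt_le_left (by norm_num)]; linarith
    calc B * 2 ^ |b| = 2 * 2 ^ |b| * B * (1/2) := by ring
      _ ≤ 2 * (C1 + 2 ^ |b|) * B * gain μ := by gcongr; linarith
  have hμ0 : 0 < μ := by linarith
  have key := vdc2 (a := 1) (b := 2) (M := B * 2 ^ |b+1-κ|)
    (M1 := B * (2 ^ |b+1-κ| + |b+1-κ| * 2 ^ |b-κ|)) (Λ := (2 ^ |-κ-1|)⁻¹ * μ) (R := 2 ^ |κ-1|)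
    (by norm_num) (by positivity) (by positivity)
    (φ := φ) (ψ := fun x => φ1 x * x ^ (-κ)) (ρ := fun x => x ^ (κ-1))
    (ψ' := fun x => x ^ (-κ-1) * (φ2 x - κ * φ1 x))
    (G := fun x => A x * x ^ (b+1-κ))
    (G' := fun x => A1 x * x ^ (b-κ) + A x * ((b+1-κ) * x ^ (b-κ)))
    (by
      intro x hx
      convert hφ x hx using 1
      rw [mul_assoc, ← rpow_add (pos x hx), div_eq_mul_inv, ← rpow_neg_one]
      congr 2; ring)
    (by
      intro x hx
      refine ((hφ1 x hx).mul (rd (-κ) x hx)).congr_deriv ?_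
      rw [rpow_sub (pos x hx), rpow_one]
      field_simp [(pos x hx).ne']; ring)
    (by
      intro x hx
      refine ((hA x hx).mul (rd (b+1-κ) x hx)).congr_deriv ?_
      rw [show b + 1 - κ - 1 = b - κ by ring, show b + 1 - κ = (b - κ) + 1 by ring,
        rpow_add (pos x hx), rpow_one]
      field_simp [(pos x hx).ne'])
    (rc _) ((rc _).mul (hφ2c.sub (continuousOn_const.mul hφ1c)))
    ((hA1c.mul (rc _)).add (hAc.mul (continuousOn_const.mul (rc _))))
    (by
      intro x hx
      rw [abs_mul, abs_of_pos (rpow_pos_of_pos (pos x hx) _)]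
      exact mul_le_mul (hAb x hx) (rpow_bd12 hx _).1 (rpow_nonneg (pos x hx).le _) hB)
    (by
      intro x hx
      refine (abs_add_le _ _).trans ?_
      rw [mul_add]
      have hp := rpow_pos_of_pos (pos x hx) (b - κ)
      refine add_le_add ?_ ?_
      · rw [abs_mul, abs_of_pos hp]
        refine mul_le_mul (hA1b x hx) ?_ hp.le hB
        refine le_trans ?_ (rpow_bd12 hx _).1
        exact rpow_le_rpow_of_exponent_le hx.1 (by linarith)
      · rw [abs_mul, abs_mul, abs_of_pos hp]
        exact mul_le_mul (hAb x hx) (mul_le_mul_of_nonneg_left (rpow_bd12 hx _).1 (abs_nonneg _))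
          (by positivity) hB)
    (by
      intro x hx
      rw [abs_of_pos (rpow_pos_of_pos (pos x hx) _)]
      exact (rpow_bd12 hx _).1)
    (by
      intro x hx
      rw [abs_mul, abs_of_pos (rpow_pos_of_pos (pos x hx) _)]
      exact mul_le_mul (rpow_bd12 hx _).2 (hl x hx) hμ (rpow_nonneg (pos x hx).le _))
  have e1 : ∫ x in (1:ℝ)..2, ((A x * x ^ b : ℝ) : ℂ) * Complex.exp (Complex.I * (φ x : ℂ)) =
      ∫ x in (1:ℝ)..2, ((A x * x ^ (b+1-κ) * x ^ (κ-1) : ℝ) : ℂ) * Complex.exp (Complex.I * (φ x : ℂ)) := by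
    apply intervalIntegral.integral_congr
    intro x hx
    rw [uIcc_of_le (by norm_num)] at hx
    simp only
    rw [mul_assoc, ← rpow_add (pos x hx)]
    congr 5; ring
  rw [e1]
  refine key.trans ?_
  have e2 : √(2 ^ |κ-1| / ((2 ^ |-κ-1|)⁻¹ * μ)) = √(2 ^ |κ-1| * 2 ^ |-κ-1|) * (√μ)⁻¹ := by
    rw [← Real.sqrt_inv, ← Real.sqrt_mul (by positivity)]
    congr 1; field_simp
  have e3 : (√μ)⁻¹ ≤ 2 * gain μ := by
    unfold gain
    rw [inv_eq_one_div, ← div_eq_mul_inv, div_le_div_iff₀ (by positivity) (by positivity), one_mul]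
    rw [Real.sqrt_le_left (by positivity), mul_pow, sq_sqrt (by positivity)]
    linarith
  rw [e2]
  calc _ = C1 * B * (√μ)⁻¹ := by rw [hC1]; ring
    _ ≤ C1 * B * (2 * gain μ) := by gcongr
    _ ≤ 2 * (C1 + 2 ^ |b|) * B * gain μ := by
      have := mul_nonneg (mul_nonneg hB (gain_nonneg μ)) (show (0:ℝ) ≤ 2 * 2 ^ |b| by positivity)
      nlinarith

lemma lemA_piece (b κ h c : ℝ) (hc : 0 < c) : ∃ C : ℝ, 0 < C ∧
    ∀ (s B μ : ℝ) (A A1 φ φ1 φ2 : ℝ → ℝ), 0 < s → 0 ≤ μ →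
    (∀ x ∈ Icc s (2*s), HasDerivAt A (A1 x / x) x) → ContinuousOn A1 (Icc s (2*s)) →
    (∀ x ∈ Icc s (2*s), |A x| ≤ B) → (∀ x ∈ Icc s (2*s), |A1 x| ≤ B) →
    (∀ x ∈ Icc s (2*s), HasDerivAt φ (φ1 x / x) x) →
    (∀ x ∈ Icc s (2*s), HasDerivAt φ1 (φ2 x / x) x) → ContinuousOn φ2 (Icc s (2*s)) →
    (∀ x ∈ Icc s (2*s), c * (μ * x ^ h) ≤ |φ2 x - κ * φ1 x|) →
    ‖∫ x in Ioc s (2*s), ((A x * x ^ b : ℝ) : ℂ) * Complex.exp (Complex.I * (φ x : ℂ))‖ₑ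
      ≤ ENNReal.ofReal (C * B) * ∫⁻ x in Ioc s (2*s), ENNReal.ofReal (x ^ b * gain (μ * x ^ h)) := by
  obtain ⟨C, hC, H⟩ := unit_vdc b κ
  set K : ℝ := max 1 (2 ^ |h| * 2 ^ |h| / c) with hK
  have hK1 : 1 ≤ K := le_max_left _ _
  refine ⟨C * 2 ^ |b| * K, by positivity, ?_⟩
  intro s B μ A A1 φ φ1 φ2 hs hμ hA hA1c hAb hA1b hφ hφ1 hφ2c hl
  have hmem : ∀ x ∈ Icc (1:ℝ) 2, s * x ∈ Icc s (2*s) := fun x hx =>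
    ⟨by nlinarith [hx.1], by nlinarith [hx.2]⟩
  have pos : ∀ x ∈ Icc (1:ℝ) 2, 0 < x := fun x hx => by linarith [hx.1]
  have hB : 0 ≤ B := (abs_nonneg _).trans (hAb s ⟨le_rfl, by linarith⟩)
  have dcomp : ∀ (f f1 : ℝ → ℝ), (∀ x ∈ Icc s (2*s), HasDerivAt f (f1 x / x) x) →
      ∀ x ∈ Icc (1:ℝ) 2, HasDerivAt (fun x => f (s * x)) (f1 (s * x) / x) x := by
    intro f f1 hf x hx
    have h1 := (hf _ (hmem x hx)).comp x ((hasDerivAt_id x).const_mul s)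
    refine h1.congr_deriv ?_
    have := (pos x hx).ne'; field_simp
  have ccomp : ∀ f : ℝ → ℝ, ContinuousOn f (Icc s (2*s)) → ContinuousOn (fun x => f (s*x)) (Icc 1 2) :=
    fun f hf => hf.comp (by fun_prop) hmem
  set μ' : ℝ := c * (μ * s ^ h * (2 ^ |h|)⁻¹) with hμ'
  have hsh : 0 < s ^ h := rpow_pos_of_pos hs h
  have hμ'0 : 0 ≤ μ' := by positivity
  have main := H B μ' (fun x => A (s*x)) (fun x => A1 (s*x)) (fun x => φ (s*x)) (fun x => φ1 (s*x))
    (fun x => φ2 (s*x)) hμ'0 (dcomp _ _ hA) (ccomp _ hA1c) (fun x hx => hAb _ (hmem x hx))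
    (fun x hx => hA1b _ (hmem x hx)) (dcomp _ _ hφ) (dcomp _ _ hφ1) (ccomp _ hφ2c)
    (by
      intro x hx
      refine le_trans ?_ (hl _ (hmem x hx))
      rw [mul_rpow hs.le (pos x hx).le, hμ', ← mul_assoc μ]
      gcongr
      exact (rpow_bd12 hx h).2)
  have e1 : ∫ x in Ioc s (2*s), ((A x * x ^ b : ℝ) : ℂ) * Complex.exp (Complex.I * (φ x : ℂ)) =
      ((s * s ^ b : ℝ) : ℂ) * ∫ x in (1:ℝ)..2, ((A (s*x) * x ^ b : ℝ) : ℂ) * Complex.exp (Complex.I * (φ (s*x) : ℂ)) := by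
    rw [← intervalIntegral.integral_of_le (by linarith)]
    have h1 := intervalIntegral.smul_integral_comp_mul_left (a := 1) (b := 2)
      (fun x => ((A x * x ^ b : ℝ) : ℂ) * Complex.exp (Complex.I * (φ x : ℂ))) s
    rw [mul_one, mul_comm s 2] at h1
    rw [← h1, ← intervalIntegral.integral_smul, ← intervalIntegral.integral_const_mul]
    apply intervalIntegral.integral_congr
    intro x hx
    rw [uIcc_of_le (by norm_num)] at hx
    simp only [Complex.real_smul]
    rw [mul_rpow hs.le (pos x hx).le]
    push_cast; ring
  have hsb : 0 < s ^ b := rpow_pos_of_pos hs b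
  have lower : ∀ x ∈ Ioc s (2*s), s ^ b * gain μ' ≤ 2 ^ |b| * K * (x ^ b * gain (μ * x ^ h)) := by
    intro x hx
    have hx0 : 0 < x := hs.trans hx.1
    have hy : x / s ∈ Icc (1:ℝ) 2 := ⟨by rw [le_div_iff₀ hs]; linarith [hx.1], by rw [div_le_iff₀ hs]; exact hx.2⟩
    have ex : ∀ a : ℝ, x ^ a = s ^ a * (x/s) ^ a := fun a => by
      rw [← mul_rpow hs.le (pos _ hy).le]; congr 1; field_simp
    have h1 : s ^ b ≤ 2 ^ |b| * x ^ b := by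
      rw [ex b]
      have := (rpow_bd12 hy b).2
      have h2 : 1 ≤ 2 ^ |b| * (x/s) ^ b := by
        rw [inv_le_iff_one_le_mul₀ (by positivity)] at this; linarith
      nlinarith
    have h2 : gain μ' ≤ K * gain (μ * x ^ h) := by
      apply gain_scale' hK1 hμ'0 (by positivity)
      rw [ex h]
      have h3 := (rpow_bd12 hy h).1
      calc μ * (s ^ h * (x/s) ^ h) ≤ μ * (s ^ h * 2 ^ |h|) := by gcongr
        _ = (2 ^ |h| * 2 ^ |h| / c) * μ' := by rw [hμ']; field_simp
        _ ≤ K * μ' := by gcongr; exact le_max_right _ _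
    calc s ^ b * gain μ' ≤ (2 ^ |b| * x ^ b) * (K * gain (μ * x ^ h)) :=
          mul_le_mul h1 h2 (gain_nonneg _) (by positivity)
      _ = _ := by ring
  have hn : ‖∫ x in Ioc s (2*s), ((A x * x ^ b : ℝ) : ℂ) * Complex.exp (Complex.I * (φ x : ℂ))‖ ≤
      s * s ^ b * (C * B * gain μ') := by
    rw [e1, norm_mul, Complex.norm_real, norm_eq_abs, abs_of_pos (by positivity)]
    exact mul_le_mul_of_nonneg_left main (by positivity)
  rw [← ofReal_norm]
  refine (ENNReal.ofReal_le_ofReal hn).trans ?_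
  rw [← lintegral_const_mul' _ _ ENNReal.ofReal_ne_top]
  calc ENNReal.ofReal (s * s ^ b * (C * B * gain μ'))
      = ∫⁻ x in Ioc s (2*s), ENNReal.ofReal (C * B * (s ^ b * gain μ')) := by
        rw [lintegral_const, Measure.restrict_apply_univ, Real.volume_Ioc, ← ENNReal.ofReal_mul]
        · congr 1; ring
        · have := gain_nonneg μ'; positivity
    _ ≤ _ := by
        apply setLIntegral_mono' measurableSet_Ioc
        intro x hx
        rw [← ENNReal.ofReal_mul (by positivity)]
        apply ENNReal.ofReal_le_ofReal
        calc C * B * (s ^ b * gain μ') ≤ C * B * (2 ^ |b| * K * (x ^ b * gain (μ * x ^ h))) := by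
              exact mul_le_mul_of_nonneg_left (lower x hx) (by positivity)
          _ = _ := by ring

lemma lemA (b κ h c : ℝ) (hc : 0 < c) : ∃ C : ℝ, 0 < C ∧
    ∀ (T B μ : ℝ) (A A1 φ φ1 φ2 : ℝ → ℝ), 0 < T → 0 ≤ μ →
    (∀ x ∈ Ioc 0 T, HasDerivAt A (A1 x / x) x) → ContinuousOn A1 (Ioc 0 T) →
    (∀ x ∈ Ioc 0 T, |A x| ≤ B) → (∀ x ∈ Ioc 0 T, |A1 x| ≤ B) →
    (∀ x ∈ Ioc 0 T, HasDerivAt φ (φ1 x / x) x) →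
    (∀ x ∈ Ioc 0 T, HasDerivAt φ1 (φ2 x / x) x) → ContinuousOn φ2 (Ioc 0 T) →
    (∀ x ∈ Ioc 0 T, c * (μ * x ^ h) ≤ |φ2 x - κ * φ1 x|) →
    ‖∫ x in Ioc 0 T, ((A x * x ^ b : ℝ) : ℂ) * Complex.exp (Complex.I * (φ x : ℂ))‖ₑ
      ≤ ENNReal.ofReal (C * B) * ∫⁻ x in Ioc 0 T, ENNReal.ofReal (x ^ b * gain (μ * x ^ h)) := by
  obtain ⟨C, hC, H⟩ := lemA_piece b κ h c hc
  refine ⟨C, hC, ?_⟩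
  intro T B μ A A1 φ φ1 φ2 hT hμ hA hA1c hAb hA1b hφ hφ1 hφ2c hl
  by_cases hint : IntegrableOn (fun x => ((A x * x ^ b : ℝ) : ℂ) * Complex.exp (Complex.I * (φ x : ℂ))) (Ioc 0 T)
  swap
  · rw [integral_undef hint]; simp
  set J : ℕ → Set ℝ := fun k => Ioc (T / 2 ^ (k+1)) (T / 2 ^ k) with hJ
  have hanti : Antitone fun k : ℕ => T / 2 ^ k := by
    intro i j hij
    simp only
    gcongr
    norm_num
  have hdis : Pairwise (Function.onFun Disjoint J) := hanti.pairwise_disjoint_on_Ioc_succ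
  have hU : (⋃ k, J k) = Ioc 0 T := by
    ext x
    simp only [hJ, mem_iUnion, mem_Ioc]
    constructor
    · rintro ⟨k, h1, h2⟩
      exact ⟨lt_trans (by positivity) h1, h2.trans (div_le_self hT.le (one_le_pow₀ (by norm_num)))⟩
    · rintro ⟨h1, h2⟩
      obtain ⟨k, hk1, hk2⟩ := exists_nat_pow_near (x := T / x) (y := (2:ℝ)) (by rwa [one_le_div h1]) (by norm_num)
      refine ⟨k, ?_, ?_⟩
      · rw [div_lt_iff₀ (by positivity)]; rw [div_lt_iff₀ h1] at hk2; linarith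
      · rw [le_div_iff₀ (by positivity)]; rw [le_div_iff₀ h1] at hk1; linarith
  have hmJ : ∀ k, MeasurableSet (J k) := fun k => measurableSet_Ioc
  have hs := hasSum_integral_iUnion hmJ hdis (hU ▸ hint)
  rw [hU] at hs
  rw [← hs.tsum_eq]
  rw [← hU, lintegral_iUnion hmJ hdis, ← ENNReal.tsum_mul_left]
  refine (enorm_tsum_le_tsum_enorm).trans (ENNReal.tsum_le_tsum fun k => ?_)
  have e2 : T / 2 ^ k = 2 * (T / 2 ^ (k+1)) := by rw [pow_succ]; field_simp
  have hsub : Icc (T / 2 ^ (k+1)) (2 * (T / 2 ^ (k+1))) ⊆ Ioc 0 T := by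
    rw [← e2]
    intro x hx
    exact ⟨lt_of_lt_of_le (by positivity) hx.1, hx.2.trans (div_le_self hT.le (one_le_pow₀ (by norm_num)))⟩
  simp only [hJ]
  rw [e2]
  exact H _ B μ A A1 φ φ1 φ2 (by positivity) hμ (fun x hx => hA x (hsub hx)) (hA1c.mono hsub)
    (fun x hx => hAb x (hsub hx)) (fun x hx => hA1b x (hsub hx)) (fun x hx => hφ x (hsub hx))
    (fun x hx => hφ1 x (hsub hx)) (hφ2c.mono hsub) (fun x hx => hl x (hsub hx))

lemma div_alg {E : Type*} [NormedAddCommGroup E] [NormedSpace ℝ E] (P : E →L[ℝ] E) (e : E)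
    (l : E → ℝ) (hl : ∀ x, x = P x + l x • e) {n : ℕ} (f : ContinuousMultilinearMap ℝ (fun _ : Fin (n+1) => E) ℝ)
    (x : E) : f (fun _ => x) - f (fun _ => P x) =
      l x * ∑ k : Fin (n+1), f (k.insertNth e (fun i : Fin n => if i.castSucc < k then P x else x)) := by
  set v : ℕ → Fin (n+1) → E := fun k i => if i.val < k then P x else x with hv
  have h1 : ∀ k : Fin (n+1), l x * f (k.insertNth e (fun i : Fin n => if i.castSucc < k then P x else x))
      = f (v k) - f (v (k+1)) := by
    intro k
    set m : Fin n → E := fun i : Fin n => if i.castSucc < k then P x else x with hm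
    have e1 : l x * f (k.insertNth e m) = f (k.insertNth (l x • e) m) :=
      (f.toMultilinearMap.map_insertNth_smul k m (l x) e).symm
    have e2 : f (k.insertNth (P x + l x • e) m) = f (k.insertNth (P x) m) + f (k.insertNth (l x • e) m) :=
      f.toMultilinearMap.map_insertNth_add k m (P x) (l x • e)
    have hrem : ∀ i : Fin n, ((k.succAbove i).val < k.val ↔ i.castSucc < k) ∧
        ((k.succAbove i).val < k.val + 1 ↔ i.castSucc < k) := by
      intro i
      rcases lt_or_ge i.castSucc k with h | h
      · rw [Fin.succAbove_of_castSucc_lt _ _ h]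
        have h' : i.val < k.val := h
        refine ⟨iff_of_true h' h, iff_of_true (by simp only [Fin.val_castSucc]; omega) h⟩
      · rw [Fin.succAbove_of_le_castSucc _ _ h]
        have h' : k.val ≤ i.val := h
        refine ⟨iff_of_false ?_ (not_lt.2 h), iff_of_false ?_ (not_lt.2 h)⟩ <;>
        · simp only [Fin.val_succ]; omega
    have e3 : k.insertNth (P x + l x • e) m = v k := by
      rw [← hl x, Fin.insertNth_eq_iff]
      refine ⟨by simp [hv], ?_⟩
      funext i
      simp [hv, hm, Fin.removeNth, (hrem i).1]
    have e4 : k.insertNth (P x) m = v (k+1) := by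
      rw [Fin.insertNth_eq_iff]
      refine ⟨by simp [hv], ?_⟩
      funext i
      simp [hv, hm, Fin.removeNth, (hrem i).2]
    rw [e1, ← e3, ← e4, e2]; ring
  rw [Finset.mul_sum, Finset.sum_congr rfl (fun k _ => h1 k),
    Fin.sum_univ_eq_sum_range (fun k => f (v k) - f (v (k+1))) (n+1), Finset.sum_range_sub']
  congr 2
  funext i; simp only [hv, i.isLt, if_true]

lemma div_lemma {E : Type*} [NormedAddCommGroup E] [NormedSpace ℝ E] (P : E →L[ℝ] E) (e : E)
    (l : E → ℝ) (hl : ∀ x, x = P x + l x • e) (hP : ‖P‖ ≤ 1) (he : ‖e‖ ≤ 1)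
    {F : E → ℝ} (hF : AnalyticAt ℝ F 0) :
    ∃ G : E → ℝ, AnalyticAt ℝ G 0 ∧ ∀ᶠ x in 𝓝 (0:E), F x = F (P x) + l x * G x := by
  obtain ⟨p, r, hp⟩ := hF
  set q : FormalMultilinearSeries ℝ E ℝ := fun n => ∑ k : Fin (n+1),
    ((p (n+1)).curryMid k e).compContinuousLinearMap
      (fun i : Fin n => if i.castSucc < k then P else ContinuousLinearMap.id ℝ E) with hq
  have hqn : ∀ n, ‖q n‖ ≤ (n+1) * ‖p (n+1)‖ := by
    intro n
    refine (norm_sum_le _ _).trans ?_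
    refine (Finset.sum_le_card_nsmul _ _ (‖p (n+1)‖) ?_).trans (by simp)
    intro k _
    refine (ContinuousMultilinearMap.norm_compContinuousLinearMap_le _ _).trans ?_
    have h1 : ‖(p (n+1)).curryMid k e‖ ≤ ‖p (n+1)‖ := by
      refine (ContinuousLinearMap.le_opNorm _ _).trans ?_
      rw [ContinuousMultilinearMap.norm_curryMid]
      exact mul_le_of_le_one_right (norm_nonneg _) he
    refine (mul_le_mul h1 (Finset.prod_le_one (fun _ _ => norm_nonneg _) ?_) (Finset.prod_nonneg fun _ _ => norm_nonneg _) (norm_nonneg _)).trans (by simp)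
    intro i _
    split_ifs
    · exact hP
    · exact ContinuousLinearMap.norm_id_le
  obtain ⟨r0, hr0, hr0r⟩ := ENNReal.lt_iff_exists_nnreal_btwn.1 hp.r_pos
  have hr0p : 0 < r0 := by exact_mod_cast hr0
  obtain ⟨C, hC, hCb⟩ := p.norm_mul_pow_le_of_lt_radius (hr0r.trans_le hp.r_le)
  have hrad : ((r0/2 : NNReal) : ℝ≥0∞) ≤ q.radius := by
    apply q.le_radius_of_bound (C / r0)
    intro n
    have h2 : ((n:ℝ)+1) ≤ 2 ^ n := by exact_mod_cast Nat.lt_two_pow_self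
    have h3 := hCb (n+1)
    have hr' : (0:ℝ) < r0 := hr0p
    rw [le_div_iff₀ hr']
    push_cast
    calc ‖q n‖ * (r0/2:ℝ)^n * r0 ≤ (2 ^ n * ‖p (n+1)‖) * (r0/2:ℝ)^n * r0 := by
          gcongr; exact (hqn n).trans (by gcongr)
      _ = ‖p (n+1)‖ * (r0:ℝ)^(n+1) := by rw [div_pow, pow_succ]; field_simp
      _ ≤ C := h3
  have hqpos : 0 < q.radius := lt_of_lt_of_le (by simpa [pos_iff_ne_zero] using hr0p.ne') hrad
  have hqs := q.hasFPowerSeriesOnBall hqpos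
  refine ⟨q.sum, hqs.analyticAt, ?_⟩
  have hb1 : Metric.eball (0:E) r ∈ 𝓝 (0:E) := Metric.eball_mem_nhds _ hp.r_pos
  have hb2 : Metric.eball (0:E) q.radius ∈ 𝓝 (0:E) := Metric.eball_mem_nhds _ hqpos
  filter_upwards [hb1, hb2] with x hx1 hx2
  have hPx : P x ∈ Metric.eball (0:E) r := by
    rw [Metric.mem_eball, edist_zero_right] at hx1 ⊢
    refine lt_of_le_of_lt ?_ hx1
    rw [← ofReal_norm, ← ofReal_norm]
    exact ENNReal.ofReal_le_ofReal ((P.le_opNorm x).trans (mul_le_of_le_one_left (norm_nonneg _) hP))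
  have s1 := hp.hasSum hx1
  have s2 := hp.hasSum hPx
  have s3 := (hqs.hasSum hx2).mul_left (l x)
  rw [zero_add] at s1 s2 s3
  have s4 := s1.sub s2
  rw [← hasSum_nat_add_iff' 1] at s4
  have e0 : (p 0 fun _ => x) = (p 0 fun _ => P x) := by congr 1; funext i; exact i.elim0
  simp only [Finset.range_one, Finset.sum_singleton, e0, sub_self, sub_zero] at s4
  have : ∀ n, (p (n+1) fun _ => x) - (p (n+1) fun _ => P x) = l x * q n (fun _ => x) := by
    intro n
    rw [div_alg P e l hl (p (n+1)) x]
    congr 1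
    simp only [hq, _root_.sum_apply]
    refine Finset.sum_congr rfl fun k _ => ?_
    rw [ContinuousMultilinearMap.compContinuousLinearMap_apply, ContinuousMultilinearMap.curryMid_apply]
    congr 2
    funext i
    split_ifs <;> rfl
  simp only [this] at s4
  have := s4.unique s3
  linarith

lemma div_z {F : RR → ℝ} (hF : AnalyticAt ℝ F 0) :
    ∃ G : RR → ℝ, AnalyticAt ℝ G 0 ∧ ∀ᶠ x in 𝓝 (0:RR), F x = F (x.1, 0) + x.2 * G x := by
  have := div_lemma (E := RR) ((ContinuousLinearMap.inl ℝ ℝ ℝ).comp (ContinuousLinearMap.fst ℝ ℝ ℝ))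
    (0, 1) (fun x => x.2) (fun x => by ext <;> simp)
    (ContinuousLinearMap.opNorm_le_bound _ (by norm_num) fun x => by
      simp [Prod.norm_def]) (by simp [Prod.norm_def]) hF
  simpa using this

lemma div_t {F : RR → ℝ} (hF : AnalyticAt ℝ F 0) :
    ∃ G : RR → ℝ, AnalyticAt ℝ G 0 ∧ ∀ᶠ x in 𝓝 (0:RR), F x = F (0, x.2) + x.1 * G x := by
  have := div_lemma (E := RR) ((ContinuousLinearMap.inr ℝ ℝ ℝ).comp (ContinuousLinearMap.snd ℝ ℝ ℝ))
    (1, 0) (fun x => x.1) (fun x => by ext <;> simp)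
    (ContinuousLinearMap.opNorm_le_bound _ (by norm_num) fun x => by
      simp [Prod.norm_def]) (by simp [Prod.norm_def]) hF
  simpa using this

structure WDec (F : RR → ℝ) (m : ℕ) (c : ℕ → ℝ → ℝ) (u : RR → ℝ) : Prop where
  hc : ∀ k < m, AnalyticAt ℝ (c k) 0
  hc0 : ∀ k < m, c k 0 = 0
  hu : AnalyticAt ℝ u 0
  hu0 : u 0 ≠ 0
  eq : ∀ᶠ x in 𝓝 (0:RR), F x = ∑ k ∈ Finset.range m, c k x.1 * x.2 ^ k + x.2 ^ m * u x

lemma an_slice {F : RR → ℝ} {x : RR} (hF : AnalyticAt ℝ F x) :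
    AnalyticAt ℝ (fun z => F (x.1, z)) x.2 := by
  exact AnalyticAt.fun_comp (f := fun z => (x.1, z)) (g := F) hF (analyticAt_const.prod analyticAt_id)

lemma an_slice1 {F : RR → ℝ} {x : RR} (hF : AnalyticAt ℝ F x) :
    AnalyticAt ℝ (fun t => F (t, x.2)) x.1 := by
  exact AnalyticAt.fun_comp (f := fun t => (t, x.2)) (g := F) hF (analyticAt_id.prod analyticAt_const)

lemma tendsto_slice : Tendsto (fun z : ℝ => ((0:ℝ), z)) (𝓝 0) (𝓝 (0:RR)) := by
  have : Continuous (fun z : ℝ => ((0:ℝ), z)) := by fun_prop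
  exact this.tendsto' _ _ rfl

lemma tendsto_slice1 : Tendsto (fun t : ℝ => (t, (0:ℝ))) (𝓝 0) (𝓝 (0:RR)) := by
  have : Continuous (fun t : ℝ => (t, (0:ℝ))) := by fun_prop
  exact this.tendsto' _ _ rfl

lemma wdec_exists : ∀ (m : ℕ) {F : RR → ℝ} (_ : AnalyticAt ℝ F 0) {r : ℝ → ℝ}
    (_ : ContinuousAt r 0) (_ : r 0 ≠ 0) (_ : ∀ᶠ z in 𝓝 (0:ℝ), F (0, z) = z ^ m * r z),
    ∃ c u, WDec F m c u := by
  intro m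
  induction m with
  | zero =>
    intro F hF r hr hr0 h
    refine ⟨fun _ _ => 0, F, by simp, by simp, hF, ?_, by simp⟩
    have := h.self_of_nhds
    simp only [pow_zero, one_mul] at this
    rw [show (0:RR) = (0,0) from rfl, this]; exact hr0
  | succ m ih =>
    intro F hF r hr hr0 h
    obtain ⟨G, hG, hGe⟩ := div_z hF
    have hF0 : F (0,0) = 0 := by have := h.self_of_nhds; simpa using this
    have h2 : ∀ᶠ z in 𝓝[≠] (0:ℝ), G (0, z) = z ^ m * r z := by
      have h3 := (tendsto_slice.eventually hGe).and h
      filter_upwards [h3.filter_mono nhdsWithin_le_nhds, self_mem_nhdsWithin] with z hz hz0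
      simp only [hF0, zero_add] at hz
      have h4 := hz.1.symm.trans hz.2
      have hz0' : z ≠ 0 := hz0
      apply mul_left_cancel₀ hz0'
      rw [h4]; ring
    have hc1 : ContinuousAt (fun z => G (0,z)) 0 := (an_slice (x := (0,0)) hG).continuousAt
    have hc2 : ContinuousAt (fun z => z ^ m * r z) 0 := (continuousAt_id.pow m).mul hr
    have h5 : ∀ᶠ z in 𝓝 (0:ℝ), G (0, z) = z ^ m * r z := by
      have h6 : G (0,0) = 0 ^ m * r 0 := by
        have t1 : Tendsto (fun z => G (0,z)) (𝓝[≠] 0) (𝓝 (G (0,0))) := hc1.tendsto.mono_left nhdsWithin_le_nhds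
        have t2 : Tendsto (fun z => z ^ m * r z) (𝓝[≠] 0) (𝓝 (0 ^ m * r 0)) := hc2.tendsto.mono_left nhdsWithin_le_nhds
        exact tendsto_nhds_unique (t1.congr' h2) t2
      rw [eventually_nhdsWithin_iff] at h2
      filter_upwards [h2] with z hz
      by_cases h0 : z = 0
      · rw [h0]; exact h6
      · exact hz h0
    obtain ⟨c, u, hw⟩ := ih hG hr hr0 h5
    refine ⟨fun k => match k with | 0 => fun t => F (t, 0) | k+1 => c k, u, ?_, ?_, hw.hu, hw.hu0, ?_⟩
    · rintro (_ | k) hk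
      · exact an_slice1 (x := (0,0)) hF
      · exact hw.hc k (by omega)
    · rintro (_ | k) hk
      · exact hF0
      · exact hw.hc0 k (by omega)
    · filter_upwards [hGe, hw.eq] with x h1 h2
      rw [h1, h2, Finset.sum_range_succ']
      simp only [mul_add, Finset.mul_sum, pow_zero, mul_one]
      have : ∀ k, x.2 * (c k x.1 * x.2 ^ k) = c k x.1 * x.2 ^ (k+1) := fun k => by ring
      simp only [this]; ring

lemma order_exists {f : ℝ → ℝ} (hf : AnalyticAt ℝ f 0) (h : ¬ ∀ᶠ z in 𝓝 (0:ℝ), f z = 0) :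
    ∃ (m : ℕ) (r : ℝ → ℝ), AnalyticAt ℝ r 0 ∧ r 0 ≠ 0 ∧ ∀ᶠ z in 𝓝 (0:ℝ), f z = z ^ m * r z := by
  obtain ⟨m, r, h1, h2, h3⟩ := hf.exists_eventuallyEq_pow_smul_nonzero_iff.2 h
  exact ⟨m, r, h1, h2, by simpa using h3⟩

def dz (F : RR → ℝ) (p : RR) : ℝ := deriv (fun y => F (p.1, y)) p.2

lemma dz_eq {F : RR → ℝ} {x : RR} (hF : DifferentiableAt ℝ F x) :
    HasDerivAt (fun y => F (x.1, y)) (fderiv ℝ F x (0,1)) x.2 := by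
  have h1 : HasFDerivAt F (fderiv ℝ F x) (x.1, x.2) := hF.hasFDerivAt
  exact h1.comp_hasDerivAt x.2 ((hasDerivAt_const x.2 x.1).prodMk (hasDerivAt_id x.2))

lemma dz_analytic {F : RR → ℝ} {x : RR} (hF : AnalyticAt ℝ F x) : AnalyticAt ℝ (dz F) x := by
  have h1 : AnalyticAt ℝ (fun p => fderiv ℝ F p (0,1)) x := by
    exact AnalyticAt.fun_comp ((ContinuousLinearMap.apply ℝ ℝ ((0:ℝ),(1:ℝ))).analyticAt _) hF.fderiv
  refine h1.congr ?_
  filter_upwards [hF.eventually_analyticAt] with p hp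
  exact (dz_eq hp.differentiableAt).deriv.symm

lemma dzit_analytic {F : RR → ℝ} {x : RR} (hF : AnalyticAt ℝ F x) (m : ℕ) : AnalyticAt ℝ (dz^[m] F) x := by
  induction m generalizing F with
  | zero => exact hF
  | succ m ih => exact ih (dz_analytic hF)

lemma dz_shift (F : RR → ℝ) (h : ℝ → ℝ) (m : ℕ) :
    dz^[m] (fun p => F (p.1, p.2 + h p.1)) = fun p => (dz^[m] F) (p.1, p.2 + h p.1) := by
  induction m generalizing F with
  | zero => rfl
  | succ m ih =>
    rw [Function.iterate_succ_apply, Function.iterate_succ_apply, ← ih]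
    congr 1
    funext p
    simp only [dz]
    exact deriv_comp_add_const (fun y => F (p.1, y)) (h p.1) p.2

lemma dzit_form : ∀ (m : ℕ) (F u : RR → ℝ) (c : ℕ → ℝ → ℝ), AnalyticAt ℝ u 0 → u 0 ≠ 0 →
    (∀ᶠ x in 𝓝 (0:RR), F x = ∑ k ∈ Finset.range (m+1), c k x.1 * x.2 ^ k + x.2 ^ (m+1) * u x) →
    ∃ (a : ℝ) (u' : RR → ℝ), a ≠ 0 ∧ AnalyticAt ℝ u' 0 ∧ u' 0 ≠ 0 ∧
      ∀ᶠ x in 𝓝 (0:RR), (dz^[m] F) x = a * c m x.1 + x.2 * u' x := by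
  intro m
  induction m with
  | zero =>
    intro F u c hu hu0 h
    refine ⟨1, u, one_ne_zero, hu, hu0, ?_⟩
    filter_upwards [h] with x hx
    simp at hx; simpa using hx
  | succ m ih =>
    intro F u c hu hu0 h
    have key : ∀ᶠ x in 𝓝 (0:RR), dz F x = ∑ k ∈ Finset.range (m+1), ((k+1:ℝ) * c (k+1) x.1) * x.2 ^ k +
        x.2 ^ (m+1) * ((m+2) * u x + x.2 * dz u x) := by
      filter_upwards [h.eventually_nhds, hu.eventually_analyticAt] with x hx hux
      have e1 : (fun y => F (x.1, y)) =ᶠ[𝓝 x.2] fun y => ∑ k ∈ Finset.range (m+2), c k x.1 * y ^ k + y ^ (m+2) * u (x.1, y) := by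
        have t : Tendsto (fun y => (x.1, y)) (𝓝 x.2) (𝓝 x) := by
          have : Continuous (fun y : ℝ => ((x.1, y) : RR)) := by fun_prop
          exact this.tendsto' _ _ rfl
        exact t.eventually hx
      have hud := dz_eq hux.differentiableAt
      have hd : HasDerivAt (fun y => ∑ k ∈ Finset.range (m+2), c k x.1 * y ^ k + y ^ (m+2) * u (x.1, y))
          (∑ k ∈ Finset.range (m+2), c k x.1 * (k * x.2 ^ (k-1)) +
            (((m+2:ℕ):ℝ) * x.2 ^ (m+2-1) * u x + x.2 ^ (m+2) * dz u x)) x.2 := by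
        refine HasDerivAt.add ?_ ?_
        · exact HasDerivAt.fun_sum fun k _ => (hasDerivAt_pow k x.2).const_mul _
        · have : dz u x = fderiv ℝ u x (0,1) := hud.deriv
          rw [this]
          exact (hasDerivAt_pow (m+2) x.2).mul hud
      have : dz F x = _ := (e1.deriv_eq).trans hd.deriv
      rw [this, Finset.sum_range_succ']
      simp only [Nat.cast_zero, zero_mul, mul_zero, add_zero, Nat.add_sub_cancel]
      congr 1
      · refine Finset.sum_congr rfl fun k _ => ?_
        push_cast; ring
      · push_cast
        ring
    have hu' : AnalyticAt ℝ (fun x : RR => ((m:ℝ)+2) * u x + x.2 * dz u x) 0 :=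
      (analyticAt_const.mul hu).add (analyticAt_snd.mul (dz_analytic hu))
    have hu0' : (fun x : RR => ((m:ℝ)+2) * u x + x.2 * dz u x) 0 ≠ 0 := by
      simp only [Prod.snd_zero, zero_mul, add_zero]
      exact mul_ne_zero (by positivity) hu0
    obtain ⟨a, u', ha, h1, h2, h3⟩ := ih (dz F) _ (fun k t => (k+1:ℝ) * c (k+1) t) hu' hu0' key
    refine ⟨a * (m+1), u', mul_ne_zero ha (by positivity), h1, h2, ?_⟩
    filter_upwards [h3] with x hx
    rw [Function.iterate_succ_apply, hx]; ring

lemma center_exists {F : RR → ℝ} {m : ℕ} {c : ℕ → ℝ → ℝ} {u : RR → ℝ} (hF : AnalyticAt ℝ F 0)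
    (hw : WDec F (m+1) c u) :
    ∃ h : ℝ → ℝ, AnalyticAt ℝ h 0 ∧ h 0 = 0 ∧ ∀ᶠ t in 𝓝 (0:ℝ), (dz^[m] F) (t, h t) = 0 := by
  obtain ⟨a, u', ha, hu', hu0', he⟩ := dzit_form m F u c hw.hu hw.hu0 hw.eq
  set D := dz^[m] F with hD
  have hDa : AnalyticAt ℝ D 0 := dzit_analytic hF m
  have hD0 : D 0 = 0 := by
    have := he.self_of_nhds
    rw [this]; simp [hw.hc0 m (by omega)]
  have hd : fderiv ℝ D 0 (0,1) = u' 0 := by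
    have h1 := dz_eq hDa.differentiableAt
    have h2 : (fun y => D ((0:RR).1, y)) =ᶠ[𝓝 0] fun y => y * u' (0, y) := by
      filter_upwards [tendsto_slice.eventually he] with y hy
      simp only [hw.hc0 m (by omega), mul_zero, zero_add] at hy
      exact hy
    have h3 : HasDerivAt (fun y : ℝ => y * u' (0, y)) (1 * u' (0,0) + 0 * deriv (fun y => u' (0,y)) 0) 0 :=
      (hasDerivAt_id (0:ℝ)).mul (an_slice (x := (0,0)) hu').differentiableAt.hasDerivAt
    have h4 := h1.unique (h3.congr_of_eventuallyEq h2)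
    rw [h4]; simp; rfl
  have hinv : (fderiv ℝ D 0 ∘L ContinuousLinearMap.inr ℝ ℝ ℝ).IsInvertible := by
    refine ⟨ContinuousLinearEquiv.unitsEquivAut ℝ (Units.mk0 (u' 0) hu0'), ?_⟩
    ext
    simp [hd]
  have cdf : ContDiffAt ℝ ⊤ D 0 := hDa.contDiffAt
  refine ⟨cdf.implicitFunction (by simp) hinv, ?_, cdf.implicitFunction_apply_self _ hinv, ?_⟩
  · exact (cdf.contDiffAt_implicitFunction (by simp) hinv).analyticAt
  · have := cdf.eventually_apply_implicitFunction (by simp) hinv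
    rw [hD0] at this
    exact this

lemma center_coeff {F : RR → ℝ} {m : ℕ} {c : ℕ → ℝ → ℝ} {u : RR → ℝ} {h : ℝ → ℝ}
    (hh : ∀ᶠ t in 𝓝 (0:ℝ), (dz^[m] F) (t, h t) = 0)
    (hw : WDec (fun p => F (p.1, p.2 + h p.1)) (m+1) c u) : ∀ᶠ t in 𝓝 (0:ℝ), c m t = 0 := by
  obtain ⟨a, u', ha, hu', hu0', he⟩ := dzit_form m _ u c hw.hu hw.hu0 hw.eq
  filter_upwards [hh, tendsto_slice1.eventually he] with t h1 h2
  rw [dz_shift] at h2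
  simp only [zero_add, h1, zero_mul, add_zero] at h2
  rcases mul_eq_zero.1 h2.symm with h3 | h3
  · exact absurd h3 ha
  · exact h3

lemma tdiv_exists {F : RR → ℝ} (hF : AnalyticAt ℝ F 0) (h0 : ¬ ∀ᶠ x in 𝓝 (0:RR), F x = 0) :
    ∃ (n : ℕ) (G : RR → ℝ), AnalyticAt ℝ G 0 ∧ (∀ᶠ x in 𝓝 (0:RR), F x = x.1 ^ n * G x) ∧
      ¬ ∀ᶠ z in 𝓝 (0:ℝ), G (0, z) = 0 := by
  by_contra hcon
  push Not at hcon
  have key : ∀ n : ℕ, ∃ G : RR → ℝ, AnalyticAt ℝ G 0 ∧ ∀ᶠ x in 𝓝 (0:RR), F x = x.1 ^ n * G x := by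
    intro n
    induction n with
    | zero => exact ⟨F, hF, by simp⟩
    | succ n ih =>
      obtain ⟨G, hG, hGe⟩ := ih
      have h1 := hcon n G hG hGe
      obtain ⟨G', hG', hGe'⟩ := div_t hG
      refine ⟨G', hG', ?_⟩
      have t2 : Tendsto (fun x : RR => x.2) (𝓝 0) (𝓝 0) := continuous_snd.tendsto' _ _ rfl
      filter_upwards [hGe, hGe', t2.eventually h1] with x a b c
      rw [a, b, c]; ring
  apply h0
  obtain ⟨ε, hε, hball⟩ := Metric.eventually_nhds_iff_ball.1 hF.eventually_analyticAt
  rw [Metric.eventually_nhds_iff_ball]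
  refine ⟨ε, hε, fun w hw => ?_⟩
  have hmem : ∀ s ∈ Icc (0:ℝ) 1, s • w ∈ ball (0:RR) ε := by
    intro s hs
    rw [mem_ball_zero_iff] at hw ⊢
    rw [norm_smul, norm_eq_abs, abs_of_nonneg hs.1]
    exact (mul_le_of_le_one_left (norm_nonneg _) hs.2).trans_lt hw
  have han : AnalyticOnNhd ℝ (fun s : ℝ => F (s • w)) (Icc 0 1) := by
    intro s hs
    exact AnalyticAt.fun_comp (g := F) (f := fun s : ℝ => s • w) (hball _ (hmem s hs)) (analyticAt_id.smul analyticAt_const)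
  have hz : ∀ᶠ s in 𝓝 (0:ℝ), F (s • w) = 0 := by
    by_contra hne
    obtain ⟨m, r, hr, hr0, hre⟩ := order_exists (han 0 (by simp)) hne
    obtain ⟨G, hG, hGe⟩ := key (m+1)
    have t : Tendsto (fun s : ℝ => s • w) (𝓝 0) (𝓝 (0:RR)) := by
      have : Continuous (fun s : ℝ => s • w) := by fun_prop
      exact this.tendsto' _ _ (by simp)
    have e1 : ∀ᶠ s in 𝓝[≠] (0:ℝ), r s = s * (w.1 ^ (m+1) * G (s • w)) := by
      filter_upwards [((t.eventually hGe).and hre).filter_mono nhdsWithin_le_nhds, self_mem_nhdsWithin] with s hs hs0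
      have hs0' : s ≠ 0 := hs0
      have := hs.2.symm.trans hs.1
      apply mul_left_cancel₀ (pow_ne_zero m hs0')
      rw [this]; simp only [Prod.smul_fst, smul_eq_mul]; ring
    have t1 : Tendsto r (𝓝[≠] 0) (𝓝 (r 0)) := hr.continuousAt.tendsto.mono_left nhdsWithin_le_nhds
    have hGc : Tendsto (fun s : ℝ => G (s • w)) (𝓝 0) (𝓝 (G 0)) := hG.continuousAt.tendsto.comp t
    have t2 : Tendsto (fun s : ℝ => s * (w.1 ^ (m+1) * G (s • w))) (𝓝[≠] 0) (𝓝 (0 * (w.1^(m+1) * G 0))) :=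
      (tendsto_id.mul (hGc.const_mul _)).mono_left nhdsWithin_le_nhds
    have := tendsto_nhds_unique (t1.congr' e1) t2
    exact hr0 (by simpa using this)
  have := han.eqOn_zero_of_preconnected_of_eventuallyEq_zero isPreconnected_Icc (by simp : (0:ℝ) ∈ Icc (0:ℝ) 1) hz
    (by simp : (1:ℝ) ∈ Icc (0:ℝ) 1)
  simpa using this

lemma newton {ι : Type*} [Fintype ι] (m : ι → ℕ) (c : ι → ℕ → ℝ → ℝ)
    (hc : ∀ i, ∀ k < m i, AnalyticAt ℝ (c i k) 0) (hc0 : ∀ i, ∀ k < m i, c i k 0 = 0) :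
    ∃ p q : ℕ, 1 ≤ p ∧ 1 ≤ q ∧ ∃ d : ι → ℕ → ℝ → ℝ, (∀ i k, AnalyticAt ℝ (d i k) 0) ∧
      (∀ i, ∀ k < m i, ∀ᶠ s in 𝓝 (0:ℝ), c i k (s ^ q) = s ^ (p * (m i - k)) * d i k s) ∧
      ((∀ i k, d i k = fun _ => 0) ∨ ∃ i, ∃ k < m i, d i k 0 ≠ 0) ∧
      (∀ i, ∀ k < m i, (∀ᶠ t in 𝓝 (0:ℝ), c i k t = 0) → d i k = fun _ => 0) := by
  classical
  have tq : ∀ q : ℕ, 1 ≤ q → Tendsto (fun s : ℝ => s ^ q) (𝓝 0) (𝓝 0) := fun q hq =>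
    (continuous_pow q).tendsto' _ _ (by simp; omega)
  let bad : ι → ℕ → Prop := fun i k => k < m i ∧ ¬ ∀ᶠ t in 𝓝 (0:ℝ), c i k t = 0
  by_cases hb : ∀ i k, ¬ bad i k
  · refine ⟨1, 1, le_rfl, le_rfl, fun _ _ _ => 0, fun _ _ => analyticAt_const, ?_, Or.inl fun _ _ => rfl, fun _ _ _ _ => rfl⟩
    intro i k hk
    have : ∀ᶠ t in 𝓝 (0:ℝ), c i k t = 0 := by
      by_contra h; exact hb i k ⟨hk, h⟩
    filter_upwards [this] with s hs
    simp [hs]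
  push Not at hb
  obtain ⟨i', k', hb⟩ := hb
  have hn : ∀ i k, ∃ (n : ℕ) (r : ℝ → ℝ), bad i k → (1 ≤ n ∧ AnalyticAt ℝ r 0 ∧ r 0 ≠ 0 ∧ ∀ᶠ z in 𝓝 (0:ℝ), c i k z = z ^ n * r z) := by
    intro i k
    by_cases h : bad i k
    · obtain ⟨n, r, h1, h2, h3⟩ := order_exists (hc i k h.1) h.2
      refine ⟨n, r, fun _ => ⟨?_, h1, h2, h3⟩⟩
      rcases Nat.eq_zero_or_pos n with h4 | h4
      · subst h4
        have := h3.self_of_nhds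
        rw [hc0 i k h.1] at this
        exact absurd (by simpa using this.symm) h2
      · exact h4
    · exact ⟨0, fun _ => 0, fun h' => absurd h' h⟩
  choose n r hnr using hn
  let T : Finset (Σ i, Fin (m i)) := Finset.univ.filter fun x => bad x.1 x.2
  have hT : T.Nonempty := ⟨⟨i', ⟨k', hb.1⟩⟩, by simp [T]; exact hb⟩
  obtain ⟨⟨i₀, k₀⟩, hx, hmin⟩ := T.exists_min_image (fun x => (n x.1 x.2 : ℚ) / ((m x.1 - (x.2:ℕ) : ℕ) : ℚ)) hT
  have hb0 : bad i₀ k₀ := by simpa [T] using hx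
  have hq : 1 ≤ m i₀ - (k₀:ℕ) := by have := k₀.2; omega
  have hle : ∀ i k, bad i k → n i₀ k₀ * (m i - k) ≤ n i k * (m i₀ - k₀) := by
    intro i k h
    have := hmin ⟨i, ⟨k, h.1⟩⟩ (by simp [T]; exact h)
    have hq' : 1 ≤ m i - k := by have := h.1; omega
    rw [div_le_div_iff₀ (by exact_mod_cast hq) (by exact_mod_cast hq')] at this
    exact_mod_cast this
  refine ⟨n i₀ k₀, m i₀ - k₀, (hnr _ _ hb0).1, hq, fun i k => if bad i k then
    fun s => s ^ (n i k * (m i₀ - k₀) - n i₀ k₀ * (m i - k)) * r i k (s ^ (m i₀ - (k₀:ℕ))) else fun _ => 0, ?_, ?_, ?_, ?_⟩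
  · intro i k
    beta_reduce
    split_ifs with h
    · refine (analyticAt_id.pow _).mul (AnalyticAt.fun_comp (g := r i k) (f := fun s : ℝ => s ^ (m i₀ - (k₀:ℕ))) ?_ (analyticAt_id.pow _))
      rw [zero_pow (by omega)]
      exact (hnr i k h).2.1
    · exact analyticAt_const
  · intro i k hk
    by_cases h : bad i k
    · filter_upwards [(tq _ hq).eventually (hnr i k h).2.2.2] with s hs
      rw [hs, if_pos h, ← mul_assoc, ← pow_add, Nat.add_sub_cancel' (hle i k h), ← pow_mul, mul_comm (n i k)]
    · have h' : ∀ᶠ t in 𝓝 (0:ℝ), c i k t = 0 := by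
        by_contra h2; exact h ⟨hk, h2⟩
      filter_upwards [(tq _ hq).eventually h'] with s hs
      rw [hs, if_neg h]; simp
  · right
    refine ⟨i₀, k₀, hb0.1, ?_⟩
    beta_reduce
    rw [if_pos hb0]
    rw [mul_comm (n i₀ k₀), Nat.sub_self, pow_zero, one_mul, zero_pow (by omega)]
    exact (hnr _ _ hb0).2.2.1
  · intro i k hk h
    beta_reduce
    rw [if_neg (fun h' : bad i k => h'.2 h)]

open Polynomial in
lemma inner_orders {ι : Type*} [Fintype ι] (m : ι → ℕ) (d : ι → ℕ → ℝ) (u : ι → ℝ) (hu : ∀ i, u i ≠ 0)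
    (hd : ∃ i, ∃ k < m i, d i k ≠ 0) (hc : ∃ i, 1 ≤ m i ∧ d i (m i - 1) = 0) (z₀ : ℝ) :
    ∃ (μ : ι → ℕ) (R : ι → ℝ[X]), (∀ i, (R i).eval 0 ≠ 0) ∧
      (∀ i z, ∑ k ∈ Finset.range (m i), d i k * (z₀ + z) ^ k + (z₀ + z) ^ m i * u i = z ^ μ i * (R i).eval z) ∧
      ∑ i, μ i < ∑ i, m i := by
  let L : ι → ℝ[X] := fun i => ∑ k ∈ Finset.range (m i), C (d i k) * X ^ k
  let Q : ι → ℝ[X] := fun i => L i + C (u i) * X ^ m i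
  have hL : ∀ i, (L i).degree < m i := by
    intro i
    refine (degree_sum_le _ _).trans_lt ?_
    rw [Finset.sup_lt_iff (WithBot.bot_lt_coe _)]
    intro k hk
    exact (degree_C_mul_X_pow_le _ _).trans_lt (by exact_mod_cast Finset.mem_range.1 hk)
  have hco : ∀ i, ∀ k < m i, (Q i).coeff k = d i k := by
    intro i k hk
    simp only [Q, L, coeff_add, finsetSum_coeff, coeff_C_mul, coeff_X_pow, mul_ite, mul_one, mul_zero]
    rw [if_neg (by omega)]
    simp [hk]
  have hdeg : ∀ i, (Q i).natDegree = m i := by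
    intro i
    have h1 : (C (u i) * X ^ m i).degree = ((m i : ℕ) : WithBot ℕ) := degree_C_mul_X_pow _ (hu i)
    have : (Q i).degree = m i := by
      rw [← h1]; exact degree_add_eq_right_of_degree_lt (by rw [h1]; exact hL i)
    exact natDegree_eq_of_degree_eq_some this
  have hlc : ∀ i, (Q i).coeff (m i) = u i := by
    intro i
    have : (L i).coeff (m i) = 0 := coeff_eq_zero_of_degree_lt (hL i)
    simp [Q, this]
  have hQ0 : ∀ i, Q i ≠ 0 := by
    intro i h
    have := hlc i
    rw [h] at this
    exact hu i (by simpa using this.symm)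
  have hex : ∀ i, ∃ R : ℝ[X], Q i = (X - C z₀) ^ (rootMultiplicity z₀ (Q i)) * R ∧ ¬ (X - C z₀) ∣ R := fun i =>
    exists_eq_pow_rootMultiplicity_mul_and_not_dvd (Q i) (hQ0 i) z₀
  choose R hR hRn using hex
  have hR0 : ∀ i, R i ≠ 0 := fun i h => hRn i (h ▸ dvd_zero _)
  have hdegR : ∀ i, m i = rootMultiplicity z₀ (Q i) + (R i).natDegree := by
    intro i
    rw [← hdeg i]
    conv_lhs => rw [hR i]
    rw [natDegree_mul (pow_ne_zero _ (X_sub_C_ne_zero _)) (hR0 i), natDegree_pow, natDegree_X_sub_C, mul_one]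
  refine ⟨fun i => rootMultiplicity z₀ (Q i), fun i => (R i).comp (X + C z₀), ?_, ?_, ?_⟩
  · intro i h
    apply hRn i
    rw [dvd_iff_isRoot]
    simpa [IsRoot, eval_comp] using h
  · intro i z
    have h1 : (Q i).eval (z₀ + z) = ∑ k ∈ Finset.range (m i), d i k * (z₀ + z) ^ k + (z₀ + z) ^ m i * u i := by
      simp only [Q, L, eval_add, eval_finsetSum, eval_mul, eval_C, eval_pow, eval_X]; ring
    rw [← h1]
    conv_lhs => rw [hR i]
    simp [eval_comp, add_comm z z₀]
  · by_contra hcon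
    push Not at hcon
    have hall : ∀ i, rootMultiplicity z₀ (Q i) = m i := by
      have hle : ∀ i ∈ Finset.univ, rootMultiplicity z₀ (Q i) ≤ m i := fun i _ => by have := hdegR i; omega
      have := (Finset.sum_eq_sum_iff_of_le hle).1 (le_antisymm (Finset.sum_le_sum hle) hcon)
      exact fun i => this i (Finset.mem_univ i)
    have hform : ∀ i, ∃ a : ℝ, Q i = (X - C z₀) ^ m i * C a := by
      intro i
      have : (R i).natDegree = 0 := by have := hdegR i; rw [hall i] at this; omega
      refine ⟨(R i).coeff 0, ?_⟩
      rw [← eq_C_of_natDegree_eq_zero this, ← hall i]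
      exact hR i
    choose a ha using hform
    have hcoef : ∀ i k, (Q i).coeff k = (-z₀) ^ (m i - k) * ((m i).choose k : ℝ) * a i := by
      intro i k
      rw [ha i, coeff_mul_C, sub_eq_add_neg, ← C_neg, coeff_X_add_C_pow]
    have hane : ∀ i, a i ≠ 0 := by
      intro i h
      apply hQ0 i
      rw [ha i, h]; simp
    obtain ⟨i₁, hm1, hd1⟩ := hc
    have hz : z₀ = 0 := by
      have h1 := hco i₁ (m i₁ - 1) (by omega)
      rw [hd1, hcoef, show m i₁ - (m i₁ - 1) = 1 by omega] at h1
      have h2 : ((m i₁).choose (m i₁ - 1) : ℝ) ≠ 0 := by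
        have := Nat.choose_pos (show m i₁ - 1 ≤ m i₁ by omega)
        exact_mod_cast this.ne'
      have := hane i₁
      simpa [h2, this] using h1
    obtain ⟨i, k, hk, hne⟩ := hd
    apply hne
    rw [← hco i k hk, hcoef, hz]
    simp; left; left; omega

def Vf (q p m : ℕ) (u : RR → ℝ) (d : ℕ → ℝ → ℝ) (s z : ℝ) : ℝ :=
  u (s ^ q, s ^ p * z) + ∑ k ∈ Finset.range m, d k s * (z⁻¹) ^ (m - k)

def LU (q p : ℕ) (u : RR → ℝ) : RR → ℝ :=
  fun x => q * x.1 * fderiv ℝ u x (1, 0) + p * x.2 * fderiv ℝ u x (0, 1)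

def Dc (d : ℕ → ℝ → ℝ) : ℕ → ℝ → ℝ := fun k s => s * deriv (d k) s

lemma LU_an {q p : ℕ} {u : RR → ℝ} (hu : AnalyticAt ℝ u 0) : AnalyticAt ℝ (LU q p u) 0 := by
  have h1 : ∀ v : RR, AnalyticAt ℝ (fun x => fderiv ℝ u x v) 0 := fun v =>
    AnalyticAt.fun_comp ((ContinuousLinearMap.apply ℝ ℝ v).analyticAt _) hu.fderiv
  exact ((analyticAt_const.mul analyticAt_fst).mul (h1 _)).add ((analyticAt_const.mul analyticAt_snd).mul (h1 _))

lemma LU_zero {q p : ℕ} {u : RR → ℝ} : LU q p u 0 = 0 := by simp [LU]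

lemma Dc_an {d : ℕ → ℝ → ℝ} {k : ℕ} (hd : AnalyticAt ℝ (d k) 0) : AnalyticAt ℝ (Dc d k) 0 :=
  analyticAt_id.mul hd.deriv

lemma Vf_deriv {q p m : ℕ} {u : RR → ℝ} {d : ℕ → ℝ → ℝ} {s z : ℝ} (hs : s ≠ 0) (hq : 1 ≤ q) (hp : 1 ≤ p)
    (hu : DifferentiableAt ℝ u (s ^ q, s ^ p * z)) (hd : ∀ k < m, DifferentiableAt ℝ (d k) s) :
    HasDerivAt (fun s => Vf q p m u d s z) (Vf q p m (LU q p u) (Dc d) s z / s) s := by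
  have h1 : HasDerivAt (fun s : ℝ => ((s ^ q, s ^ p * z) : RR)) (q * s ^ (q-1), p * s ^ (p-1) * z) s :=
    (hasDerivAt_pow q s).prodMk ((hasDerivAt_pow p s).mul_const z)
  have h2 := hu.hasFDerivAt.comp_hasDerivAt s h1
  have h3 : HasDerivAt (fun s => ∑ k ∈ Finset.range m, d k s * (z⁻¹) ^ (m - k))
      (∑ k ∈ Finset.range m, deriv (d k) s * (z⁻¹) ^ (m - k)) s :=
    HasDerivAt.fun_sum fun k hk => ((hd k (Finset.mem_range.1 hk)).hasDerivAt).mul_const _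
  refine (h2.add h3).congr_deriv ?_
  have e : (((q:ℝ) * s ^ (q-1), (p:ℝ) * s ^ (p-1) * z) : RR) = ((q:ℝ) * s ^ (q-1)) • ((1:ℝ),(0:ℝ)) + ((p:ℝ) * s ^ (p-1) * z) • ((0:ℝ),(1:ℝ)) := by
    ext <;> simp
  have eq1 : s ^ q = s ^ (q-1) * s := by rw [← pow_succ, Nat.sub_add_cancel hq]
  have eq2 : s ^ p = s ^ (p-1) * s := by rw [← pow_succ, Nat.sub_add_cancel hp]
  rw [e, map_add, map_smul, map_smul]
  simp only [Vf, LU, Dc, smul_eq_mul]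
  generalize fderiv ℝ u (s ^ q, s ^ p * z) (1,0) = A
  generalize fderiv ℝ u (s ^ q, s ^ p * z) (0,1) = B
  rw [add_div, Finset.sum_div]
  congr 1
  · rw [eq1, eq2]; field_simp
  · exact Finset.sum_congr rfl fun k _ => by field_simp

lemma outer_dom {q p : ℕ} (hq : 1 ≤ q) {Pr : RR → Prop} (h : ∀ᶠ x in 𝓝 (0:RR), Pr x) :
    ∀ᶠ ρ in 𝓝[>] (0:ℝ), ∀ s z : ℝ, 0 < s → s ≤ ρ → |s ^ p * z| ≤ ρ → Pr (s ^ q, s ^ p * z) := by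
  obtain ⟨ε, hε, hb⟩ := Metric.eventually_nhds_iff_ball.1 h
  filter_upwards [Ioo_mem_nhdsGT (show (0:ℝ) < min ε 1 by positivity)] with ρ hρ s z hs hsρ hz
  have h1 : ρ < ε := hρ.2.trans_le (min_le_left _ _)
  have h2 : ρ < 1 := hρ.2.trans_le (min_le_right _ _)
  apply hb
  rw [mem_ball_zero_iff, Prod.norm_mk, max_lt_iff]
  constructor
  · rw [norm_eq_abs, abs_of_pos (by positivity)]
    exact (pow_le_of_le_one hs.le (by linarith) (by omega)).trans_lt (by linarith)
  · rw [norm_eq_abs]; linarith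

lemma outer_s {Pr : ℝ → Prop} (h : ∀ᶠ x in 𝓝 (0:ℝ), Pr x) :
    ∀ᶠ ρ in 𝓝[>] (0:ℝ), ∀ s : ℝ, 0 < s → s ≤ ρ → Pr s := by
  obtain ⟨ε, hε, hb⟩ := Metric.eventually_nhds_iff_ball.1 h
  filter_upwards [Ioo_mem_nhdsGT hε] with ρ hρ s hs hsρ
  apply hb
  rw [mem_ball_zero_iff, norm_eq_abs, abs_of_pos hs]
  linarith [hρ.2]

lemma Vf_small {q p m : ℕ} {u : RR → ℝ} {d : ℕ → ℝ → ℝ} (hq : 1 ≤ q)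
    (hu : ContinuousAt u 0) (hd : ∀ k < m, ContinuousAt (d k) 0) {η : ℝ} (hη : 0 < η) :
    ∀ᶠ ρ in 𝓝[>] (0:ℝ), ∀ s z : ℝ, 0 < s → s ≤ ρ → (ρ⁻¹ < |z| ∨ ∀ k < m, d k = fun _ => 0) → |s ^ p * z| ≤ ρ →
      |Vf q p m u d s z - u 0| ≤ η := by
  have h1 : ∀ᶠ x in 𝓝 (0:RR), |u x - u 0| < η / 2 := by
    have := Metric.continuousAt_iff'.1 hu (η/2) (by positivity)
    simpa [dist_eq] using this
  have h2 : ∀ k ∈ Finset.range m, ∀ᶠ ρ in 𝓝[>] (0:ℝ), ∀ s z : ℝ, 0 < s → s ≤ ρ → (ρ⁻¹ < |z| ∨ ∀ k < m, d k = fun _ => 0) →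
      |d k s * (z⁻¹) ^ (m-k)| ≤ η / (2 * (m+1)) := by
    intro k hk
    have hk' := Finset.mem_range.1 hk
    have h3 : ∀ᶠ x in 𝓝 (0:ℝ), |d k x| < |d k 0| + 1 := (hd k hk').abs.eventually_lt continuousAt_const (by simp)
    have hpos : 0 < min 1 (η / (2 * (m+1)) / (|d k 0| + 1)) := by positivity
    filter_upwards [outer_s h3, Ioo_mem_nhdsGT hpos] with ρ h3 hρ s z hs hsρ hz
    rcases hz with hz | hz
    · have hρ0 : 0 < ρ := hρ.1
      have hz1 : |z⁻¹| ≤ ρ := by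
        rw [abs_inv]; exact inv_le_of_inv_le₀ hρ0 hz.le
      have hρ1 : ρ < 1 := hρ.2.trans_le (min_le_left _ _)
      have hρ2 : ρ < η / (2 * (m+1)) / (|d k 0| + 1) := hρ.2.trans_le (min_le_right _ _)
      rw [lt_div_iff₀ (by positivity)] at hρ2
      rw [abs_mul, abs_pow]
      calc |d k s| * |z⁻¹| ^ (m-k) ≤ (|d k 0| + 1) * |z⁻¹| := by
            gcongr
            · exact (h3 s hs hsρ).le
            · exact pow_le_of_le_one (abs_nonneg _) (by linarith) (by omega)
        _ ≤ (|d k 0| + 1) * ρ := by gcongr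
        _ ≤ _ := by linarith
    · rw [hz k hk']; simp; positivity
  filter_upwards [outer_dom (p := p) hq h1, (Finset.eventually_all (Finset.range m)).2 h2] with ρ h1 h2 s z hs hsρ hz hsz
  have a1 := h1 s z hs hsρ hsz
  have a2 : |∑ k ∈ Finset.range m, d k s * (z⁻¹) ^ (m-k)| ≤ η / 2 := by
    calc _ ≤ ∑ k ∈ Finset.range m, |d k s * (z⁻¹) ^ (m-k)| := Finset.abs_sum_le_sum_abs _ _
      _ ≤ ∑ k ∈ Finset.range m, η / (2 * (m+1)) := Finset.sum_le_sum fun k hk => h2 k hk s z hs hsρ hz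
      _ = m * (η / (2 * (m+1))) := by simp
      _ ≤ η / 2 := by
        rw [mul_div_assoc', div_le_div_iff₀ (by positivity) (by positivity)]
        nlinarith
  unfold Vf
  rw [abs_le] at a2 ⊢
  rw [abs_lt] at a1
  constructor <;> linarith [a1.1, a1.2, a2.1, a2.2]

lemma outer_one {q p m : ℕ} {u : RR → ℝ} {d : ℕ → ℝ → ℝ} (hq : 1 ≤ q) (hp : 1 ≤ p)
    (hu : AnalyticAt ℝ u 0) (hd : ∀ k, AnalyticAt ℝ (d k) 0) {η : ℝ} (hη : 0 < η) :
    ∀ᶠ ρ in 𝓝[>] (0:ℝ), ∀ s z : ℝ, 0 < s → s ≤ ρ → (ρ⁻¹ < |z| ∨ ∀ k < m, d k = fun _ => 0) → |s ^ p * z| ≤ ρ →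
      |Vf q p m u d s z - u 0| ≤ η ∧ |Vf q p m (LU q p u) (Dc d) s z| ≤ η ∧
      |Vf q p m (LU q p (LU q p u)) (Dc (Dc d)) s z| ≤ η ∧
      HasDerivAt (fun s => Vf q p m u d s z) (Vf q p m (LU q p u) (Dc d) s z / s) s ∧
      HasDerivAt (fun s => Vf q p m (LU q p u) (Dc d) s z) (Vf q p m (LU q p (LU q p u)) (Dc (Dc d)) s z / s) s ∧
      ContinuousAt (fun s => Vf q p m (LU q p (LU q p u)) (Dc (Dc d)) s z) s := by
  have hu1 := LU_an (q := q) (p := p) hu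
  have hu2 := LU_an (q := q) (p := p) hu1
  have hd1 : ∀ k, AnalyticAt ℝ (Dc d k) 0 := fun k => Dc_an (hd k)
  have hd2 : ∀ k, AnalyticAt ℝ (Dc (Dc d) k) 0 := fun k => Dc_an (hd1 k)
  have hz : (∀ k < m, d k = fun _ => 0) → ∀ k < m, Dc d k = fun _ => 0 := by
    intro h k hk; funext s; simp [Dc, h k hk]
  have hz2 : (∀ k < m, Dc d k = fun _ => 0) → ∀ k < m, Dc (Dc d) k = fun _ => 0 := by
    intro h k hk; funext s
    show s * deriv (Dc d k) s = 0
    rw [h k hk]; simp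
  have hev : ∀ (w : RR → ℝ) (e : ℕ → ℝ → ℝ), AnalyticAt ℝ w 0 → (∀ k, AnalyticAt ℝ (e k) 0) →
      ∀ᶠ ρ in 𝓝[>] (0:ℝ), ∀ s z : ℝ, 0 < s → s ≤ ρ → |s ^ p * z| ≤ ρ →
        HasDerivAt (fun s => Vf q p m w e s z) (Vf q p m (LU q p w) (Dc e) s z / s) s := by
    intro w e hw he
    have h2 : ∀ k ∈ Finset.range m, ∀ᶠ ρ in 𝓝[>] (0:ℝ), ∀ s : ℝ, 0 < s → s ≤ ρ → AnalyticAt ℝ (e k) s :=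
      fun k _ => outer_s (he k).eventually_analyticAt
    filter_upwards [outer_dom (p := p) hq hw.eventually_analyticAt, (Finset.eventually_all (Finset.range m)).2 h2] with ρ h1 h2 s z hs hsρ hsz
    exact Vf_deriv hs.ne' hq hp (h1 s z hs hsρ hsz).differentiableAt fun k hk => (h2 k (Finset.mem_range.2 hk) s hs hsρ).differentiableAt
  filter_upwards [Vf_small (p := p) hq hu.continuousAt (fun k _ => (hd k).continuousAt) hη,
    Vf_small (p := p) (m := m) hq hu1.continuousAt (fun k _ => (hd1 k).continuousAt) hη,
    Vf_small (p := p) (m := m) hq hu2.continuousAt (fun k _ => (hd2 k).continuousAt) hη,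
    hev _ _ hu hd, hev _ _ hu1 hd1, hev _ _ hu2 hd2] with ρ a1 a2 a3 b1 b2 b3 s z hs hsρ hz0 hsz
  refine ⟨a1 s z hs hsρ hz0 hsz, ?_, ?_, b1 s z hs hsρ hsz, b2 s z hs hsρ hsz, (b3 s z hs hsρ hsz).continuousAt⟩
  · have := a2 s z hs hsρ (hz0.imp_right hz) hsz
    rwa [LU_zero, sub_zero] at this
  · have := a3 s z hs hsρ (hz0.imp_right (fun h => hz2 (hz h))) hsz
    rwa [LU_zero, sub_zero] at this

def EB (T B : ℝ) (A : ℝ → ℝ) : Prop :=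
  ∃ A1 : ℝ → ℝ, (∀ x ∈ Ioc 0 T, HasDerivAt A (A1 x / x) x) ∧ ContinuousOn A1 (Ioc 0 T) ∧
    (∀ x ∈ Ioc 0 T, |A x| ≤ B) ∧ ∀ x ∈ Ioc 0 T, |A1 x| ≤ B

lemma EB.mul {T B B' : ℝ} {A A' : ℝ → ℝ} (hB : 0 ≤ B) (hB' : 0 ≤ B') (h : EB T B A) (h' : EB T B' A') :
    EB T (2 * B * B') (fun x => A x * A' x) := by
  obtain ⟨A1, a1, a2, a3, a4⟩ := h
  obtain ⟨A1', b1, b2, b3, b4⟩ := h'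
  have ca : ContinuousOn A (Ioc 0 T) := fun x hx => (a1 x hx).continuousAt.continuousWithinAt
  have cb : ContinuousOn A' (Ioc 0 T) := fun x hx => (b1 x hx).continuousAt.continuousWithinAt
  refine ⟨fun x => A1 x * A' x + A x * A1' x, fun x hx => ?_, (a2.mul cb).add (ca.mul b2), fun x hx => ?_, fun x hx => ?_⟩
  · exact ((a1 x hx).mul (b1 x hx)).congr_deriv (by ring)
  · rw [abs_mul]
    have := mul_le_mul (a3 x hx) (b3 x hx) (abs_nonneg _) hB
    have : 0 ≤ B * B' := by positivity
    linarith
  · refine (abs_add_le _ _).trans ?_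
    rw [abs_mul, abs_mul]
    have h1 := mul_le_mul (a4 x hx) (b3 x hx) (abs_nonneg _) hB
    have h2 := mul_le_mul (a3 x hx) (b4 x hx) (abs_nonneg _) hB
    linarith

lemma EB.prod {ι : Type*} (s : Finset ι) {K : ι → ℝ} (hK : ∀ i, 0 ≤ K i) :
    ∃ C : ℝ, 0 ≤ C ∧ ∀ T (A : ι → ℝ → ℝ), (∀ i ∈ s, EB T (K i) (A i)) → EB T C (fun x => ∏ i ∈ s, A i x) := by
  classical
  induction s using Finset.induction_on with
  | empty =>
    refine ⟨1, zero_le_one, fun T A _ => ⟨fun _ => 0, fun x _ => ?_, continuousOn_const, by simp, by simp⟩⟩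
    simp; exact hasDerivAt_const _ _
  | insert i s hi ih =>
    obtain ⟨C, hC, h⟩ := ih
    refine ⟨2 * K i * C, by have := hK i; positivity, fun T A hA => ?_⟩
    simp only [Finset.prod_insert hi]
    exact EB.mul (hK i) hC (hA i (by simp)) (h T A fun j hj => hA j (by simp [hj]))

lemma hasDerivAt_absrpow {V : ℝ → ℝ} {V' x γ : ℝ} (hV : HasDerivAt V V' x) (h0 : V x ≠ 0) :
    HasDerivAt (fun s => |V s| ^ γ) (γ * |V x| ^ γ / V x * V') x := by
  have h1 : HasDerivAt (fun s => |V s|) (|V x| / V x * V') x := by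
    rcases lt_or_gt_of_ne h0 with h | h
    · refine (hV.neg.congr_of_eventuallyEq ?_).congr_deriv ?_
      · filter_upwards [hV.continuousAt.eventually_lt continuousAt_const h] with s hs
        exact abs_of_neg hs
      · rw [abs_of_neg h]; field_simp
    · refine (hV.congr_of_eventuallyEq ?_).congr_deriv ?_
      · filter_upwards [hV.continuousAt.eventually_const_lt h] with s hs
        exact abs_of_pos hs
      · rw [abs_of_pos h]; field_simp
  refine (h1.rpow_const (p := γ) (Or.inl (abs_ne_zero.2 h0))).congr_deriv ?_
  rw [rpow_sub_one (abs_ne_zero.2 h0)]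
  have := abs_ne_zero.2 h0
  field_simp

/-- bounds of `|V|^γ` for `V` close to `u ≠ 0` -/
lemma rpow_bds {u : ℝ} (hu : u ≠ 0) (γ : ℝ) : ∃ k K : ℝ, 0 < k ∧ 0 < K ∧ ∀ V : ℝ, |V - u| ≤ |u| / 2 → 
    V ≠ 0 ∧ |u| / 2 ≤ |V| ∧ |V| ≤ 2 * |u| ∧ k ≤ |V| ^ γ ∧ |V| ^ γ ≤ K := by
  have hu' := abs_pos.2 hu
  refine ⟨min ((|u|/2)^γ) ((2*|u|)^γ), max ((|u|/2)^γ) ((2*|u|)^γ), by positivity, by positivity, fun V hV => ?_⟩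
  have h1 : |u| / 2 ≤ |V| := by
    have := abs_sub_abs_le_abs_sub u V
    rw [abs_sub_comm] at this; linarith
  have h2 : |V| ≤ 2 * |u| := by
    have := abs_sub_abs_le_abs_sub V u
    linarith
  refine ⟨fun h => ?_, h1, h2, ?_, ?_⟩
  · rw [h] at h1; simp at h1; linarith [abs_nonneg u]
  · rcases le_total 0 γ with h | h
    · exact (min_le_left _ _).trans (rpow_le_rpow (by positivity) h1 h)
    · exact (min_le_right _ _).trans (rpow_le_rpow_of_nonpos (by linarith) h2 h)
  · rcases le_total 0 γ with h | h
    · exact (rpow_le_rpow (by positivity) h2 h).trans (le_max_right _ _)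
    · exact (rpow_le_rpow_of_nonpos (by positivity) h1 h).trans (le_max_left _ _)

lemma EB.rpow_abs {u : ℝ} (hu : u ≠ 0) (γ : ℝ) : ∃ K : ℝ, 0 ≤ K ∧ ∀ T (V V1 : ℝ → ℝ),
    (∀ x ∈ Ioc 0 T, HasDerivAt V (V1 x / x) x) → ContinuousOn V1 (Ioc 0 T) → (∀ x ∈ Ioc 0 T, |V x - u| ≤ |u|/2) →
    (∀ x ∈ Ioc 0 T, |V1 x| ≤ 1) → EB T K (fun x => |V x| ^ γ) := by
  obtain ⟨k, K, hk, hK, h⟩ := rpow_bds hu γ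
  have hu' := abs_pos.2 hu
  refine ⟨K + |γ| * K * (2 / |u|), by positivity, fun T V V1 h1 h2 h3 h4 => ?_⟩
  have cV : ContinuousOn V (Ioc 0 T) := fun x hx => (h1 x hx).continuousAt.continuousWithinAt
  refine ⟨fun x => γ * |V x| ^ γ / V x * V1 x, fun x hx => ?_, ?_, fun x hx => ?_, fun x hx => ?_⟩
  · exact (hasDerivAt_absrpow (h1 x hx) (h _ (h3 x hx)).1).congr_deriv (by ring)
  · refine ((continuousOn_const.mul (cV.abs.rpow_const fun x hx => Or.inl (abs_ne_zero.2 (h _ (h3 x hx)).1))).div cV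
      fun x hx => (h _ (h3 x hx)).1).mul h2
  · rw [abs_of_nonneg (by positivity)]
    have := (h _ (h3 x hx)).2.2.2.2
    have : 0 ≤ |γ| * K * (2 / |u|) := by positivity
    linarith
  · obtain ⟨a1, a2, a3, a4, a5⟩ := h _ (h3 x hx)
    rw [abs_mul, abs_div, abs_mul, abs_of_nonneg (by positivity : 0 ≤ |V x| ^ γ), div_eq_mul_inv]
    have a6 : |V x|⁻¹ ≤ 2 / |u| := by
      rw [inv_le_comm₀ (by positivity) (by positivity), inv_div]; exact a2
    calc |γ| * |V x| ^ γ * |V x|⁻¹ * |V1 x| ≤ |γ| * K * (2/|u|) * 1 := by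
          gcongr
          exact h4 x hx
      _ ≤ _ := by linarith

def Psi (h : ℝ → ℝ) (p q : ℕ) (x : RR) : RR := (x.1 ^ q, h (x.1 ^ q) + x.1 ^ p * x.2)

lemma psi_fderiv {h : ℝ → ℝ} {p q : ℕ} {x : RR} (hh : DifferentiableAt ℝ h (x.1 ^ q)) :
    ∃ M : RR →L[ℝ] RR, HasFDerivAt (Psi h p q) M x ∧ M.det = q * x.1 ^ (q-1) * x.1 ^ p ∧
      M (1,0) = (q * x.1 ^ (q-1), deriv h (x.1 ^ q) * (q * x.1 ^ (q-1)) + p * x.1 ^ (p-1) * x.2) ∧ M (0,1) = (0, x.1 ^ p) := by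
  let a := (q:ℝ) * x.1 ^ (q-1)
  let b := deriv h (x.1 ^ q) * a + p * x.1 ^ (p-1) * x.2
  have h1 : HasFDerivAt (fun y : RR => y.1) (ContinuousLinearMap.fst ℝ ℝ ℝ) x := hasFDerivAt_fst
  have h2 : HasFDerivAt (fun y : RR => y.2) (ContinuousLinearMap.snd ℝ ℝ ℝ) x := hasFDerivAt_snd
  have h3 : HasFDerivAt (fun y : RR => y.1 ^ q) _ x := (hasDerivAt_pow q x.1).comp_hasFDerivAt x h1
  have h4 := hh.hasDerivAt.comp_hasFDerivAt x h3
  have h5 : HasFDerivAt (fun y : RR => y.1 ^ p) _ x := (hasDerivAt_pow p x.1).comp_hasFDerivAt x h1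
  refine ⟨LinearMap.toContinuousLinearMap (Matrix.toLin (Module.Basis.finTwoProd ℝ) (Module.Basis.finTwoProd ℝ) !![a, 0; b, x.1 ^ p]), ?_, ?_, ?_, ?_⟩
  · rw [Matrix.toLin_finTwoProd_toContinuousLinearMap]
    have h6 : HasFDerivAt (Psi h p q) _ x := h3.prodMk (h4.add (h5.mul h2))
    refine h6.congr_fderiv ?_
    ext <;> simp [b, a]; ring
  · rw [ContinuousLinearMap.det, LinearMap.coe_toContinuousLinearMap, LinearMap.det_toLin, Matrix.det_fin_two_of]
    simp [a]
  · simp [Matrix.toLin_finTwoProd_apply, b, a]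
  · simp [Matrix.toLin_finTwoProd_apply]

lemma psi_inj {h : ℝ → ℝ} {p q : ℕ} (hq : 1 ≤ q) : InjOn (Psi h p q) (Ioi 0 ×ˢ univ) := by
  rintro ⟨s, z⟩ ⟨hs, _⟩ ⟨s', z'⟩ ⟨hs', _⟩ he
  simp only [Psi, Prod.mk.injEq] at he
  have hs0 : (0:ℝ) < s := hs
  have hs0' : (0:ℝ) < s' := hs'
  have e1 : s = s' := (pow_left_inj₀ hs0.le hs0'.le (by omega)).1 he.1
  subst e1
  have : s ^ p * z = s ^ p * z' := by linarith [he.2]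
  rw [mul_left_cancel₀ (pow_ne_zero p hs0.ne') this]

lemma psi_cov {h : ℝ → ℝ} {p q : ℕ} (hq : 1 ≤ q) {A : Set (RR)} (hA : MeasurableSet A)
    (hA0 : ∀ x ∈ A, 0 < x.1 ∧ DifferentiableAt ℝ h (x.1 ^ q)) :
    (∀ f : RR → ℂ, ∫ x in Psi h p q '' A, f x = ∫ x in A, (q * x.1 ^ (q-1) * x.1 ^ p : ℝ) • f (Psi h p q x)) ∧
    (∀ f : RR → ℝ≥0∞, ∫⁻ x in Psi h p q '' A, f x = ∫⁻ x in A, ENNReal.ofReal (q * x.1 ^ (q-1) * x.1 ^ p) * f (Psi h p q x)) := by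
  have hM : ∀ x, ∃ M : RR →L[ℝ] RR, x ∈ A → HasFDerivAt (Psi h p q) M x ∧ M.det = q * x.1 ^ (q-1) * x.1 ^ p := by
    intro x
    by_cases hx : x ∈ A
    · obtain ⟨M, h1, h2, _⟩ := psi_fderiv (p := p) (hA0 x hx).2
      exact ⟨M, fun _ => ⟨h1, h2⟩⟩
    · exact ⟨0, fun h => absurd h hx⟩
  choose M hM using hM
  have hinj : InjOn (Psi h p q) A := (psi_inj hq).mono fun x hx => show x ∈ Ioi 0 ×ˢ univ from ⟨(hA0 x hx).1, mem_univ _⟩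
  have hdet : ∀ x ∈ A, |(M x).det| = q * x.1 ^ (q-1) * x.1 ^ p := fun x hx => by
    rw [(hM x hx).2, abs_of_nonneg]
    have := (hA0 x hx).1
    positivity
  constructor
  · intro f
    rw [integral_image_eq_integral_abs_det_fderiv_smul volume hA (fun x hx => (hM x hx).1.hasFDerivWithinAt) hinj]
    exact setIntegral_congr_fun hA fun x hx => by simp only [hdet x hx]
  · intro f
    rw [lintegral_image_eq_lintegral_abs_det_fderiv_mul volume hA (fun x hx => (hM x hx).1.hasFDerivWithinAt) hinj]
    exact setLIntegral_congr_fun hA fun x hx => by simp only [hdet x hx]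

lemma psi_image {h : ℝ → ℝ} {p q : ℕ} (hq : 1 ≤ q) {ρ : ℝ} (hρ : 0 < ρ) :
    Psi h p q '' (Ioc 0 ρ ×ˢ univ) = Ioc 0 (ρ ^ q) ×ˢ univ := by
  ext ⟨t, z⟩
  simp only [mem_image, mem_prod, mem_Ioc, mem_univ, and_true, Prod.exists, Psi, Prod.mk.injEq]
  constructor
  · rintro ⟨s, w, ⟨h1, h2⟩, rfl, _⟩
    exact ⟨by positivity, by gcongr⟩
  · rintro ⟨h1, h2⟩
    have e : (t ^ ((q:ℝ)⁻¹)) ^ q = t := rpow_inv_natCast_pow h1.le (by omega)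
    have hs : 0 < t ^ ((q:ℝ)⁻¹) := by positivity
    refine ⟨t ^ ((q:ℝ)⁻¹), (z - h t) / (t ^ ((q:ℝ)⁻¹)) ^ p, ⟨hs, ?_⟩, e, ?_⟩
    · by_contra hc
      push Not at hc
      have := pow_lt_pow_left₀ hc hρ.le (show q ≠ 0 by omega)
      rw [e] at this; linarith
    · rw [e]; field_simp; ring

structure EData (ι : Type) where
  F : ι → RR → ℝ
  m : ι → ℕ
  γ : ι → ℝ
  i0 : ι
  b : ℝ
  P : ℕ
  q : ℕ
  S : Set (RR)

structure EData.OK {ι : Type} (D : EData ι) : Prop where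
  an : ∀ i, AnalyticAt ℝ (D.F i) 0
  ord : ∀ i, ∃ r : ℝ → ℝ, ContinuousAt r 0 ∧ r 0 ≠ 0 ∧ ∀ᶠ z in 𝓝 (0:ℝ), D.F i (0, z) = z ^ D.m i * r z
  meas : MeasurableSet D.S
  conn : ∃ ρ > 0, ∀ Z ⊆ Ioo 0 ρ ×ˢ Ioo (-ρ) ρ, IsPreconnected Z → (∀ i, ∀ x ∈ Z, D.F i x ≠ 0) → Z ⊆ D.S ∨ Disjoint Z D.S
  hq : 1 ≤ D.q
  hP : D.q ≤ D.P
  hPq : D.P = D.q → 1 ≤ D.m D.i0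

def EData.wt {ι : Type} [Fintype ι] (D : EData ι) (x : RR) : ℝ :=
  D.S.indicator (fun x => x.1 ^ D.b * ∏ i, |D.F i x| ^ D.γ i) x

def EData.H {ι : Type} (D : EData ι) (T : Bool) (x : RR) : ℝ :=
  if T then |x.1 ^ D.P * D.F D.i0 x| else x.1 ^ D.q

def EData.ph {ι : Type} (D : EData ι) (v1 v2 : ℝ) (x : RR) : ℝ :=
  v1 * x.1 ^ D.q + v2 * (x.1 ^ D.P * D.F D.i0 x)

def Vc (T : Bool) (c0 v1 v2 : ℝ) : Prop := if T then c0 ≤ |v2| else c0 ≤ |v1| ∧ |v2| ≤ 1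

structure Adm (B r : ℝ) (β : RR → ℝ) : Prop where
  cd : ∀ x : RR, 0 < x.1 → ContDiffAt ℝ 1 β x
  b0 : ∀ x : RR, 0 < x.1 → |β x| ≤ B
  b1 : ∀ x : RR, 0 < x.1 → |x.1 * fderiv ℝ β x (1, 0)| ≤ B
  b2 : ∀ x : RR, 0 < x.1 → |fderiv ℝ β x (0, 1)| ≤ B
  supp : ∀ x : RR, 0 < x.1 → (r ≤ x.1 ∨ r ≤ |x.2|) → β x = 0

def Est {ι : Type} [Fintype ι] (D : EData ι) (T : Bool) : Prop :=
  ∀ c0 > (0:ℝ), ∀ r > (0:ℝ), ∃ r' > (0:ℝ), r' ≤ r ∧ ∀ B, 0 ≤ B → ∃ C : ℝ, 0 ≤ C ∧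
    ∀ (lam v1 v2 : ℝ) (β : RR → ℝ), 0 < lam → Vc T c0 v1 v2 → Adm B r' β →
      ‖∫ x in Ioi (0:ℝ) ×ˢ (univ : Set ℝ), ((β x * D.wt x : ℝ) : ℂ) * Complex.exp (Complex.I * ((lam * D.ph v1 v2 x : ℝ) : ℂ))‖ₑ
        ≤ ENNReal.ofReal C * ∫⁻ x in Ioo 0 r ×ˢ Ioo (-r) r, ENNReal.ofReal (D.wt x * gain (lam * D.H T x))

def Ft (m : ℕ) (p q : ℕ) (u : RR → ℝ) (d : ℕ → ℝ → ℝ) (s z : ℝ) : ℝ :=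
  ∑ k ∈ Finset.range m, d k s * z ^ k + z ^ m * u (s ^ q, s ^ p * z)

lemma Ft_eq_Vf {m p q : ℕ} {u : RR → ℝ} {d : ℕ → ℝ → ℝ} {s z : ℝ} (hz : z ≠ 0) :
    Ft m p q u d s z = z ^ m * Vf q p m u d s z := by
  unfold Ft Vf
  rw [mul_add, Finset.mul_sum, add_comm]
  congr 1
  refine Finset.sum_congr rfl fun k hk => ?_
  have hk := Finset.mem_range.1 hk
  rw [inv_pow]
  have : z ^ m = z ^ k * z ^ (m - k) := by rw [← pow_add]; congr 1; omega
  rw [this]; field_simp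

structure Blow {ι : Type} (D : EData ι) (h : ℝ → ℝ) (p q : ℕ) (u : ι → RR → ℝ) (d : ι → ℕ → ℝ → ℝ) : Prop where
  hc : Continuous h
  han : AnalyticAt ℝ h 0
  h0 : h 0 = 0
  hp : 1 ≤ p
  hq : 1 ≤ q
  hu : ∀ i, AnalyticAt ℝ (u i) 0
  hu0 : ∀ i, u i 0 ≠ 0
  hd : ∀ i k, AnalyticAt ℝ (d i k) 0
  hF : ∀ᶠ ρ in 𝓝[>] (0:ℝ), ∀ i, ∀ s z : ℝ, 0 < s → s ≤ ρ → |s ^ p * z| ≤ ρ →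
    D.F i (Psi h p q (s, z)) = s ^ (p * D.m i) * Ft (D.m i) p q (u i) (d i) s z
  dich : (∀ i k, d i k = fun _ => 0) ∨ ((∃ i, ∃ k < D.m i, d i k 0 ≠ 0) ∧ ∃ i, 1 ≤ D.m i ∧ d i (D.m i - 1) 0 = 0)

lemma clamp_exists {h : ℝ → ℝ} (hh : AnalyticAt ℝ h 0) : ∃ h' : ℝ → ℝ, Continuous h' ∧ h' =ᶠ[𝓝 0] h := by
  obtain ⟨ε, hε, hb⟩ := Metric.eventually_nhds_iff_ball.1 hh.eventually_analyticAt
  have hcl : ∀ t : ℝ, max (-(ε/2)) (min (ε/2) t) ∈ ball (0:ℝ) ε := by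
    intro t
    rw [mem_ball_zero_iff, norm_eq_abs, abs_lt]
    constructor
    · exact lt_of_lt_of_le (by linarith) (le_max_left _ _)
    · exact max_lt (by linarith) (lt_of_le_of_lt (min_le_left _ _) (by linarith))
  refine ⟨fun t => h (max (-(ε/2)) (min (ε/2) t)), ?_, ?_⟩
  · rw [continuous_iff_continuousAt]
    intro t
    have h1 : ContinuousAt h (max (-(ε/2)) (min (ε/2) t)) := (hb _ (hcl t)).continuousAt
    have h2 : ContinuousAt (fun t : ℝ => max (-(ε/2)) (min (ε/2) t)) t := by fun_prop
    exact ContinuousAt.comp (g := h) h1 h2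
  · filter_upwards [Ioo_mem_nhds (show -(ε/2) < (0:ℝ) by linarith) (show (0:ℝ) < ε/2 by linarith)] with t ht
    rw [min_eq_right ht.2.le, max_eq_right ht.1.le]

lemma blow_exists {ι : Type} [Fintype ι] {D : EData ι} (hD : D.OK) : ∃ h p q u d, Blow D h p q u d := by
  have hshift : ∀ h : ℝ → ℝ, AnalyticAt ℝ h 0 → h 0 = 0 → ∀ i, ∃ c u, WDec (fun x => D.F i (x.1, x.2 + h x.1)) (D.m i) c u := by
    intro h hh h0 i
    obtain ⟨r, h1, h2, h3⟩ := hD.ord i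
    refine wdec_exists (D.m i) ?_ h1 h2 (by simpa [h0] using h3)
    refine AnalyticAt.fun_comp (g := D.F i) (f := fun x : RR => (x.1, x.2 + h x.1)) ?_ ?_
    · simp [h0]; exact hD.an i
    · refine analyticAt_fst.prod (analyticAt_snd.add ?_)
      exact AnalyticAt.fun_comp (g := h) (f := fun x : RR => x.1) hh analyticAt_fst
  have hmain : ∃ (h : ℝ → ℝ) (c : ι → ℕ → ℝ → ℝ) (u : ι → RR → ℝ), Continuous h ∧ AnalyticAt ℝ h 0 ∧ h 0 = 0 ∧
      (∀ i, WDec (fun x => D.F i (x.1, x.2 + h x.1)) (D.m i) (c i) (u i)) ∧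
      ((∀ i, D.m i = 0) ∨ ∃ i, 1 ≤ D.m i ∧ ∀ᶠ t in 𝓝 (0:ℝ), c i (D.m i - 1) t = 0) := by
    by_cases hM : ∀ i, D.m i = 0
    · choose c u hcu using hshift (fun _ => 0) analyticAt_const rfl
      exact ⟨fun _ => 0, c, u, continuous_const, analyticAt_const, rfl, hcu, Or.inl hM⟩
    · push Not at hM
      obtain ⟨i, hi⟩ := hM
      obtain ⟨m, hm⟩ := Nat.exists_eq_succ_of_ne_zero hi
      obtain ⟨r, h1, h2, h3⟩ := hD.ord i
      obtain ⟨c', u', hw⟩ := wdec_exists (D.m i) (hD.an i) h1 h2 h3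
      rw [hm] at hw
      obtain ⟨h₀, ha, hz, he⟩ := center_exists (hD.an i) hw
      obtain ⟨h, hc, hee⟩ := clamp_exists ha
      have ha' : AnalyticAt ℝ h 0 := ha.congr hee.symm
      have hz' : h 0 = 0 := by rw [hee.self_of_nhds, hz]
      have he' : ∀ᶠ t in 𝓝 (0:ℝ), (dz^[m] (D.F i)) (t, h t) = 0 := by
        filter_upwards [he, hee] with t a b
        rw [b]; exact a
      choose c u hcu using hshift h ha' hz'
      refine ⟨h, c, u, hc, ha', hz', hcu, Or.inr ⟨i, by omega, ?_⟩⟩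
      have := hcu i
      rw [hm] at this ⊢
      exact center_coeff he' this
  obtain ⟨h, c, u, hc, ha, h0, hw, hcen⟩ := hmain
  obtain ⟨p, q, hp, hq, d, hd, hcd, hdich, hz⟩ := newton D.m c (fun i => (hw i).hc) (fun i => (hw i).hc0)
  refine ⟨h, p, q, u, d, hc, ha, h0, hp, hq, fun i => (hw i).hu, fun i => (hw i).hu0, hd, ?_, ?_⟩
  · have e1 : ∀ i, ∀ᶠ ρ in 𝓝[>] (0:ℝ), ∀ s z : ℝ, 0 < s → s ≤ ρ → |s ^ p * z| ≤ ρ →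
        D.F i (Psi h p q (s, z)) = s ^ (p * D.m i) * Ft (D.m i) p q (u i) (d i) s z := by
      intro i
      have h2 : ∀ k ∈ Finset.range (D.m i), ∀ᶠ ρ in 𝓝[>] (0:ℝ), ∀ s : ℝ, 0 < s → s ≤ ρ →
          c i k (s ^ q) = s ^ (p * (D.m i - k)) * d i k s := fun k hk => outer_s (hcd i k (Finset.mem_range.1 hk))
      filter_upwards [outer_dom (p := p) hq (hw i).eq, (Finset.eventually_all _).2 h2] with ρ a1 a2 s z hs hsρ hsz
      have := a1 s z hs hsρ hsz
      rw [show Psi h p q (s, z) = (s ^ q, s ^ p * z + h (s ^ q)) by simp only [Psi, add_comm], this, Ft, mul_add, Finset.mul_sum]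
      congr 1
      · refine Finset.sum_congr rfl fun k hk => ?_
        rw [a2 k hk s hs hsρ]
        have hk := Finset.mem_range.1 hk
        have : p * D.m i = p * (D.m i - k) + p * k := by rw [← mul_add]; congr 1; omega
        rw [this, pow_add, mul_pow, ← pow_mul]; ring
      · rw [mul_pow, ← pow_mul]; ring
    exact eventually_all.2 e1
  · rcases hdich with h1 | h1
    · exact Or.inl h1
    · refine Or.inr ⟨h1, ?_⟩
      rcases hcen with h2 | ⟨i, hi, h2⟩
      · obtain ⟨i, k, hk, _⟩ := h1
        rw [h2 i] at hk; omega
      · refine ⟨i, hi, ?_⟩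
        rw [hz i _ (by omega) h2]

def EData.bl {ι : Type} [Fintype ι] (D : EData ι) (h : ℝ → ℝ) (p q : ℕ) (u : ι → RR → ℝ) (d : ι → ℕ → ℝ → ℝ)
    (z₀ : ℝ) (μ : ι → ℕ) : EData ι where
  F := fun i x => Ft (D.m i) p q (u i) (d i) x.1 (z₀ + x.2)
  m := μ
  γ := D.γ
  i0 := D.i0
  b := q * D.b + p * ∑ i, D.m i * D.γ i + ((q:ℝ) - 1) + p
  P := q * D.P + p * D.m D.i0
  q := D.q * q
  S := {x | Psi h p q (x.1, z₀ + x.2) ∈ D.S}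

lemma psi_cont {h : ℝ → ℝ} (hc : Continuous h) (p q : ℕ) : Continuous (Psi h p q) := by
  unfold Psi; fun_prop

/-- the three transformation identities -/
lemma bl_identities {ι : Type} [Fintype ι] {D : EData ι} {h : ℝ → ℝ} {p q : ℕ} {u : ι → RR → ℝ} {d : ι → ℕ → ℝ → ℝ}
    (hB : Blow D h p q u d) {s z z₀ : ℝ} {μ : ι → ℕ} (hs : 0 < s)
    (hF : ∀ i, D.F i (Psi h p q (s, z₀ + z)) = s ^ (p * D.m i) * Ft (D.m i) p q (u i) (d i) s (z₀ + z)) :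
    (q * s ^ (q-1) * s ^ p) * D.wt (Psi h p q (s, z₀ + z)) = q * (D.bl h p q u d z₀ μ).wt (s, z) ∧
    (∀ v1 v2, D.ph v1 v2 (Psi h p q (s, z₀ + z)) = (D.bl h p q u d z₀ μ).ph v1 v2 (s, z)) ∧
    (∀ T, D.H T (Psi h p q (s, z₀ + z)) = (D.bl h p q u d z₀ μ).H T (s, z)) := by
  have e3 : ∀ i, (Psi h p q (s, z₀ + z)).1 ^ D.P * (s ^ (p * D.m i) * Ft (D.m i) p q (u i) (d i) s (z₀ + z)) =
      s ^ (q * D.P + p * D.m i) * Ft (D.m i) p q (u i) (d i) s (z₀ + z) := by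
    intro i; simp only [Psi]; rw [pow_add, pow_mul s q, mul_assoc]
  have e4 : (Psi h p q (s, z₀ + z)).1 ^ D.q = s ^ (D.q * q) := by rw [Psi, ← pow_mul, mul_comm]
  refine ⟨?_, fun v1 v2 => ?_, fun T => ?_⟩
  · unfold EData.wt
    by_cases hS : Psi h p q (s, z₀ + z) ∈ D.S
    · rw [indicator_of_mem hS, indicator_of_mem (show (s, z) ∈ (D.bl h p q u d z₀ μ).S from hS)]
      simp only [EData.bl, hF, abs_mul]
      have e1 : ∀ i, (|s ^ (p * D.m i)| * |Ft (D.m i) p q (u i) (d i) s (z₀ + z)|) ^ D.γ i =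
          s ^ (p * (D.m i * D.γ i)) * |Ft (D.m i) p q (u i) (d i) s (z₀ + z)| ^ D.γ i := by
        intro i
        rw [mul_rpow (abs_nonneg _) (abs_nonneg _), abs_of_pos (by positivity), ← rpow_natCast, ← rpow_mul hs.le]
        push_cast; rw [mul_assoc]
      simp only [e1]
      rw [Finset.prod_mul_distrib, ← rpow_sum_of_pos hs, ← Finset.mul_sum]
      have e2 : (Psi h p q (s, z₀ + z)).1 ^ D.b = s ^ ((q:ℝ) * D.b) := by
        simp only [Psi]; rw [← rpow_natCast, ← rpow_mul hs.le]
      have e5 : s ^ (q - 1) = s ^ ((q:ℝ) - 1) := by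
        rw [← rpow_natCast, Nat.cast_sub hB.hq]; simp
      have e6 : s ^ p = s ^ (p:ℝ) := (rpow_natCast _ _).symm
      rw [e2, e5, e6, rpow_add hs, rpow_add hs, rpow_add hs]
      ring
    · rw [indicator_of_notMem hS, indicator_of_notMem (show (s, z) ∉ (D.bl h p q u d z₀ μ).S from hS)]; simp
  · unfold EData.ph
    rw [hF, e3, e4]; rfl
  · unfold EData.H
    rw [hF, e3, e4]; rfl

set_option maxHeartbeats 1600000 in
lemma phase_fiber {Q P : ℕ} (hQ : 1 ≤ Q) (hQP : Q < P) {u0 : ℝ} (hu0 : u0 ≠ 0) {c0 : ℝ} (hc0 : 0 < c0) :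
    ∃ K : ℝ, 0 < K ∧ ∀ (T : Bool) (ρ T0 lam v1 v2 k : ℝ) (V V1 V2 : ℝ → ℝ), 0 < lam → Vc T c0 v1 v2 → ρ * K ≤ c0 / 2 →
    (∀ s ∈ Ioc 0 T0, |k| * s ^ P ≤ ρ * s ^ Q) →
    (∀ s ∈ Ioc 0 T0, |V s - u0| ≤ |u0| / 16) → (∀ s ∈ Ioc 0 T0, |V1 s| ≤ |u0| / 16) → (∀ s ∈ Ioc 0 T0, |V2 s| ≤ |u0| / 16) →
    (∀ s ∈ Ioc 0 T0, HasDerivAt V (V1 s / s) s) → (∀ s ∈ Ioc 0 T0, HasDerivAt V1 (V2 s / s) s) → ContinuousOn V2 (Ioc 0 T0) →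
    ∃ φ1 φ2 : ℝ → ℝ, (∀ s ∈ Ioc 0 T0, HasDerivAt (fun s => lam * (v1 * s ^ Q + v2 * (s ^ P * (k * V s)))) (φ1 s / s) s) ∧
      (∀ s ∈ Ioc 0 T0, HasDerivAt φ1 (φ2 s / s) s) ∧ ContinuousOn φ2 (Ioc 0 T0) ∧
      ∀ s ∈ Ioc 0 T0, (if T then c0 * |u0| / 4 else c0 / 2) * (lam * (if T then |k| else 1) * s ^ (if T then (P:ℝ) else (Q:ℝ)))
        ≤ |φ2 s - (if T then (Q:ℝ) else 2 * Q) * φ1 s| := by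
  have hu := abs_pos.2 hu0
  have hP1 : (1:ℝ) ≤ P := by exact_mod_cast (by omega : 1 ≤ P)
  have hQ1 : (1:ℝ) ≤ Q := by exact_mod_cast hQ
  have hQP1 : (Q:ℝ) + 1 ≤ P := by exact_mod_cast hQP
  refine ⟨((P:ℝ)^2 + 2 * Q * P + (2 * P + 2 * Q) + 1) * (2 * |u0|), by positivity, ?_⟩
  intro T ρ T0 lam v1 v2 k V V1 V2 hl hv hρ hk hV hV1 hV2 dV dV1 cV2
  have powd : ∀ (n : ℕ) (s : ℝ), 0 < s → HasDerivAt (fun s : ℝ => s ^ n) (n * s ^ n / s) s := by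
    intro n s hs
    refine (hasDerivAt_pow n s).congr_deriv ?_
    rcases n with _ | n
    · simp
    · rw [Nat.add_sub_cancel, pow_succ]; field_simp
  have cV : ContinuousOn V (Ioc 0 T0) := fun s hs => (dV s hs).continuousAt.continuousWithinAt
  have cV1 : ContinuousOn V1 (Ioc 0 T0) := fun s hs => (dV1 s hs).continuousAt.continuousWithinAt
  refine ⟨fun s => lam * (v1 * (Q * s ^ Q) + v2 * (k * (s ^ P * (P * V s + V1 s)))),
    fun s => lam * (v1 * (Q * (Q * s ^ Q)) + v2 * (k * (s ^ P * (P ^ 2 * V s + 2 * P * V1 s + V2 s)))), ?_, ?_, by fun_prop, ?_⟩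
  · intro s hs
    have a := (((powd Q s hs.1).const_mul v1).add (((powd P s hs.1).mul ((dV s hs).const_mul k)).const_mul v2)).const_mul lam
    exact a.congr_deriv (by ring)
  · intro s hs
    have b := ((dV s hs).const_mul (P:ℝ)).add (dV1 s hs)
    have a := ((((powd Q s hs.1).const_mul (Q:ℝ)).const_mul v1).add ((((powd P s hs.1).mul b).const_mul k).const_mul v2)).const_mul lam
    exact a.congr_deriv (by simp only [Pi.add_apply]; ring)
  · intro s hs
    have hs0 := hs.1
    have a0 := abs_le.1 (hV s hs)
    have a1 := abs_le.1 (hV1 s hs)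
    have a2 := abs_le.1 (hV2 s hs)
    have b0 : 15/16 * |u0| ≤ |V s| := by
      have := abs_sub_abs_le_abs_sub u0 (V s); rw [abs_sub_comm] at this; linarith [hV s hs]
    have b0' : |V s| ≤ 2 * |u0| := by
      have := abs_sub_abs_le_abs_sub (V s) u0; linarith [hV s hs]
    cases T with
    | true =>
      simp only [Vc, if_true] at hv ⊢
      rw [rpow_natCast]
      have e : lam * (v1 * (Q * (Q * s ^ Q)) + v2 * (k * (s ^ P * (P ^ 2 * V s + 2 * P * V1 s + V2 s)))) -
          Q * (lam * (v1 * (Q * s ^ Q) + v2 * (k * (s ^ P * (P * V s + V1 s))))) =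
          lam * (v2 * (k * (s ^ P * ((P * (P - Q)) * V s - (-((2 * P - Q) * V1 s + V2 s)))))) := by ring
      rw [e, abs_mul, abs_mul, abs_mul, abs_mul, abs_of_pos hl, abs_of_pos (pow_pos hs0 P)]
      have lb : |u0| / 4 ≤ |(P * (P - Q)) * V s - (-((2 * P - Q) * V1 s + V2 s))| := by
        refine le_trans ?_ (abs_sub_abs_le_abs_sub _ _)
        rw [abs_mul, abs_of_nonneg (show (0:ℝ) ≤ P * (P - Q) by nlinarith), abs_neg]
        have t1 : |(2 * P - Q) * V1 s + V2 s| ≤ (2 * P) * (|u0| / 16) + |u0| / 16 := by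
          refine (abs_add_le _ _).trans (add_le_add ?_ (hV2 s hs))
          rw [abs_mul, abs_of_nonneg (show (0:ℝ) ≤ 2 * P - Q by linarith)]
          exact mul_le_mul (by linarith) (hV1 s hs) (abs_nonneg _) (by linarith)
        have t2 : (P:ℝ) * (15/16 * |u0|) ≤ P * (P - Q) * |V s| := by
          have : (P:ℝ) * 1 ≤ P * (P - Q) := by gcongr; linarith
          rw [mul_one] at this
          exact mul_le_mul this b0 (by positivity) (by nlinarith)
        nlinarith
      calc c0 * |u0| / 4 * (lam * |k| * s ^ P) = lam * (c0 * (|k| * (s ^ P * (|u0| / 4)))) := by ring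
        _ ≤ _ := by gcongr
    | false =>
      simp only [Vc, Bool.false_eq_true, if_false] at hv ⊢
      rw [rpow_natCast]
      have e : lam * (v1 * (Q * (Q * s ^ Q)) + v2 * (k * (s ^ P * (P ^ 2 * V s + 2 * P * V1 s + V2 s)))) -
          2 * Q * (lam * (v1 * (Q * s ^ Q) + v2 * (k * (s ^ P * (P * V s + V1 s))))) =
          lam * (v2 * (k * (s ^ P * ((P ^ 2 - 2 * Q * P) * V s + (2 * P - 2 * Q) * V1 s + V2 s))) - v1 * (Q ^ 2 * s ^ Q)) := by ring
      rw [e, abs_mul, abs_of_pos hl]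
      have ub : |(P ^ 2 - 2 * Q * P) * V s + (2 * P - 2 * Q) * V1 s + V2 s| ≤ ((P:ℝ)^2 + 2 * Q * P + (2 * P + 2 * Q) + 1) * (2 * |u0|) := by
        have c0 : (0:ℝ) ≤ Q * P := by positivity
        have c1 : |((P:ℝ) ^ 2 - 2 * Q * P)| ≤ (P:ℝ) ^ 2 + 2 * Q * P := abs_le.2 ⟨by nlinarith, by nlinarith⟩
        have c2 : |(2 * (P:ℝ) - 2 * Q)| ≤ 2 * (P:ℝ) + 2 * Q := abs_le.2 ⟨by nlinarith, by nlinarith⟩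
        refine (abs_add_three _ _ _).trans ?_
        rw [abs_mul, abs_mul]
        have := mul_le_mul c1 b0' (abs_nonneg _) (by positivity)
        have := mul_le_mul c2 (show |V1 s| ≤ 2 * |u0| by linarith [hV1 s hs]) (abs_nonneg _) (by positivity)
        have := hV2 s hs
        linarith
      set K : ℝ := ((P:ℝ)^2 + 2 * Q * P + (2 * P + 2 * Q) + 1) * (2 * |u0|)
      have hK : 0 < K := by positivity
      have u1 : |v2 * (k * (s ^ P * ((P ^ 2 - 2 * Q * P) * V s + (2 * P - 2 * Q) * V1 s + V2 s)))| ≤ c0 / 2 * s ^ Q := by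
        rw [abs_mul, abs_mul, abs_mul, abs_of_pos (pow_pos hs0 P)]
        calc _ ≤ 1 * (|k| * (s ^ P * K)) := by gcongr; exact hv.2
          _ = (|k| * s ^ P) * K := by ring
          _ ≤ (ρ * s ^ Q) * K := mul_le_mul_of_nonneg_right (hk s hs) hK.le
          _ = (ρ * K) * s ^ Q := by ring
          _ ≤ _ := by gcongr
      have u2 : c0 * s ^ Q ≤ |v1 * (Q ^ 2 * s ^ Q)| := by
        rw [abs_mul, abs_of_pos (show (0:ℝ) < Q ^ 2 * s ^ Q by positivity)]
        calc c0 * s ^ Q = c0 * (1 ^ 2 * s ^ Q) := by ring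
          _ ≤ _ := by gcongr; exact hv.1
      have := abs_sub_abs_le_abs_sub (v1 * (Q ^ 2 * s ^ Q)) (v2 * (k * (s ^ P * ((P ^ 2 - 2 * Q * P) * V s + (2 * P - 2 * Q) * V1 s + V2 s))))
      rw [abs_sub_comm] at this
      calc c0 / 2 * (lam * 1 * s ^ Q) = lam * (c0 * s ^ Q - c0 / 2 * s ^ Q) := by ring
        _ ≤ _ := by gcongr; linarith

lemma EB.mono {T B B' : ℝ} {A : ℝ → ℝ} (h : EB T B A) (hB : B ≤ B') : EB T B' A := by
  obtain ⟨A1, a1, a2, a3, a4⟩ := h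
  exact ⟨A1, a1, a2, fun x hx => (a3 x hx).trans hB, fun x hx => (a4 x hx).trans hB⟩

lemma clm_pair (L : RR →L[ℝ] ℝ) (a b : ℝ) : L (a, b) = a * L (1, 0) + b * L (0, 1) := by
  have e : ((a, b) : RR) = a • ((1:ℝ),(0:ℝ)) + b • ((0:ℝ),(1:ℝ)) := by ext <;> simp
  rw [e, map_add, map_smul, map_smul, smul_eq_mul, smul_eq_mul]

lemma beta_EB {h : ℝ → ℝ} {p q : ℕ} (hp : 1 ≤ p) (hq : 1 ≤ q) {B r T0 z : ℝ} (hB : 0 ≤ B) {β : RR → ℝ} (hβ : Adm B r β)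
    (hh : ∀ s ∈ Ioc 0 T0, AnalyticAt ℝ h (s ^ q) ∧ |s ^ q * deriv h (s ^ q)| ≤ 1) (hz : ∀ s ∈ Ioc 0 T0, |s ^ p * z| ≤ 1) :
    EB T0 ((2 * q + p + 1) * B) (fun s => β (Psi h p q (s, z))) := by
  have key : ∀ s ∈ Ioc 0 T0, HasDerivAt (fun s => β (Psi h p q (s, z)))
      ((q * s ^ q * fderiv ℝ β (Psi h p q (s, z)) (1,0) + (q * (s ^ q * deriv h (s ^ q)) + p * (s ^ p * z)) * fderiv ℝ β (Psi h p q (s, z)) (0,1)) / s) s := by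
    intro s hs
    have hs0 := hs.1
    obtain ⟨M, h1, _, h2, _⟩ := psi_fderiv (p := p) (x := (s, z)) (hh s hs).1.differentiableAt
    have h3 : HasDerivAt (fun s : ℝ => (s, z)) (1, 0) s := (hasDerivAt_id s).prodMk (hasDerivAt_const s z)
    have h4 := h1.comp_hasDerivAt s h3
    have h5 := (hβ.cd (Psi h p q (s, z)) (pow_pos hs0 q)).differentiableAt (by simp)
    have h6 := h5.hasFDerivAt.comp_hasDerivAt s h4
    refine h6.congr_deriv ?_
    rw [h2]
    rw [clm_pair]
    have eq1 : s ^ q = s ^ (q-1) * s := by rw [← pow_succ, Nat.sub_add_cancel hq]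
    have eq2 : s ^ p = s ^ (p-1) * s := by rw [← pow_succ, Nat.sub_add_cancel hp]
    generalize fderiv ℝ β (Psi h p q (s, z)) (1,0) = A
    generalize fderiv ℝ β (Psi h p q (s, z)) (0,1) = A'
    generalize deriv h _ = A''
    simp only
    rw [eq1, eq2]; field_simp
  refine ⟨_, key, ?_, fun s hs => ?_, fun s hs => ?_⟩
  · have ch : ContinuousOn (fun s => h (s ^ q)) (Ioc 0 T0) := fun s hs =>
      (ContinuousAt.comp (g := h) (f := fun s => s ^ q) (hh s hs).1.continuousAt (continuous_pow q).continuousAt).continuousWithinAt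
    have ch' : ContinuousOn (fun s => deriv h (s ^ q)) (Ioc 0 T0) := fun s hs =>
      (ContinuousAt.comp (g := deriv h) (f := fun s => s ^ q) (hh s hs).1.deriv.continuousAt (continuous_pow q).continuousAt).continuousWithinAt
    have cP : ContinuousOn (fun s => Psi h p q (s, z)) (Ioc 0 T0) := by
      unfold Psi
      exact (continuous_pow q).continuousOn.prodMk (ch.add (by fun_prop))
    have cf : ∀ v : RR, ContinuousOn (fun s => fderiv ℝ β (Psi h p q (s, z)) v) (Ioc 0 T0) := by
      intro v s hs
      have := (hβ.cd (Psi h p q (s, z)) (pow_pos hs.1 q)).continuousAt_fderiv (by simp)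
      have h2 : ContinuousAt (fun y => fderiv ℝ β y v) (Psi h p q (s, z)) := this.clm_apply continuousAt_const
      exact ContinuousAt.comp_continuousWithinAt (g := fun y => fderiv ℝ β y v) (f := fun s => Psi h p q (s, z)) h2 (cP s hs)
    have := cf (1,0)
    have := cf (0,1)
    fun_prop
  · have := hβ.b0 (Psi h p q (s, z)) (pow_pos hs.1 q)
    nlinarith [show (0:ℝ) ≤ q from by positivity, show (0:ℝ) ≤ p from by positivity]
  · have hpos : 0 < (Psi h p q (s, z)).1 := pow_pos hs.1 q
    have t1 := hβ.b1 _ hpos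
    have t2 := hβ.b2 _ hpos
    have t3 := (hh s hs).2
    have t4 := hz s hs
    generalize fderiv ℝ β (Psi h p q (s, z)) (1,0) = a at *
    generalize fderiv ℝ β (Psi h p q (s, z)) (0,1) = a' at *
    rw [show (Psi h p q (s, z)).1 = s ^ q from rfl] at t1
    rw [mul_assoc]
    refine (abs_add_le _ _).trans ?_
    rw [abs_mul (q:ℝ) (s ^ q * a), abs_mul _ a']
    have t5 : |(q:ℝ) * (s ^ q * deriv h (s ^ q)) + p * (s ^ p * z)| ≤ q * 1 + p * 1 := by
      refine (abs_add_le _ _).trans ?_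
      rw [abs_mul (q:ℝ), abs_mul (p:ℝ), Nat.abs_cast, Nat.abs_cast]
      gcongr
    have t6 := mul_le_mul t5 t2 (abs_nonneg _) (by positivity)
    rw [Nat.abs_cast]
    have : (q:ℝ) * |s ^ q * a| ≤ q * B := by gcongr
    nlinarith

lemma k_small {z s ρ : ℝ} {P qd p q m0 : ℕ} (hq : 1 ≤ q) (hP : qd ≤ P) (hPq : P = qd → 1 ≤ m0) (hs : 0 < s) (hsρ : s ≤ ρ) (hρ : ρ ≤ 1)
    (hz : |s ^ p * z| ≤ ρ) : |z ^ m0| * s ^ (q * P + p * m0) ≤ ρ * s ^ (qd * q) := by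
  have e : |z ^ m0| * s ^ (q * P + p * m0) = |s ^ p * z| ^ m0 * s ^ (q * P) := by
    rw [abs_mul, mul_pow, abs_of_pos (pow_pos hs p), pow_add, abs_pow, ← pow_mul]; ring
  rw [e, mul_comm qd q]
  have hs1 : s ≤ 1 := hsρ.trans hρ
  have hρ0 : 0 ≤ ρ := hs.le.trans hsρ
  rcases Nat.eq_zero_or_pos m0 with h0 | h0
  · have hlt : qd < P := lt_of_le_of_ne hP fun h => by have := hPq h.symm; omega
    rw [h0, pow_zero, one_mul]
    have : q * qd + 1 ≤ q * P := by nlinarith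
    calc s ^ (q * P) ≤ s ^ (q * qd + 1) := pow_le_pow_of_le_one hs.le hs1 this
      _ = s * s ^ (q * qd) := by ring
      _ ≤ _ := by gcongr
  · have h1 : |s ^ p * z| ^ m0 ≤ ρ :=
      (pow_le_of_le_one (abs_nonneg _) (hz.trans hρ) (by omega)).trans hz
    have h2 : s ^ (q * P) ≤ s ^ (q * qd) := pow_le_pow_of_le_one hs.le hs1 (by gcongr)
    exact mul_le_mul h1 h2 (by positivity) hρ0

lemma h_small {h : ℝ → ℝ} (han : AnalyticAt ℝ h 0) (h0 : h 0 = 0) {q : ℕ} (hq : 1 ≤ q) {c : ℝ} (hc : 0 < c) :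
    ∀ᶠ ρ in 𝓝[>] (0:ℝ), ∀ s, 0 < s → s ≤ ρ → AnalyticAt ℝ h (s ^ q) ∧ |s ^ q * deriv h (s ^ q)| ≤ 1 ∧ |h (s ^ q)| < c ∧ s ^ q < c := by
  have t1 : Tendsto (fun t => |t * deriv h t|) (𝓝 0) (𝓝 0) := by
    have : ContinuousAt (fun t => |t * deriv h t|) 0 := (continuousAt_id.mul han.deriv.continuousAt).abs
    simpa [ContinuousAt] using this
  have t2 : Tendsto (fun t => |h t|) (𝓝 0) (𝓝 0) := by
    have : ContinuousAt (fun t => |h t|) 0 := han.continuousAt.abs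
    simpa [ContinuousAt, h0] using this
  have t3 : ∀ᶠ t in 𝓝 (0:ℝ), AnalyticAt ℝ h t ∧ |t * deriv h t| ≤ 1 ∧ |h t| < c ∧ t < c :=
    han.eventually_analyticAt.and (((t1.eventually (gt_mem_nhds zero_lt_one)).mono fun t ht => ht.le).and
      ((t2.eventually (gt_mem_nhds hc)).and (gt_mem_nhds hc)))
  have t4 : Tendsto (fun s : ℝ => s ^ q) (𝓝 0) (𝓝 0) := by
    have := (continuous_pow q).tendsto (0:ℝ)
    simpa [show q ≠ 0 by omega] using this
  exact outer_s (t4.eventually t3)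

set_option maxHeartbeats 1600000 in
lemma fiber_est {ι : Type} [Fintype ι] {D : EData ι} (hD : D.OK) {h : ℝ → ℝ} {p q : ℕ} {u : ι → RR → ℝ} {d : ι → ℕ → ℝ → ℝ}
    (hB : Blow D h p q u d) (T : Bool) {c0 : ℝ} (hc0 : 0 < c0) (μ : ι → ℕ) :
    ∀ᶠ ρ in 𝓝[>] (0:ℝ), ∀ B, 0 ≤ B → ∃ C : ℝ, 0 ≤ C ∧ ∀ (lam v1 v2 r T0 z : ℝ) (β : RR → ℝ), 0 < lam → Vc T c0 v1 v2 →
      Adm B r β → z ≠ 0 → (ρ⁻¹ < |z| ∨ ∀ i k, d i k = fun _ => 0) → 0 < T0 → (∀ s ∈ Ioc 0 T0, s ≤ ρ ∧ |s ^ p * z| ≤ ρ) →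
      ‖∫ s in Ioc 0 T0, ((β (Psi h p q (s, z)) * (D.bl h p q u d 0 μ).wt (s, z) : ℝ) : ℂ) *
          Complex.exp (Complex.I * ((lam * (D.bl h p q u d 0 μ).ph v1 v2 (s, z) : ℝ) : ℂ))‖ₑ
        ≤ ENNReal.ofReal C * ∫⁻ s in Ioc 0 T0, ENNReal.ofReal ((D.bl h p q u d 0 μ).wt (s, z) * gain (lam * (D.bl h p q u d 0 μ).H T (s, z))) := by
  set P' := q * D.P + p * D.m D.i0 with hP'
  set Q' := D.q * q with hQ'
  have hQ1 : 1 ≤ Q' := Nat.mul_pos hD.hq hB.hq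
  have hQP : Q' < P' := by
    have h1 := hD.hP; have h2 := hB.hq; have h3 := hB.hp
    rcases Nat.eq_or_lt_of_le h1 with h | h
    · have := hD.hPq h.symm
      have : 1 ≤ p * D.m D.i0 := Nat.mul_pos h3 this
      rw [hQ', hP', h, mul_comm]; omega
    · have : q * D.q < q * D.P := Nat.mul_lt_mul_of_pos_left h (by omega)
      rw [hQ', hP', mul_comm]; omega
  obtain ⟨K, hK, hphase⟩ := phase_fiber hQ1 hQP (hB.hu0 D.i0) hc0
  obtain ⟨ρc, hρc, hconn⟩ := hD.conn
  have hη : ∀ i, 0 < min 1 (|u i 0| / 16) := fun i => lt_min one_pos (by have := abs_pos.2 (hB.hu0 i); positivity)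
  have ev1 := eventually_all.2 fun i => outer_one (m := D.m i) hB.hq hB.hp (hB.hu i) (hB.hd i) (hη i)
  have ev2 := h_small hB.han hB.h0 hB.hq (half_pos hρc)
  choose Kr hKr0 hKr using fun i => EB.rpow_abs (hB.hu0 i) (D.γ i)
  obtain ⟨Cp, hCp0, hCp⟩ := EB.prod (Finset.univ : Finset ι) hKr0
  choose kl ku hkl hku hbd using fun i => rpow_bds (hB.hu0 i) (D.γ i)
  have hu00 := abs_pos.2 (hB.hu0 D.i0)
  have hcc : 0 < (if T then c0 * |u D.i0 0| / 4 else c0 / 2) := by split_ifs <;> positivity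
  obtain ⟨CA, hCA, hlem⟩ := lemA (D.bl h p q u d 0 μ).b (if T then (Q':ℝ) else 2 * Q') (if T then (P':ℝ) else (Q':ℝ)) _ hcc
  have hmin : 0 < min (min 1 (ρc/2)) (c0 / 2 / K) := by positivity
  filter_upwards [hB.hF, ev1, ev2, Ioo_mem_nhdsGT hmin] with ρ hF hV hh hρ
  obtain ⟨hρ0, hρ1⟩ := hρ
  simp only [lt_min_iff] at hρ1
  obtain ⟨⟨hρ1, hρ2⟩, hρ3⟩ := hρ1
  have hρK : ρ * K ≤ c0 / 2 := by rw [lt_div_iff₀ hK] at hρ3; exact hρ3.le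
  intro B hB0
  set k0 : ℝ := ∏ i, kl i with hk0
  have hk0p : 0 < k0 := Finset.prod_pos fun i _ => hkl i
  set cg : ℝ := max 1 (2 * |u D.i0 0|) with hcg
  have hcg1 : 1 ≤ cg := le_max_left _ _
  set BB : ℝ := 2 * ((2 * q + p + 1) * B) * Cp with hBB
  have hBB0 : 0 ≤ BB := by positivity
  refine ⟨CA * BB * (k0⁻¹ * cg), by positivity, ?_⟩
  intro lam v1 v2 r T0 z β hl hv hβ hz hzc hT0 hfib
  set V : ι → ℝ → ℝ := fun i s => Vf q p (D.m i) (u i) (d i) s z with hVd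
  have hzc' : ∀ i, (ρ⁻¹ < |z| ∨ ∀ k < D.m i, d i k = fun _ => 0) := fun i => hzc.imp id fun h k _ => h i k
  have HV := fun i s (hs : s ∈ Ioc 0 T0) => hV i s z hs.1 (hfib s hs).1 (hzc' i) (hfib s hs).2
  have hV16 : ∀ i, ∀ s ∈ Ioc 0 T0, |V i s - u i 0| ≤ |u i 0| / 16 := fun i s hs => (HV i s hs).1.trans (min_le_right _ _)
  have hVh : ∀ i, ∀ s ∈ Ioc 0 T0, |V i s - u i 0| ≤ |u i 0| / 2 := fun i s hs =>
    (hV16 i s hs).trans (by have := abs_nonneg (u i 0); linarith)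
  have hFt : ∀ i s, Ft (D.m i) p q (u i) (d i) s (0 + z) = z ^ D.m i * V i s := fun i s => by rw [zero_add, Ft_eq_Vf hz]
  -- connectedness
  have himg : (fun s => Psi h p q (s, z)) '' Ioc 0 T0 ⊆ Ioo 0 ρc ×ˢ Ioo (-ρc) ρc := by
    rintro _ ⟨s, hs, rfl⟩
    obtain ⟨a1, a2, a3, a4⟩ := hh s hs.1 (hfib s hs).1
    have a5 := abs_le.1 (hfib s hs).2
    have a6 := abs_lt.1 a3
    refine ⟨⟨pow_pos hs.1 q, ?_⟩, ?_, ?_⟩ <;> simp only [Psi] <;> linarith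
  have hdi := hconn _ himg (isPreconnected_Ioc.image _ ((psi_cont hB.hc p q).comp (by fun_prop)).continuousOn) (by
    rintro i _ ⟨s, hs, rfl⟩
    have e := hF i s z hs.1 (hfib s hs).1 (hfib s hs).2
    simp only
    rw [e, Ft_eq_Vf hz]
    exact mul_ne_zero (pow_ne_zero _ hs.1.ne') (mul_ne_zero (pow_ne_zero _ hz) (hbd i _ (hVh i s hs)).1))
  rcases hdi with hin | hout
  swap
  · have : ∀ s ∈ Ioc 0 T0, (D.bl h p q u d 0 μ).wt (s, z) = 0 := by
      intro s hs
      unfold EData.wt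
      refine indicator_of_notMem ?_ _
      intro hmem
      have hmem : Psi h p q (s, 0 + z) ∈ D.S := hmem
      rw [zero_add] at hmem
      exact Set.disjoint_left.1 hout ⟨s, hs, rfl⟩ hmem
    rw [setIntegral_congr_fun measurableSet_Ioc (g := fun _ => 0) (fun s hs => by simp [this s hs])]
    simp
  set Z : ℝ := ∏ i, |z ^ D.m i| ^ D.γ i with hZ
  have hZ0 : 0 ≤ Z := Finset.prod_nonneg fun i _ => by positivity
  have hwt : ∀ s ∈ Ioc 0 T0, (D.bl h p q u d 0 μ).wt (s, z) = Z * (s ^ (D.bl h p q u d 0 μ).b * ∏ i, |V i s| ^ D.γ i) := by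
    intro s hs
    have hmem : (s, z) ∈ (D.bl h p q u d 0 μ).S := by
      show Psi h p q (s, 0 + z) ∈ D.S
      rw [zero_add]; exact hin ⟨s, hs, rfl⟩
    unfold EData.wt
    rw [indicator_of_mem hmem]
    have : ∀ i, |(D.bl h p q u d 0 μ).F i (s, z)| ^ (D.bl h p q u d 0 μ).γ i = |z ^ D.m i| ^ D.γ i * |V i s| ^ D.γ i := by
      intro i
      show |Ft (D.m i) p q (u i) (d i) s (0 + z)| ^ D.γ i = _
      rw [hFt, abs_mul, mul_rpow (abs_nonneg _) (abs_nonneg _)]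
    simp only [this]
    rw [Finset.prod_mul_distrib]; ring
  have hph : ∀ s, lam * (D.bl h p q u d 0 μ).ph v1 v2 (s, z) = lam * (v1 * s ^ Q' + v2 * (s ^ P' * (z ^ D.m D.i0 * V D.i0 s))) := by
    intro s
    show lam * (v1 * s ^ Q' + v2 * (s ^ P' * Ft (D.m D.i0) p q (u D.i0) (d D.i0) s (0 + z))) = _
    rw [hFt]
  obtain ⟨φ1, φ2, f1, f2, f3, f4⟩ := hphase T ρ T0 lam v1 v2 (z ^ D.m D.i0) (V D.i0) _ _ hl hv hρK
    (fun s hs => k_small hB.hq hD.hP hD.hPq hs.1 (hfib s hs).1 hρ1.le (hfib s hs).2) (hV16 D.i0)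
    (fun s hs => (HV D.i0 s hs).2.1.trans (min_le_right _ _)) (fun s hs => (HV D.i0 s hs).2.2.1.trans (min_le_right _ _))
    (fun s hs => (HV D.i0 s hs).2.2.2.1) (fun s hs => (HV D.i0 s hs).2.2.2.2.1)
    (fun s hs => (HV D.i0 s hs).2.2.2.2.2.continuousWithinAt)
  have hEB1 := beta_EB (h := h) hB.hp hB.hq (T0 := T0) (z := z) hB0 hβ (fun s hs => ⟨(hh s hs.1 (hfib s hs).1).1, (hh s hs.1 (hfib s hs).1).2.1⟩)
    (fun s hs => (hfib s hs).2.trans hρ1.le)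
  have hEB2 := hCp T0 (fun i s => |V i s| ^ D.γ i) (fun i _ => hKr i T0 (V i) _ (fun s hs => (HV i s hs).2.2.2.1)
    (fun s hs => (HV i s hs).2.2.2.2.1.continuousAt.continuousWithinAt) (hVh i) (fun s hs => (HV i s hs).2.1.trans (min_le_left _ _)))
  obtain ⟨A1, g1, g2, g3, g4⟩ := EB.mul (by positivity) hCp0 hEB1 hEB2
  have hμ : 0 ≤ lam * (if T then |z ^ D.m D.i0| else 1) := by split_ifs <;> positivity
  have main := hlem T0 BB (lam * (if T then |z ^ D.m D.i0| else 1)) _ A1 _ φ1 φ2 hT0 hμ g1 g2 g3 g4 f1 f2 f3 f4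
  have eL : ∫ s in Ioc 0 T0, ((β (Psi h p q (s, z)) * (D.bl h p q u d 0 μ).wt (s, z) : ℝ) : ℂ) *
          Complex.exp (Complex.I * ((lam * (D.bl h p q u d 0 μ).ph v1 v2 (s, z) : ℝ) : ℂ)) =
      (Z : ℂ) * ∫ s in Ioc 0 T0, (((β (Psi h p q (s, z)) * ∏ i, |V i s| ^ D.γ i) * s ^ (D.bl h p q u d 0 μ).b : ℝ) : ℂ) *
        Complex.exp (Complex.I * ((lam * (v1 * s ^ Q' + v2 * (s ^ P' * (z ^ D.m D.i0 * V D.i0 s))) : ℝ) : ℂ)) := by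
    rw [← integral_const_mul]
    refine setIntegral_congr_fun measurableSet_Ioc fun s hs => ?_
    rw [hwt s hs, hph s]
    push_cast; ring
  rw [eL, enorm_mul]
  have eZ : ‖(Z:ℂ)‖ₑ = ENNReal.ofReal Z := by
    rw [← ofReal_norm, Complex.norm_real, Real.norm_of_nonneg hZ0]
  rw [eZ]
  refine (mul_le_mul_right main _).trans ?_
  rw [mul_left_comm, ← lintegral_const_mul' _ _ ENNReal.ofReal_ne_top, ENNReal.ofReal_mul (by positivity : 0 ≤ CA * BB), mul_assoc]
  refine mul_le_mul_right ?_ _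
  rw [← lintegral_const_mul' _ _ ENNReal.ofReal_ne_top]
  refine setLIntegral_mono' measurableSet_Ioc fun s hs => ?_
  rw [← ENNReal.ofReal_mul hZ0, ← ENNReal.ofReal_mul (by positivity)]
  refine ENNReal.ofReal_le_ofReal ?_
  rw [hwt s hs]
  have hs0 := hs.1
  have hH0 : 0 ≤ lam * (D.bl h p q u d 0 μ).H T (s, z) := by
    refine mul_nonneg hl.le ?_
    unfold EData.H; split_ifs
    · positivity
    · exact pow_nonneg hs0.le _
  have hgain : gain (lam * (if T then |z ^ D.m D.i0| else 1) * s ^ (if T then (P':ℝ) else (Q':ℝ))) ≤ cg * gain (lam * (D.bl h p q u d 0 μ).H T (s, z)) := by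
    refine gain_scale' hcg1 (by positivity) hH0 ?_
    cases T with
    | true =>
      simp only [if_true]
      show lam * |s ^ P' * Ft (D.m D.i0) p q (u D.i0) (d D.i0) s (0 + z)| ≤ _
      rw [hFt, rpow_natCast, abs_mul, abs_mul, abs_of_pos (pow_pos hs0 P')]
      have : |V D.i0 s| ≤ cg := (hbd D.i0 _ (hVh D.i0 s hs)).2.2.1.trans (le_max_right _ _)
      calc lam * (s ^ P' * (|z ^ D.m D.i0| * |V D.i0 s|)) ≤ lam * (s ^ P' * (|z ^ D.m D.i0| * cg)) := by gcongr
        _ = _ := by ring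
    | false =>
      simp only [Bool.false_eq_true, if_false]
      show lam * s ^ Q' ≤ _
      rw [rpow_natCast, mul_one]
      exact le_mul_of_one_le_left (by positivity) hcg1
  have hprod : k0 ≤ ∏ i, |V i s| ^ D.γ i := Finset.prod_le_prod (fun i _ => (hkl i).le) fun i _ => (hbd i _ (hVh i s hs)).2.2.2.1
  have hg0 := gain_nonneg (lam * (D.bl h p q u d 0 μ).H T (s, z))
  calc Z * (s ^ (D.bl h p q u d 0 μ).b * gain (lam * (if T then |z ^ D.m D.i0| else 1) * s ^ (if T then (P':ℝ) else (Q':ℝ))))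
      ≤ Z * (s ^ (D.bl h p q u d 0 μ).b * (cg * gain (lam * (D.bl h p q u d 0 μ).H T (s, z)))) := by gcongr
    _ = (k0⁻¹ * cg) * (Z * (s ^ (D.bl h p q u d 0 μ).b * k0) * gain (lam * (D.bl h p q u d 0 μ).H T (s, z))) := by field_simp
    _ ≤ _ := by gcongr

lemma EData.aemeas {ι : Type} [Fintype ι] (D : EData ι) (hS : MeasurableSet D.S) {A : Set (RR)} (hA : MeasurableSet A)
    (hF : ∀ i, ContinuousOn (D.F i) A) (T : Bool) (lam : ℝ) :
    AEMeasurable (fun x => ENNReal.ofReal (D.wt x * gain (lam * D.H T x))) (volume.restrict A) := by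
  have h1 : ∀ i, AEMeasurable (D.F i) (volume.restrict A) := fun i => (hF i).aemeasurable hA
  have h2 : AEMeasurable D.wt (volume.restrict A) := by
    unfold EData.wt
    refine AEMeasurable.indicator ?_ hS
    refine (measurable_fst.pow_const _).aemeasurable.mul (Finset.aemeasurable_fun_prod _ fun i _ => ?_)
    have := h1 i
    exact (measurable_abs.comp_aemeasurable this).pow_const _
  have h3 : AEMeasurable (D.H T) (volume.restrict A) := by
    unfold EData.H
    cases T
    · simp; exact (measurable_fst.pow_const _).aemeasurable
    · simp only [if_true]
      exact measurable_abs.comp_aemeasurable ((measurable_fst.pow_const _).aemeasurable.mul (h1 _))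
  exact (h2.mul (measurable_gain.comp_aemeasurable (h3.const_mul lam))).ennreal_ofReal

def AA (p : ℕ) (ρ : ℝ) : Set (RR) := {x | 0 < x.1 ∧ x.1 ≤ ρ ∧ |x.1 ^ p * x.2| ≤ ρ}

lemma AA_meas (p : ℕ) (ρ : ℝ) : MeasurableSet (AA p ρ) := by
  have h1 : MeasurableSet {x : RR | 0 < x.1} := measurableSet_lt measurable_const measurable_fst
  have h2 : MeasurableSet {x : RR | x.1 ≤ ρ} := measurableSet_le measurable_fst measurable_const
  have h3 : MeasurableSet {x : RR | |x.1 ^ p * x.2| ≤ ρ} := (isClosed_le (by fun_prop) continuous_const).measurableSet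
  exact h1.inter (h2.inter h3)

lemma bl_S_meas {ι : Type} [Fintype ι] {D : EData ι} (hD : D.OK) {h : ℝ → ℝ} {p q : ℕ} {u : ι → RR → ℝ} {d : ι → ℕ → ℝ → ℝ}
    (hB : Blow D h p q u d) (z₀ : ℝ) (μ : ι → ℕ) : MeasurableSet (D.bl h p q u d z₀ μ).S := by
  have : Continuous (fun x : RR => Psi h p q (x.1, z₀ + x.2)) := (psi_cont hB.hc p q).comp (by fun_prop)
  exact this.measurable hD.meas

lemma bl_F_cont {ι : Type} [Fintype ι] {D : EData ι} {h : ℝ → ℝ} {p q : ℕ} {u : ι → RR → ℝ} {d : ι → ℕ → ℝ → ℝ}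
    (hB : Blow D h p q u d) (μ : ι → ℕ) : ∀ᶠ ρ in 𝓝[>] (0:ℝ), ∀ i, ContinuousOn ((D.bl h p q u d 0 μ).F i) (AA p ρ) := by
  have e1 := eventually_all.2 fun i => outer_dom (p := p) hB.hq (hB.hu i).eventually_analyticAt
  have e2 : ∀ᶠ ρ in 𝓝[>] (0:ℝ), ∀ i, ∀ k ∈ Finset.range (D.m i), ∀ s : ℝ, 0 < s → s ≤ ρ → AnalyticAt ℝ (d i k) s :=
    eventually_all.2 fun i => (Finset.eventually_all _).2 fun k _ => outer_s (hB.hd i k).eventually_analyticAt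
  filter_upwards [e1, e2] with ρ h1 h2 i x hx
  obtain ⟨a1, a2, a3⟩ := hx
  refine ContinuousAt.continuousWithinAt ?_
  show ContinuousAt (fun x : RR => Ft (D.m i) p q (u i) (d i) x.1 (0 + x.2)) x
  simp only [zero_add, Ft]
  refine ContinuousAt.add ?_ ((by fun_prop : ContinuousAt (fun x : RR => x.2 ^ D.m i) x).mul ?_)
  · refine tendsto_finsetSum _ fun k hk => ?_
    have c1 : ContinuousAt (fun x : RR => d i k x.1) x :=
      ContinuousAt.comp (g := d i k) (f := fun x : RR => x.1) (h2 i k hk x.1 a1 a2).continuousAt (by fun_prop)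
    exact c1.mul (by fun_prop)
  · exact ContinuousAt.comp (g := u i) (f := fun x : RR => (x.1 ^ q, x.1 ^ p * x.2)) (h1 i x.1 x.2 a1 a2 a3).continuousAt (by fun_prop)

lemma fiber_T0 {p : ℕ} (hp : 1 ≤ p) {ρ z : ℝ} (hρ : 0 < ρ) (hz : z ≠ 0) : ∃ T0 : ℝ, 0 < T0 ∧ T0 ≤ ρ ∧ ∀ s, (s, z) ∈ AA p ρ ↔ s ∈ Ioc 0 T0 := by
  have hz' := abs_pos.2 hz
  set w : ℝ := (ρ / |z|) ^ ((p:ℝ)⁻¹) with hw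
  have hw0 : 0 < w := by positivity
  have hwp : w ^ p = ρ / |z| := rpow_inv_natCast_pow (by positivity) (by omega)
  refine ⟨min ρ w, by positivity, min_le_left _ _, fun s => ?_⟩
  simp only [AA, mem_ofPred_eq, mem_Ioc, le_min_iff]
  refine and_congr_right fun hs => and_congr_right fun _ => ?_
  rw [abs_mul, abs_of_pos (pow_pos hs p), ← le_div_iff₀ hz', ← hwp]
  exact pow_le_pow_iff_left₀ hs.le hw0.le (by omega)

set_option maxHeartbeats 800000 in
lemma outer_est {ι : Type} [Fintype ι] {D : EData ι} (hD : D.OK) {h : ℝ → ℝ} {p q : ℕ} {u : ι → RR → ℝ} {d : ι → ℕ → ℝ → ℝ}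
    (hB : Blow D h p q u d) (T : Bool) {c0 : ℝ} (hc0 : 0 < c0) (μ : ι → ℕ) :
    ∀ᶠ ρ in 𝓝[>] (0:ℝ), ∀ B, 0 ≤ B → ∃ C : ℝ, 0 ≤ C ∧ ∀ (lam v1 v2 r : ℝ) (β : RR → ℝ) (χ : ℝ → ℝ), 0 < lam → Vc T c0 v1 v2 →
      Adm B r β → (∀ z, |χ z| ≤ 1) → ((∀ z, |z| ≤ ρ⁻¹ → χ z = 0) ∨ ∀ i k, d i k = fun _ => 0) →
      (∀ s z, 0 < s → s ≤ ρ → ρ < |s ^ p * z| → β (Psi h p q (s, z)) = 0) →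
      ‖∫ x in Ioc 0 ρ ×ˢ (univ : Set ℝ), (χ x.2 : ℂ) * (((β (Psi h p q x) * (D.bl h p q u d 0 μ).wt x : ℝ) : ℂ) *
          Complex.exp (Complex.I * ((lam * (D.bl h p q u d 0 μ).ph v1 v2 x : ℝ) : ℂ)))‖ₑ
        ≤ ENNReal.ofReal C * ∫⁻ x in AA p ρ, ENNReal.ofReal ((D.bl h p q u d 0 μ).wt x * gain (lam * (D.bl h p q u d 0 μ).H T x)) := by
  filter_upwards [fiber_est hD hB T hc0 μ, bl_F_cont hB μ, self_mem_nhdsWithin] with ρ hfib hcont hρ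
  have hρ : 0 < ρ := hρ
  intro B hB0
  obtain ⟨C, hC, hfib⟩ := hfib B hB0
  refine ⟨C, hC, ?_⟩
  intro lam v1 v2 r β χ hl hv hβ hχ1 hχ0 hsupp
  set D0 := D.bl h p q u d 0 μ with hD0
  set G : RR → ℂ := fun x => ((β (Psi h p q x) * D0.wt x : ℝ) : ℂ) * Complex.exp (Complex.I * ((lam * D0.ph v1 v2 x : ℝ) : ℂ)) with hG
  set W : RR → ℝ≥0∞ := fun x => ENNReal.ofReal (D0.wt x * gain (lam * D0.H T x)) with hW
  have hmeas : AEMeasurable W (volume.restrict (AA p ρ)) := D0.aemeas (bl_S_meas hD hB 0 μ) (AA_meas p ρ) hcont T lam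
  by_cases hint : IntegrableOn (fun x : RR => (χ x.2 : ℂ) * G x) (Ioc 0 ρ ×ˢ univ)
  swap
  · rw [integral_undef hint]; simp
  have hvol : (volume : Measure (RR)).restrict (Ioc 0 ρ ×ˢ univ) = (volume.restrict (Ioc 0 ρ)).prod volume := by
    rw [Measure.volume_eq_prod, ← Measure.prod_restrict, Measure.restrict_univ]
  unfold IntegrableOn at hint
  rw [hvol] at hint ⊢
  rw [integral_prod_symm _ hint]
  refine (enorm_integral_le_lintegral_enorm _).trans ?_
  rw [← lintegral_indicator (AA_meas p ρ), Measure.volume_eq_prod, lintegral_prod_symm _ (by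
    rw [← Measure.volume_eq_prod]; exact (aemeasurable_indicator_iff (AA_meas p ρ)).2 hmeas),
    ← lintegral_const_mul' _ _ ENNReal.ofReal_ne_top]
  refine lintegral_mono_ae ?_
  have hne : ∀ᵐ z : ℝ, z ≠ 0 := by
    rw [ae_iff]; simp
  filter_upwards [hne] with z hz
  rw [integral_const_mul, enorm_mul]
  by_cases hc : χ z = 0
  · simp [hc]
  have hχ : ‖(χ z : ℂ)‖ₑ ≤ 1 := by
    rw [← ofReal_norm, Complex.norm_real]
    exact ENNReal.ofReal_le_one.2 (hχ1 z)
  refine (mul_le_mul_left hχ _).trans ?_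
  rw [one_mul]
  obtain ⟨T0, hT0, hT0ρ, hTiff⟩ := fiber_T0 hB.hp hρ hz
  have e1 : ∫ s in Ioc 0 ρ, G (s, z) = ∫ s in Ioc 0 T0, G (s, z) := by
    refine (setIntegral_eq_of_subset_of_forall_sdiff_eq_zero measurableSet_Ioc (Ioc_subset_Ioc_right hT0ρ) ?_)
    rintro s ⟨hs, hs'⟩
    rw [← hTiff] at hs'
    have : ρ < |s ^ p * z| := by
      by_contra hcon
      exact hs' ⟨hs.1, hs.2, not_lt.1 hcon⟩
    simp only [hG, hsupp s z hs.1 hs.2 this]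
    simp
  rw [e1]
  have e2 : ∫⁻ s, (AA p ρ).indicator W (s, z) = ∫⁻ s in Ioc 0 T0, W (s, z) := by
    rw [← lintegral_indicator measurableSet_Ioc]
    refine lintegral_congr fun s => ?_
    by_cases hs : s ∈ Ioc 0 T0
    · rw [indicator_of_mem hs, indicator_of_mem ((hTiff s).2 hs)]
    · rw [indicator_of_notMem hs, indicator_of_notMem (fun h => hs ((hTiff s).1 h))]
  rw [e2]
  refine hfib lam v1 v2 r T0 z β hl hv hβ hz ?_ hT0 fun s hs => ?_
  · rcases hχ0 with h1 | h1
    · left; by_contra hcon; exact hc (h1 z (not_lt.1 hcon))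
    · exact Or.inr h1
  · exact ((hTiff s).2 hs).2

lemma bl_QP {ι : Type} {D : EData ι} (hD : D.OK) {p q : ℕ} (hp : 1 ≤ p) (hq : 1 ≤ q) : D.q * q < q * D.P + p * D.m D.i0 := by
  rcases Nat.eq_or_lt_of_le hD.hP with h | h
  · have := hD.hPq h.symm
    have : 1 ≤ p * D.m D.i0 := Nat.mul_pos hp this
    rw [h, mul_comm]; omega
  · have : q * D.q < q * D.P := Nat.mul_lt_mul_of_pos_left h (by omega)
    rw [mul_comm]; omega

lemma bl_ok {ι : Type} [Fintype ι] {D : EData ι} (hD : D.OK) {h : ℝ → ℝ} {p q : ℕ} {u : ι → RR → ℝ} {d : ι → ℕ → ℝ → ℝ}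
    (hB : Blow D h p q u d) (z₀ : ℝ) (μ : ι → ℕ) (R : ι → Polynomial ℝ) (hR0 : ∀ i, (R i).eval 0 ≠ 0)
    (hR : ∀ i z, ∑ k ∈ Finset.range (D.m i), d i k 0 * (z₀ + z) ^ k + (z₀ + z) ^ D.m i * u i 0 = z ^ μ i * (R i).eval z) :
    (D.bl h p q u d z₀ μ).OK where
  an := by
    intro i
    show AnalyticAt ℝ (fun x : RR => Ft (D.m i) p q (u i) (d i) x.1 (z₀ + x.2)) 0
    unfold Ft
    have hz : AnalyticAt ℝ (fun x : RR => z₀ + x.2) 0 := analyticAt_const.add analyticAt_snd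
    refine AnalyticAt.add ?_ ((hz.pow _).mul ?_)
    · refine Finset.analyticAt_fun_sum _ fun k _ => AnalyticAt.mul ?_ (hz.pow k)
      exact AnalyticAt.fun_comp (g := d i k) (f := fun x : RR => x.1) (hB.hd i k) analyticAt_fst
    · refine AnalyticAt.fun_comp (g := u i) (f := fun x : RR => (x.1 ^ q, x.1 ^ p * (z₀ + x.2))) ?_ ?_
      · have h1 := hB.hp; have h2 := hB.hq
        have : (((0:RR).1 ^ q, (0:RR).1 ^ p * (z₀ + (0:RR).2)) : RR) = 0 := by
          simp [show p ≠ 0 by omega, show q ≠ 0 by omega]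
        rw [this]; exact hB.hu i
      · exact (analyticAt_fst.pow q).prod ((analyticAt_fst.pow p).mul hz)
  ord := by
    intro i
    refine ⟨fun z => (R i).eval z, (R i).continuous.continuousAt, hR0 i, Eventually.of_forall fun z => ?_⟩
    show Ft (D.m i) p q (u i) (d i) 0 (z₀ + z) = _
    have h1 := hB.hp; have h2 := hB.hq
    have e : ((0:ℝ) ^ q, (0:ℝ) ^ p * (z₀ + z)) = (0 : RR) := by simp [show p ≠ 0 by omega, show q ≠ 0 by omega]
    unfold Ft
    rw [e, hR]; rfl
  meas := bl_S_meas hD hB z₀ μ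
  conn := by
    obtain ⟨ρc, hρc, hconn⟩ := hD.conn
    obtain ⟨ρ, hF, hh, hρ0, hρm⟩ := (hB.hF.and ((h_small hB.han hB.h0 hB.hq (half_pos hρc)).and
      (Ioo_mem_nhdsGT (show (0:ℝ) < min 1 (ρc/2) by positivity)))).exists
    rw [lt_min_iff] at hρm
    refine ⟨min ρ (ρ / (|z₀| + ρ)), by positivity, fun Z hZ hZc hZF => ?_⟩
    have hin : ∀ x ∈ Z, 0 < x.1 ∧ x.1 ≤ ρ ∧ |x.1 ^ p * (z₀ + x.2)| ≤ ρ := by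
      intro x hx
      obtain ⟨⟨a1, a2⟩, a3, a4⟩ := hZ hx
      rw [lt_min_iff] at a2 a4
      have a5 : |x.2| < ρ := abs_lt.2 ⟨by linarith [min_le_left ρ (ρ / (|z₀| + ρ))], a4.1⟩
      refine ⟨a1, a2.1.le, ?_⟩
      rw [abs_mul, abs_of_pos (pow_pos a1 p)]
      have a6 : |z₀ + x.2| ≤ |z₀| + ρ := (abs_add_le _ _).trans (by linarith)
      have a7 : x.1 ^ p ≤ x.1 := pow_le_of_le_one a1.le (by linarith) (by have := hB.hp; omega)
      calc x.1 ^ p * |z₀ + x.2| ≤ x.1 * (|z₀| + ρ) := by gcongr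
        _ ≤ ρ / (|z₀| + ρ) * (|z₀| + ρ) := by gcongr; exact a2.2.le
        _ = ρ := by field_simp
    have hcont : Continuous (fun x : RR => Psi h p q (x.1, z₀ + x.2)) := (psi_cont hB.hc p q).comp (by fun_prop)
    have key := hconn ((fun x : RR => Psi h p q (x.1, z₀ + x.2)) '' Z) (by
      rintro _ ⟨x, hx, rfl⟩
      obtain ⟨b1, b2, b3⟩ := hin x hx
      obtain ⟨a1, a2, a3, a4⟩ := hh x.1 b1 b2
      have a5 := abs_le.1 b3
      have a6 := abs_lt.1 a3
      refine ⟨⟨pow_pos b1 q, ?_⟩, ?_, ?_⟩ <;> simp only [Psi] <;> linarith) (hZc.image _ hcont.continuousOn) (by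
      rintro i _ ⟨x, hx, rfl⟩
      obtain ⟨b1, b2, b3⟩ := hin x hx
      simp only
      rw [hF i _ _ b1 b2 b3]
      exact mul_ne_zero (pow_ne_zero _ b1.ne') (hZF i x hx))
    rcases key with k | k
    · exact Or.inl fun x hx => k ⟨x, hx, rfl⟩
    · exact Or.inr (Set.disjoint_left.2 fun x hx hs => Set.disjoint_left.1 k ⟨x, hx, rfl⟩ hs)
  hq := Nat.mul_pos hD.hq hB.hq
  hP := (bl_QP hD hB.hp hB.hq).le
  hPq := fun h => absurd h (bl_QP hD hB.hp hB.hq).ne'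

lemma bl_shift {ι : Type} [Fintype ι] (D : EData ι) (h : ℝ → ℝ) (p q : ℕ) (u : ι → RR → ℝ) (d : ι → ℕ → ℝ → ℝ) (z₀ s z : ℝ)
    (μ μ' : ι → ℕ) : (D.bl h p q u d z₀ μ).wt (s, z) = (D.bl h p q u d 0 μ').wt (s, z₀ + z) ∧
    (∀ v1 v2, (D.bl h p q u d z₀ μ).ph v1 v2 (s, z) = (D.bl h p q u d 0 μ').ph v1 v2 (s, z₀ + z)) ∧
    ∀ T, (D.bl h p q u d z₀ μ).H T (s, z) = (D.bl h p q u d 0 μ').H T (s, z₀ + z) := by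
  refine ⟨?_, fun v1 v2 => ?_, fun T => ?_⟩
  · unfold EData.wt
    by_cases hS : Psi h p q (s, z₀ + z) ∈ D.S
    · rw [indicator_of_mem (show (s, z) ∈ (D.bl h p q u d z₀ μ).S from hS),
        indicator_of_mem (show (s, z₀ + z) ∈ (D.bl h p q u d 0 μ').S by
          show Psi h p q (s, 0 + (z₀ + z)) ∈ D.S
          rwa [zero_add])]
      simp only [EData.bl, zero_add]
    · rw [indicator_of_notMem (show (s, z) ∉ (D.bl h p q u d z₀ μ).S from hS),
        indicator_of_notMem (show (s, z₀ + z) ∉ (D.bl h p q u d 0 μ').S by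
          show Psi h p q (s, 0 + (z₀ + z)) ∉ D.S
          rwa [zero_add])]
  · simp only [EData.ph, EData.bl, zero_add]
  · simp only [EData.H, EData.bl, zero_add]

lemma lint_shift (z₀ : ℝ) (A : Set (RR)) (hA : MeasurableSet A) (B : Set (RR)) (hBm : MeasurableSet B)
    (hAB : ∀ s z, (s, z) ∈ A → (s, z₀ + z) ∈ B) (f : RR → ℝ≥0∞) :
    ∫⁻ x in A, f (x.1, z₀ + x.2) ≤ ∫⁻ x in B, f x := by
  rw [← lintegral_indicator hA, ← lintegral_indicator hBm, ← lintegral_add_left_eq_self (B.indicator f) ((0, z₀) : RR)]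
  refine lintegral_mono fun x => ?_
  have e : ((0, z₀) : RR) + x = (x.1, z₀ + x.2) := by ext <;> simp
  rw [e]
  by_cases hx : x ∈ A
  · rw [indicator_of_mem hx, indicator_of_mem (hAB x.1 x.2 hx)]
  · rw [indicator_of_notMem hx]; exact zero_le

lemma int_shift (z₀ : ℝ) (S : Set ℝ) (hS : MeasurableSet S) (f : RR → ℂ) :
    ∫ x in S ×ˢ (univ : Set ℝ), f (x.1, z₀ + x.2) = ∫ x in S ×ˢ (univ : Set ℝ), f x := by
  have hm : MeasurableSet (S ×ˢ (univ : Set ℝ)) := hS.prod MeasurableSet.univ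
  rw [← integral_indicator hm, ← integral_indicator hm, ← integral_add_left_eq_self ((S ×ˢ univ).indicator f) ((0, z₀) : RR)]
  refine integral_congr_ae (Eventually.of_forall fun x => ?_)
  have e : ((0, z₀) : RR) + x = (x.1, z₀ + x.2) := by ext <;> simp
  simp only [e]
  by_cases hx : x ∈ S ×ˢ univ
  · rw [indicator_of_mem hx, indicator_of_mem (show (x.1, z₀ + x.2) ∈ S ×ˢ univ from ⟨hx.1, mem_univ _⟩)]
  · rw [indicator_of_notMem hx, indicator_of_notMem (fun h => hx (show x ∈ S ×ˢ univ from ⟨h.1, mem_univ _⟩))]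

lemma rhs_cmp {ι : Type} [Fintype ι] {D : EData ι} {h : ℝ → ℝ} {p q : ℕ} {u : ι → RR → ℝ} {d : ι → ℕ → ℝ → ℝ}
    (hB : Blow D h p q u d) (T : Bool) (μ : ι → ℕ) {ρ r lam : ℝ} (hρr : ρ < r / 2)
    (hF : ∀ i, ∀ s z : ℝ, 0 < s → s ≤ ρ → |s ^ p * z| ≤ ρ →
      D.F i (Psi h p q (s, z)) = s ^ (p * D.m i) * Ft (D.m i) p q (u i) (d i) s z)
    (hh : ∀ s, 0 < s → s ≤ ρ → AnalyticAt ℝ h (s ^ q) ∧ |s ^ q * deriv h (s ^ q)| ≤ 1 ∧ |h (s ^ q)| < r / 2 ∧ s ^ q < r / 2) :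
    ∫⁻ x in AA p ρ, ENNReal.ofReal ((D.bl h p q u d 0 μ).wt x * gain (lam * (D.bl h p q u d 0 μ).H T x)) ≤
      ∫⁻ x in Ioo 0 r ×ˢ Ioo (-r) r, ENNReal.ofReal (D.wt x * gain (lam * D.H T x)) := by
  have hsub : Psi h p q '' AA p ρ ⊆ Ioo 0 r ×ˢ Ioo (-r) r := by
    rintro _ ⟨x, ⟨b1, b2, b3⟩, rfl⟩
    obtain ⟨a1, a2, a3, a4⟩ := hh x.1 b1 b2
    have a5 := abs_le.1 b3
    have a6 := abs_lt.1 a3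
    refine ⟨⟨pow_pos b1 q, ?_⟩, ?_, ?_⟩ <;> simp only [Psi] <;> linarith
  refine le_trans ?_ (lintegral_mono_set hsub)
  rw [(psi_cov hB.hq (AA_meas p ρ) fun x hx => ⟨hx.1, (hh x.1 hx.1 hx.2.1).1.differentiableAt⟩).2]
  refine setLIntegral_mono' (AA_meas p ρ) fun x hx => ?_
  obtain ⟨b1, b2, b3⟩ := hx
  obtain ⟨i1, _, i3⟩ := bl_identities (μ := μ) hB (s := x.1) (z := x.2) (z₀ := 0) b1 (fun i => by rw [zero_add]; exact hF i _ _ b1 b2 b3)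
  rw [zero_add] at i1 i3
  rw [← ENNReal.ofReal_mul (by positivity), ← mul_assoc, i1, i3]
  refine ENNReal.ofReal_le_ofReal ?_
  have hq1 : (1:ℝ) ≤ q := by exact_mod_cast hB.hq
  have hw : 0 ≤ (D.bl h p q u d 0 μ).wt (x.1, x.2) := by
    unfold EData.wt
    refine Set.indicator_apply_nonneg fun _ => ?_
    exact mul_nonneg (rpow_nonneg b1.le _) (Finset.prod_nonneg fun i _ => by positivity)
  refine mul_le_mul_of_nonneg_right ?_ (gain_nonneg _)
  exact le_mul_of_one_le_left hw hq1

lemma adm_piece {h : ℝ → ℝ} {p q : ℕ} (hp : 1 ≤ p) (hq : 1 ≤ q) {B r' r1 ρ M z₀ : ℝ} (hB : 0 ≤ B) (hM : 0 ≤ M) (hρ1 : ρ ≤ 1) (hρ : 0 < ρ)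
    {β : RR → ℝ} (hβ : Adm B r' β) (hh : ∀ s, 0 < s → s ≤ ρ → AnalyticAt ℝ h (s ^ q) ∧ |s ^ q * deriv h (s ^ q)| ≤ 1)
    (hr1 : 0 < r1) (h1 : r' ≤ (ρ / 2) ^ q) (h2 : r' ≤ r1 ^ q) (h3 : ∀ s z, 0 < s → s ≤ ρ → ρ < |s ^ p * z| → β (Psi h p q (s, z)) = 0)
    {χ : ℝ → ℝ} (c1 : ContDiff ℝ 1 χ) (c2 : ∀ z, |χ z| ≤ 1) (c3 : ∀ z, |deriv χ z| ≤ M) (c4 : ∀ z, r1 ≤ |z - z₀| → χ z = 0) :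
    Adm ((2 * q + p + 1) * B + M * B + B) r1 (fun x => β (Psi h p q (x.1, z₀ + x.2)) * χ (z₀ + x.2)) := by
  have hs0 : ∀ s z, 0 < s → r' ≤ s ^ q → β (Psi h p q (s, z)) = 0 := fun s z a b => hβ.supp _ (pow_pos a q) (Or.inl b)
  have hB' : 0 ≤ (2 * q + p + 1) * B + M * B + B := by positivity
  have key : ∀ x : RR, 0 < x.1 → let f := (fun x : RR => β (Psi h p q (x.1, z₀ + x.2)) * χ (z₀ + x.2));
      ContDiffAt ℝ 1 f x ∧ |x.1 * fderiv ℝ f x (1, 0)| ≤ (2 * q + p + 1) * B + M * B + B ∧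
      |fderiv ℝ f x (0, 1)| ≤ (2 * q + p + 1) * B + M * B + B := by
    rintro ⟨s, z⟩ hs f
    replace hs : 0 < s := hs
    by_cases hc : s < ρ ∧ |s ^ p * (z₀ + z)| ≤ ρ
    · obtain ⟨hsρ, hsz⟩ := hc
      have hhs := hh s hs hsρ.le
      have hP : 0 < (Psi h p q (s, z₀ + z)).1 := pow_pos hs q
      obtain ⟨N, n1, _, n2, n3⟩ := psi_fderiv (p := p) (x := (s, z₀ + z)) hhs.1.differentiableAt
      have e1 : HasFDerivAt (fun x : RR => (x.1, z₀ + x.2)) (ContinuousLinearMap.id ℝ (RR)) (s, z) :=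
        (hasFDerivAt_fst.prodMk (hasFDerivAt_snd.const_add z₀)).congr_fderiv (by ext <;> simp)
      have e2 := ((hβ.cd _ hP).differentiableAt (by simp)).hasFDerivAt
      have e3 : HasFDerivAt (fun x : RR => β (Psi h p q (x.1, z₀ + x.2))) _ (s, z) :=
        HasFDerivAt.comp (g := β ∘ Psi h p q) (f := fun x : RR => (x.1, z₀ + x.2)) (s, z) (e2.comp (s, z₀ + z) n1) e1
      have e6 : HasFDerivAt (fun x : RR => z₀ + x.2) (ContinuousLinearMap.snd ℝ ℝ ℝ) (s, z) := hasFDerivAt_snd.const_add z₀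
      have e4 : HasFDerivAt (fun x : RR => χ (z₀ + x.2)) _ (s, z) :=
        ((c1.differentiable (by simp)) (z₀ + z)).hasDerivAt.comp_hasFDerivAt (s, z) e6
      have e5 : HasFDerivAt f _ (s, z) := e3.mul e4
      set L := fderiv ℝ β (Psi h p q (s, z₀ + z)) with hL
      have b1 := hβ.b1 _ hP
      have b2 := hβ.b2 _ hP
      have b0 := hβ.b0 _ hP
      have hs1 : s ^ p ≤ 1 := pow_le_one₀ hs.le (by linarith)
      refine ⟨?_, ?_, ?_⟩
      · refine ContDiffAt.mul ?_ (c1.contDiffAt.comp (s, z) (by fun_prop))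
        have hPs : ContDiffAt ℝ 1 (fun x : RR => Psi h p q (x.1, z₀ + x.2)) (s, z) := by
          unfold Psi
          refine ContDiffAt.prodMk (by fun_prop) (ContDiffAt.add ?_ (by fun_prop))
          exact hhs.1.contDiffAt.comp (s, z) (f := fun x : RR => x.1 ^ q) (by fun_prop)
        exact (hβ.cd _ hP).comp (s, z) hPs
      · rw [e5.fderiv]
        have : s * ((β (Psi h p q (s, z₀ + z)) • (deriv χ (z₀ + z) • ContinuousLinearMap.snd ℝ ℝ ℝ) +
            χ (z₀ + z) • ((L.comp N).comp (ContinuousLinearMap.id ℝ (RR)))) (1, 0)) =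
            χ (z₀ + z) * (q * (s ^ q * L (1, 0)) + (q * (s ^ q * deriv h (s ^ q)) + p * (s ^ p * (z₀ + z))) * L (0, 1)) := by
          simp [n2]
          rw [clm_pair L]
          obtain ⟨q, rfl⟩ := Nat.exists_eq_add_of_le' hq
          obtain ⟨p, rfl⟩ := Nat.exists_eq_add_of_le' hp
          simp only [Nat.add_sub_cancel, pow_succ]
          ring
        refine le_trans (le_of_eq (congrArg _ this)) ?_
        have t0 : |q * (s ^ q * L (1, 0))| ≤ q * B := by rw [abs_mul, Nat.abs_cast]; gcongr; exact b1
        have t1 : |q * (s ^ q * deriv h (s ^ q)) + p * (s ^ p * (z₀ + z))| ≤ q + p := by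
          refine (abs_add_le _ _).trans ?_
          rw [abs_mul, abs_mul (p:ℝ), Nat.abs_cast, Nat.abs_cast]
          have := mul_le_mul_of_nonneg_left hhs.2 (Nat.cast_nonneg (α := ℝ) q)
          have := mul_le_mul_of_nonneg_left (hsz.trans hρ1) (Nat.cast_nonneg (α := ℝ) p)
          linarith
        have t2 : |(q * (s ^ q * deriv h (s ^ q)) + p * (s ^ p * (z₀ + z))) * L (0, 1)| ≤ (q + p) * B := by
          rw [abs_mul]; gcongr
        rw [abs_mul]
        refine (mul_le_of_le_one_left (abs_nonneg _) (c2 _)).trans ((abs_add_le _ _).trans ?_)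
        have : 0 ≤ M * B := by positivity
        linarith
      · rw [e5.fderiv]
        have : (β (Psi h p q (s, z₀ + z)) • (deriv χ (z₀ + z) • ContinuousLinearMap.snd ℝ ℝ ℝ) +
            χ (z₀ + z) • ((L.comp N).comp (ContinuousLinearMap.id ℝ (RR)))) (0, 1) =
            β (Psi h p q (s, z₀ + z)) * deriv χ (z₀ + z) + χ (z₀ + z) * (s ^ p * L (0, 1)) := by
          simp [n3]
          rw [clm_pair L]; simp
        refine le_trans (le_of_eq (congrArg _ this)) ((abs_add_le _ _).trans ?_)
        rw [abs_mul, abs_mul (χ _), abs_mul (s ^ p), abs_of_pos (pow_pos hs p)]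
        have t1 := mul_le_mul b0 (c3 (z₀ + z)) (abs_nonneg _) hB
        have t2 : |χ (z₀ + z)| * (s ^ p * |L (0, 1)|) ≤ 1 * (1 * B) := by gcongr; exact c2 _
        have : 0 ≤ (2 * q + p + 1) * B := by positivity
        linarith
    · have hz : f =ᶠ[𝓝 (s, z)] fun _ => 0 := by
        by_cases hsρ : s < ρ
        · have : ρ < |s ^ p * (z₀ + z)| := by by_contra hh; exact hc ⟨hsρ, not_lt.1 hh⟩
          have o1 : IsOpen {x : RR | 0 < x.1 ∧ x.1 < ρ ∧ ρ < |x.1 ^ p * (z₀ + x.2)|} :=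
            IsOpen.and (isOpen_lt (by fun_prop) (by fun_prop)) (IsOpen.and (isOpen_lt (by fun_prop) (by fun_prop)) (isOpen_lt (by fun_prop) (by fun_prop)))
          filter_upwards [o1.mem_nhds (show (s, z) ∈ _ from ⟨hs, hsρ, this⟩)] with x hx
          simp only [f, h3 x.1 (z₀ + x.2) hx.1 hx.2.1.le hx.2.2, zero_mul]
        · have o1 : IsOpen {x : RR | ρ / 2 < x.1} := isOpen_lt (by fun_prop) (by fun_prop)
          filter_upwards [o1.mem_nhds (show (s, z) ∈ _ from (show ρ / 2 < s by linarith))] with x hx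
          have hx : ρ / 2 < x.1 := hx
          simp only [f, hs0 x.1 (z₀ + x.2) (by linarith) (h1.trans (by gcongr)), zero_mul]
      refine ⟨contDiffAt_const.congr_of_eventuallyEq hz, ?_, ?_⟩ <;> rw [hz.fderiv_eq] <;> simpa using hB'
  refine ⟨fun x hx => (key x hx).1, fun x hx => ?_, fun x hx => (key x hx).2.1, fun x hx => (key x hx).2.2, fun x hx hc => ?_⟩
  · have := hβ.b0 (Psi h p q (x.1, z₀ + x.2)) (pow_pos hx q)
    rw [abs_mul]
    refine (mul_le_of_le_one_right (abs_nonneg _) (c2 _)).trans (this.trans ?_)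
    have : 0 ≤ (2 * q + p + 1) * B + M * B := by positivity
    linarith
  · rcases hc with hc | hc
    · simp only [hs0 x.1 _ hx (h2.trans (by gcongr)), zero_mul]
    · simp only [c4 (z₀ + x.2) (by simpa using hc), mul_zero]

lemma pou {E : Type} [NormedAddCommGroup E] [NormedSpace ℝ E] [FiniteDimensional ℝ E] {K : Set E} (hK : IsCompact K) {r : E → ℝ}
    (hr : ∀ x ∈ K, 0 < r x) : ∃ (t : Finset E) (χ : E → E → ℝ), (∀ j ∈ t, j ∈ K) ∧
      (∀ j ∈ t, ContDiff ℝ 1 (χ j) ∧ (∀ z, |χ j z| ≤ 1) ∧ (∃ M, 0 ≤ M ∧ ∀ z, ‖fderiv ℝ (χ j) z‖ ≤ M) ∧ ∀ z, r j ≤ dist z j → χ j z = 0) ∧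
      (∀ z, |1 - ∑ j ∈ t, χ j z| ≤ 1) ∧ ∀ z ∈ K, ∑ j ∈ t, χ j z = 1 := by
  classical
  obtain ⟨t, ht, hcov⟩ := hK.elim_nhds_subcover (fun x => ball x (r x)) fun x hx => ball_mem_nhds x (hr x hx)
  obtain ⟨f, hf⟩ := SmoothPartitionOfUnity.exists_isSubordinate (modelWithCornersSelf ℝ E) hK.isClosed
    (fun j : t => ball (j:E) (r j)) (fun _ => isOpen_ball) (by
      intro x hx
      obtain ⟨i, hi, hxi⟩ := mem_iUnion₂.1 (hcov hx)
      exact mem_iUnion.2 ⟨⟨i, hi⟩, hxi⟩)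
  let χ : E → E → ℝ := fun j => if h : j ∈ t then f ⟨j, h⟩ else fun _ => 0
  have hχ : ∀ j (h : j ∈ t), χ j = f ⟨j, h⟩ := fun j h => by simp only [χ, dif_pos h]
  have hsum : ∀ z, ∑ j ∈ t, χ j z = ∑ᶠ i, f i z := by
    intro z
    rw [finsum_eq_sum_of_fintype, ← Finset.sum_coe_sort]
    exact Finset.sum_congr rfl fun j _ => by rw [hχ j j.2]
  have hout : ∀ j (h : j ∈ t) z, r j ≤ dist z j → f ⟨j, h⟩ z = 0 := by
    intro j h z hz
    by_contra h0
    have := hf ⟨j, h⟩ (subset_tsupport _ (Function.mem_support.2 h0))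
    exact absurd (mem_ball.1 this) (not_lt.2 hz)
  refine ⟨t, χ, ht, fun j hj => ?_, fun z => ?_, fun z hz => ?_⟩
  · rw [hχ j hj]
    have hcd : ContDiff ℝ 1 (f ⟨j, hj⟩) := (f ⟨j, hj⟩).contMDiff.contDiff.of_le (by simp)
    have hcs : HasCompactSupport (f ⟨j, hj⟩) := by
      refine HasCompactSupport.of_support_subset_isCompact (isCompact_closedBall j (r j)) fun z hz => ?_
      by_contra h0
      exact hz (hout j hj z (not_le.1 h0).le)
    obtain ⟨M, hM⟩ := (hcs.fderiv ℝ).exists_bound_of_continuous (hcd.continuous_fderiv (by simp))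
    refine ⟨hcd, fun z => ?_, ⟨M, (norm_nonneg _).trans (hM j), hM⟩, hout j hj⟩
    rw [abs_of_nonneg (f.nonneg _ _)]; exact f.le_one _ _
  · rw [hsum]
    have h1 := f.sum_le_one z
    have h2 := f.sum_nonneg z
    rw [abs_le]; constructor <;> linarith
  · rw [hsum]; exact f.sum_eq_one hz

lemma lhs_cov {ι : Type} [Fintype ι] {D : EData ι} {h : ℝ → ℝ} {p q : ℕ} {u : ι → RR → ℝ} {d : ι → ℕ → ℝ → ℝ}
    (hB : Blow D h p q u d) (μ : ι → ℕ) {ρ B r' lam v1 v2 : ℝ} (hρ : 0 < ρ)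
    (hF : ∀ i, ∀ s z : ℝ, 0 < s → s ≤ ρ → |s ^ p * z| ≤ ρ →
      D.F i (Psi h p q (s, z)) = s ^ (p * D.m i) * Ft (D.m i) p q (u i) (d i) s z)
    (hh : ∀ s, 0 < s → s ≤ ρ → AnalyticAt ℝ h (s ^ q)) {β : RR → ℝ} (hβ : Adm B r' β) (h1 : r' ≤ ρ ^ q)
    (h3 : ∀ s z, 0 < s → s ≤ ρ → ρ < |s ^ p * z| → β (Psi h p q (s, z)) = 0) :
    ∫ x in Ioi (0:ℝ) ×ˢ (univ : Set ℝ), ((β x * D.wt x : ℝ) : ℂ) * Complex.exp (Complex.I * ((lam * D.ph v1 v2 x : ℝ) : ℂ)) =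
    q * ∫ x in Ioc 0 ρ ×ˢ (univ : Set ℝ), (((β (Psi h p q x) * (D.bl h p q u d 0 μ).wt x : ℝ) : ℂ) *
          Complex.exp (Complex.I * ((lam * (D.bl h p q u d 0 μ).ph v1 v2 x : ℝ) : ℂ))) := by
  have hm : MeasurableSet (Ioc 0 ρ ×ˢ (univ : Set ℝ)) := measurableSet_Ioc.prod MeasurableSet.univ
  rw [setIntegral_eq_of_subset_of_forall_sdiff_eq_zero (s := Ioc 0 (ρ ^ q) ×ˢ univ) (measurableSet_Ioi.prod MeasurableSet.univ)
    (prod_mono Ioc_subset_Ioi_self subset_rfl) (fun x hx => ?_), ← psi_image (h := h) (p := p) hB.hq hρ,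
    (psi_cov (p := p) hB.hq hm fun x hx => ⟨hx.1.1, (hh x.1 hx.1.1 hx.1.2).differentiableAt⟩).1, ← integral_const_mul]
  · refine setIntegral_congr_fun hm fun x hx => ?_
    obtain ⟨s, z⟩ := x
    have hs : 0 < s := hx.1.1
    have hsρ : s ≤ ρ := hx.1.2
    simp only
    by_cases hz : |s ^ p * z| ≤ ρ
    · obtain ⟨i1, i2, -⟩ := bl_identities hB (s := s) (z := z) (z₀ := 0) (μ := μ) hs (fun i => by rw [zero_add]; exact hF i s z hs hsρ hz)
      rw [zero_add] at i1 i2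
      rw [i2, Complex.real_smul, ← mul_assoc, ← mul_assoc, ← Complex.ofReal_mul, ← Complex.ofReal_natCast, ← Complex.ofReal_mul]
      congr 2
      linear_combination β (Psi h p q (s, z)) * i1
    · rw [h3 s z hs hsρ (not_le.1 hz)]; simp
  · have hx0 : 0 < x.1 := hx.1.1
    have : ρ ^ q < x.1 := by
      by_contra hc
      exact hx.2 ⟨⟨hx0, not_lt.1 hc⟩, mem_univ _⟩
    rw [hβ.supp x hx0 (Or.inl (h1.trans this.le))]; simp

set_option maxHeartbeats 1600000 in
lemma est_step {ι : Type} [Fintype ι] {D : EData ι} (hD : D.OK) (T : Bool)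
    (IH : ∀ D' : EData ι, D'.OK → ∑ i, D'.m i < ∑ i, D.m i → Est D' T) : Est D T := by
  intro c0 hc0 r hr
  obtain ⟨h, p, q, u, d, hB⟩ := blow_exists hD
  obtain ⟨ρ, hout, hF, hh, hρ, hρ2⟩ := ((outer_est hD hB T hc0 D.m).and (hB.hF.and ((h_small hB.han hB.h0 hB.hq (half_pos hr)).and
    (Ioo_mem_nhdsGT (show (0:ℝ) < min 1 (r/2) from lt_min one_pos (half_pos hr)))))).exists
  have hρ1 : ρ < 1 := hρ2.trans_le (min_le_left _ _)
  have hρr : ρ < r / 2 := hρ2.trans_le (min_le_right _ _)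
  obtain ⟨η, hη, hηh⟩ : ∃ η > 0, ∀ t : ℝ, 0 < t → t < η → |h t| ≤ ρ / 2 := by
    have : Tendsto (fun t => |h t|) (𝓝 0) (𝓝 0) := by
      have := hB.hc.abs.tendsto 0
      rwa [hB.h0, abs_zero] at this
    obtain ⟨η, hη, hb⟩ := Metric.eventually_nhds_iff.1 (this.eventually_lt_const (half_pos hρ))
    refine ⟨η, hη, fun t h1 h2 => (hb ?_).le⟩
    rw [dist_eq, sub_zero, abs_of_pos h1]; exact h2
  set r0 := min (min r η) (min (ρ / 2) ((ρ / 2) ^ q)) with hr0d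
  have hr0 : 0 < r0 := by positivity
  have k1 : r0 ≤ r := (min_le_left _ _).trans (min_le_left _ _)
  have k2 : r0 ≤ η := (min_le_left _ _).trans (min_le_right _ _)
  have k3 : r0 ≤ ρ / 2 := (min_le_right _ _).trans (min_le_left _ _)
  have k4 : r0 ≤ (ρ / 2) ^ q := (min_le_right _ _).trans (min_le_right _ _)
  have k5 : r0 ≤ ρ ^ q := k4.trans (by gcongr; linarith)
  have h3 : ∀ r' ≤ r0, ∀ B β, Adm B r' β → ∀ s z, 0 < s → s ≤ ρ → ρ < |s ^ p * z| → β (Psi h p q (s, z)) = 0 := by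
    intro r' hr' B β hβ s z hs hsρ hsz
    have hs' := pow_pos hs q
    by_cases hc : r' ≤ s ^ q
    · exact hβ.supp _ hs' (Or.inl hc)
    · have := hηh _ hs' (by linarith)
      refine hβ.supp _ hs' (Or.inr ?_)
      simp only [Psi]
      have := abs_sub_abs_le_abs_sub (s ^ p * z) (-h (s ^ q))
      rw [abs_neg, sub_neg_eq_add, add_comm (s ^ p * z)] at this
      linarith
  have cmp := fun lam => rhs_cmp hB T D.m (lam := lam) hρr hF hh
  have hqe : ‖(q:ℂ)‖ₑ = ENNReal.ofReal q := by
    rw [← ofReal_norm]; simp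
  rcases hB.dich with hd | ⟨hd1, hd2⟩
  · refine ⟨r0, hr0, k1, fun B hB0 => ?_⟩
    obtain ⟨C, hC, hest⟩ := hout B hB0
    refine ⟨q * C, by positivity, fun lam v1 v2 β hl hv hβ => ?_⟩
    rw [lhs_cov hB D.m hρ hF (fun s a b => (hh s a b).1) hβ k5 (h3 _ le_rfl _ _ hβ), enorm_mul, hqe,
      ENNReal.ofReal_mul (by positivity), mul_assoc]
    have := hest lam v1 v2 r0 β (fun _ => 1) hl hv hβ (by simp) (Or.inr hd) (h3 _ le_rfl _ _ hβ)
    simp only [Complex.ofReal_one, one_mul] at this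
    exact mul_le_mul_right (this.trans (mul_le_mul_right (cmp lam) _)) _
  · have hz : ∀ z₀ : ℝ, ∃ (μ : ι → ℕ) (r1 : ℝ), 0 < r1 ∧ ∀ B, 0 ≤ B → ∃ C : ℝ, 0 ≤ C ∧
        ∀ (lam v1 v2 : ℝ) (β : RR → ℝ), 0 < lam → Vc T c0 v1 v2 → Adm B r1 β →
        ‖∫ x in Ioi (0:ℝ) ×ˢ (univ : Set ℝ), ((β x * (D.bl h p q u d z₀ μ).wt x : ℝ) : ℂ) *
          Complex.exp (Complex.I * ((lam * (D.bl h p q u d z₀ μ).ph v1 v2 x : ℝ) : ℂ))‖ₑ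
        ≤ ENNReal.ofReal C * ∫⁻ x in AA p ρ, ENNReal.ofReal ((D.bl h p q u d 0 D.m).wt x * gain (lam * (D.bl h p q u d 0 D.m).H T x)) := by
      intro z₀
      obtain ⟨μ, R, hR0, hR, hlt⟩ := inner_orders D.m (fun i k => d i k 0) (fun i => u i 0) hB.hu0 hd1 hd2 z₀
      obtain ⟨r1, g1, g2, g3⟩ := IH _ (bl_ok hD hB z₀ μ R hR0 hR) hlt c0 hc0 (ρ / (|z₀| + 1)) (by positivity)
      refine ⟨μ, r1, g1, fun B hB0 => ?_⟩
      obtain ⟨C, hC, hest⟩ := g3 B hB0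
      refine ⟨C, hC, fun lam v1 v2 β hl hv hβ => (hest lam v1 v2 β hl hv hβ).trans (mul_le_mul_right ?_ _)⟩
      refine le_trans (le_of_eq ?_) (lint_shift z₀ (Ioo 0 (ρ / (|z₀| + 1)) ×ˢ Ioo (-(ρ / (|z₀| + 1))) (ρ / (|z₀| + 1))) (measurableSet_Ioo.prod measurableSet_Ioo) (AA p ρ) (AA_meas p ρ) (fun s z hsz => ?_)
        (fun x => ENNReal.ofReal ((D.bl h p q u d 0 D.m).wt x * gain (lam * (D.bl h p q u d 0 D.m).H T x))))
      · refine lintegral_congr fun x => ?_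
        obtain ⟨b1, -, b3⟩ := bl_shift D h p q u d z₀ x.1 x.2 μ D.m
        rw [← b1, ← b3]
      · obtain ⟨⟨a1, a2⟩, a3⟩ := hsz
        simp only at a1 a2 a3
        have hR : ρ / (|z₀| + 1) ≤ ρ := div_le_self hρ.le (by linarith [abs_nonneg z₀])
        have a4 := abs_lt.2 a3
        have a5 : |z₀ + z| ≤ |z₀| + 1 := (abs_add_le _ _).trans (by linarith)
        refine ⟨a1, by simp only; linarith, ?_⟩
        simp only
        rw [abs_mul, abs_of_pos (pow_pos a1 p)]
        have a6 : s ^ p ≤ ρ / (|z₀| + 1) := (pow_le_of_le_one a1.le (by linarith) (by have := hB.hp; omega)).trans a2.le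
        calc s ^ p * |z₀ + z| ≤ ρ / (|z₀| + 1) * (|z₀| + 1) := by gcongr
          _ = ρ := by have := abs_nonneg z₀; field_simp
    choose μ r1 hr1 hest using hz
    obtain ⟨t, χ, -, hχ, hχ0, hχ1⟩ := pou (isCompact_Icc (a := -ρ⁻¹) (b := ρ⁻¹)) (r := r1) fun x _ => hr1 x
    obtain ⟨r', hr'j, hr', hr'0⟩ : ∃ r', (∀ j ∈ t, r' < r1 j ^ q) ∧ r' ∈ Ioo 0 r0 := by
      have e1 : ∀ j ∈ t, ∀ᶠ r' in 𝓝[>] (0:ℝ), r' < r1 j ^ q := fun j _ => mem_nhdsWithin_of_mem_nhds (Iio_mem_nhds (pow_pos (hr1 j) q))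
      exact (((Finset.eventually_all _).2 e1).and (Ioo_mem_nhdsGT hr0)).exists
    refine ⟨r', hr', hr'0.le.trans k1, fun B hB0 => ?_⟩
    have hM : ∀ j, ∃ M, 0 ≤ M ∧ (j ∈ t → ∀ z, |deriv (χ j) z| ≤ M) := by
      intro j
      by_cases hj : j ∈ t
      · obtain ⟨M, m1, m2⟩ := (hχ j hj).2.2.1
        exact ⟨M, m1, fun _ z => by rw [← norm_eq_abs, norm_deriv_eq_norm_fderiv]; exact m2 z⟩
      · exact ⟨0, le_rfl, fun h => absurd h hj⟩
    choose M hM0 hM using hM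
    have hBj : ∀ j, 0 ≤ (2 * q + p + 1) * B + M j * B + B := fun j => by have := hM0 j; positivity
    choose C hC hest using fun j => hest j _ (hBj j)
    obtain ⟨C0, hC0, hest0⟩ := hout B hB0
    refine ⟨q * (C0 + ∑ j ∈ t, C j), by have := Finset.sum_nonneg fun j (_ : j ∈ t) => hC j; positivity, fun lam v1 v2 β hl hv hβ => ?_⟩
    have h3' := h3 _ hr'0.le _ _ hβ
    rw [lhs_cov hB D.m hρ hF (fun s a b => (hh s a b).1) hβ (hr'0.le.trans k5) h3', enorm_mul, hqe,
      ENNReal.ofReal_mul (by positivity), mul_assoc]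
    refine mul_le_mul_right ?_ _
    refine le_trans ?_ (mul_le_mul_right (cmp lam) _)
    have o1 := hest0 lam v1 v2 r' β (fun z => 1 - ∑ j ∈ t, χ j z) hl hv hβ hχ0 (Or.inl fun z hz => by
      rw [hχ1 z (abs_le.1 hz), sub_self]) h3'
    set G0 : RR → ℂ := fun x => (((β (Psi h p q x) * (D.bl h p q u d 0 D.m).wt x : ℝ) : ℂ) *
          Complex.exp (Complex.I * ((lam * (D.bl h p q u d 0 D.m).ph v1 v2 x : ℝ) : ℂ))) with hG0
    set J := ∫⁻ x in AA p ρ, ENNReal.ofReal ((D.bl h p q u d 0 D.m).wt x * gain (lam * (D.bl h p q u d 0 D.m).H T x))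
    have o2 : ∀ j ∈ t, ‖∫ x in Ioc 0 ρ ×ˢ (univ : Set ℝ), (χ j x.2 : ℂ) * G0 x‖ₑ ≤ ENNReal.ofReal (C j) * J := by
      intro j hj
      refine le_of_eq_of_le ?_ (hest j lam v1 v2 _ hl hv (adm_piece hB.hp hB.hq hB0 (hM0 j) hρ1.le hρ hβ (fun s a b => ⟨(hh s a b).1, (hh s a b).2.1⟩)
        (hr1 j) (hr'0.le.trans k4) (hr'j j hj).le h3' (hχ j hj).1 (hχ j hj).2.1 (hM j hj) (fun z hz => (hχ j hj).2.2.2 z hz)))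
      congr 1
      rw [← int_shift j _ measurableSet_Ioc (fun x => (χ j x.2 : ℂ) * G0 x)]
      symm
      rw [setIntegral_eq_of_subset_of_forall_sdiff_eq_zero (s := Ioc 0 ρ ×ˢ univ) (measurableSet_Ioi.prod MeasurableSet.univ)
        (prod_mono Ioc_subset_Ioi_self subset_rfl) (fun x hx => ?_)]
      · refine integral_congr_ae (Eventually.of_forall fun x => ?_)
        obtain ⟨b1, b2, -⟩ := bl_shift D h p q u d j x.1 x.2 (μ j) D.m
        simp only [hG0]
        rw [← b1, ← b2]
        push_cast; ring
      · have hx0 : 0 < x.1 := hx.1.1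
        have : ρ < x.1 := by
          by_contra hc
          exact hx.2 ⟨⟨hx0, not_lt.1 hc⟩, mem_univ _⟩
        rw [hβ.supp _ (pow_pos hx0 q) (Or.inl (hr'0.le.trans (k5.trans (pow_le_pow_left₀ hρ.le this.le q))))]; simp
    by_cases hi : IntegrableOn G0 (Ioc 0 ρ ×ˢ (univ : Set ℝ))
    · have hij : ∀ j ∈ t, IntegrableOn (fun x => (χ j x.2 : ℂ) * G0 x) (Ioc 0 ρ ×ˢ (univ : Set ℝ)) := by
        intro j hj
        refine hi.bdd_mul (c := 1) ?_ (Eventually.of_forall fun x => ?_)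
        · exact (Complex.continuous_ofReal.comp ((hχ j hj).1.continuous.comp continuous_snd)).aestronglyMeasurable
        · rw [Complex.norm_real]; exact (hχ j hj).2.1 _
      have e : ∫ x in Ioc 0 ρ ×ˢ (univ : Set ℝ), (((1 - ∑ j ∈ t, χ j x.2 : ℝ) : ℂ)) * G0 x =
          (∫ x in Ioc 0 ρ ×ˢ (univ : Set ℝ), G0 x) - ∑ j ∈ t, ∫ x in Ioc 0 ρ ×ˢ (univ : Set ℝ), (χ j x.2 : ℂ) * G0 x := by
        rw [← integral_finsetSum _ hij, ← integral_sub hi (integrable_finsetSum _ hij)]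
        refine integral_congr_ae (Eventually.of_forall fun x => ?_)
        simp only
        push_cast
        rw [sub_mul, one_mul, Finset.sum_mul]
      rw [e] at o1
      rw [← sub_add_cancel (∫ x in Ioc 0 ρ ×ˢ (univ : Set ℝ), G0 x) (∑ j ∈ t, ∫ x in Ioc 0 ρ ×ˢ (univ : Set ℝ), (χ j x.2 : ℂ) * G0 x)]
      refine (enorm_add_le _ _).trans ?_
      rw [ENNReal.ofReal_add hC0 (Finset.sum_nonneg fun j _ => hC j), add_mul, ENNReal.ofReal_sum_of_nonneg (fun j _ => hC j), Finset.sum_mul]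
      exact add_le_add o1 ((enorm_sum_le _ _).trans (Finset.sum_le_sum o2))
    · rw [integral_undef hi]; simp

lemma est_all {ι : Type} [Fintype ι] (T : Bool) : ∀ (n : ℕ) (D : EData ι), D.OK → ∑ i, D.m i = n → Est D T := by
  intro n
  induction n using Nat.strong_induction_on with
  | _ n ih => exact fun D hD hn => est_step hD T fun D' hD' hlt => ih _ (hn ▸ hlt) D' hD' rfl

def FinOrd (F : RR → ℝ) (m : ℕ) : Prop :=
  ∃ r : ℝ → ℝ, ContinuousAt r 0 ∧ r 0 ≠ 0 ∧ ∀ᶠ z in 𝓝 (0:ℝ), F (0, z) = z ^ m * r z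

lemma ev_pos {Q : ℝ → Prop} (h : ∀ᶠ t in 𝓝 (0:ℝ), Q t) : ∃ τ > 0, ∀ t, 0 < t → t < τ → Q t := by
  obtain ⟨η, hη, hb⟩ := Metric.eventually_nhds_iff.1 h
  exact ⟨η, hη, fun t h1 h2 => hb (by rw [dist_eq, sub_zero, abs_of_pos h1]; exact h2)⟩

lemma curve_fn {X Y : ℝ → ℝ} (hX : AnalyticAt ℝ X 0) (hY : AnalyticAt ℝ Y 0) (hX0 : X 0 = 0) :
    ∃ j : ℕ, 1 ≤ j ∧ ∀ l, 1 ≤ l → ∃ (F : RR → ℝ) (m : ℕ), AnalyticAt ℝ F 0 ∧ FinOrd F m ∧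
      ∃ τ0 > 0, ∀ τ t z : ℝ, 0 < τ → τ < τ0 → 0 < t → |z| < 1 → t ^ (j * l) = X τ → t ^ (j * l) * z = Y τ → F (t, z) = 0 := by
  have triv : (∃ τ0 > 0, ∀ τ : ℝ, 0 < τ → τ < τ0 → ¬ (0 < X τ ∧ |Y τ| < X τ)) → ∃ j : ℕ, 1 ≤ j ∧ ∀ l, 1 ≤ l → ∃ (F : RR → ℝ) (m : ℕ), AnalyticAt ℝ F 0 ∧ FinOrd F m ∧
      ∃ τ0 > 0, ∀ τ t z : ℝ, 0 < τ → τ < τ0 → 0 < t → |z| < 1 → t ^ (j * l) = X τ → t ^ (j * l) * z = Y τ → F (t, z) = 0 := by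
    rintro ⟨τ0, h0, h⟩
    refine ⟨1, le_rfl, fun l _ => ⟨fun _ => 1, 0, analyticAt_const, ⟨fun _ => 1, continuousAt_const, one_ne_zero, by simp⟩, τ0, h0, ?_⟩⟩
    intro τ t z a b c d e f
    have hp : 0 < t ^ (1 * l) := by positivity
    refine absurd ⟨e ▸ hp, ?_⟩ (h τ a b)
    rw [← f, ← e, abs_mul, abs_of_pos hp]
    exact mul_lt_of_lt_one_right hp d
  by_cases hXz : ∀ᶠ τ in 𝓝 (0:ℝ), X τ = 0
  · obtain ⟨τ0, h0, h⟩ := ev_pos hXz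
    exact triv ⟨τ0, h0, fun τ a b c => by rw [h τ a b] at c; exact lt_irrefl _ c.1⟩
  obtain ⟨j, ξ, hξ, hξ0, hXe⟩ := hX.exists_eventuallyEq_pow_smul_nonzero_iff.2 hXz
  simp only [sub_zero, smul_eq_mul] at hXe
  have hj : j ≠ 0 := by
    rintro rfl
    have := hXe.self_of_nhds
    rw [hX0, pow_zero, one_mul] at this
    exact hξ0 this.symm
  have hYc : (∃ υ, AnalyticAt ℝ υ 0 ∧ ∀ᶠ τ in 𝓝 (0:ℝ), Y τ = τ ^ j * υ τ) ∨ ∀ᶠ τ in 𝓝 (0:ℝ), 0 < τ → |X τ| < |Y τ| := by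
    by_cases hYz : ∀ᶠ τ in 𝓝 (0:ℝ), Y τ = 0
    · exact Or.inl ⟨fun _ => 0, analyticAt_const, by simpa using hYz⟩
    obtain ⟨k, υ, hυ, hυ0, hYe⟩ := hY.exists_eventuallyEq_pow_smul_nonzero_iff.2 hYz
    simp only [sub_zero, smul_eq_mul] at hYe
    rcases le_or_gt j k with hjk | hjk
    · refine Or.inl ⟨fun τ => τ ^ (k - j) * υ τ, (analyticAt_id.pow _).mul hυ, ?_⟩
      filter_upwards [hYe] with τ h
      rw [h, ← mul_assoc, ← pow_add]; congr 2; omega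
    · right
      have c1 : ContinuousAt (fun τ => |τ ^ (j - k) * ξ τ|) 0 := ((continuousAt_id.pow _).mul hξ.continuousAt).abs
      have c2 : ContinuousAt (fun τ => |υ τ|) 0 := hυ.continuousAt.abs
      have : ∀ᶠ τ in 𝓝 (0:ℝ), |τ ^ (j - k) * ξ τ| < |υ τ| := c1.eventually_lt c2 (by
        simp [show j - k ≠ 0 by omega, hυ0])
      filter_upwards [hXe, hYe, this] with τ a b c h
      rw [a, b, show τ ^ j = τ ^ k * τ ^ (j - k) by rw [← pow_add]; congr 1; omega, mul_assoc, abs_mul, abs_mul (τ ^ k) (υ τ)]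
      exact mul_lt_mul_of_pos_left c (abs_pos.2 (pow_ne_zero _ h.ne'))
  rcases hYc with ⟨υ, hυ, hYe⟩ | hYc
  swap
  · obtain ⟨τ0, h0, h⟩ := ev_pos hYc
    exact triv ⟨τ0, h0, fun τ a b c => by
      have := h τ a b a
      rw [abs_of_pos c.1] at this; linarith [c.2]⟩
  rcases lt_or_gt_of_ne hξ0 with hneg | hpos
  · obtain ⟨τ0, h0, h⟩ := ev_pos (hXe.and (hξ.continuousAt.eventually_lt continuousAt_const hneg))
    refine triv ⟨τ0, h0, fun τ a b c => ?_⟩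
    have h1 := h τ a b
    have : τ ^ j * ξ τ < 0 := mul_neg_of_pos_of_neg (by positivity) h1.2
    linarith [c.1, h1.1]
  refine ⟨j, by omega, fun l hl => ?_⟩
  have hrp : AnalyticAt ℝ (fun τ => ξ τ ^ ((j:ℝ)⁻¹)) 0 :=
    (ContDiffAt.analyticAt (((contDiffAt_rpow_const_of_ne hξ0).comp (0:ℝ) (hξ.contDiffAt))))
  have hη : AnalyticAt ℝ (fun τ => τ * ξ τ ^ ((j:ℝ)⁻¹)) 0 := analyticAt_id.mul hrp
  have hη' : deriv (fun τ => τ * ξ τ ^ ((j:ℝ)⁻¹)) 0 ≠ 0 := by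
    have := ((hasDerivAt_id (0:ℝ)).mul hrp.differentiableAt.hasDerivAt).deriv
    have e : deriv (fun τ => τ * ξ τ ^ ((j:ℝ)⁻¹)) 0 = ξ 0 ^ ((j:ℝ)⁻¹) := by
      refine this.trans ?_
      simp
    rw [e]; positivity
  set κ := hη.hasStrictDerivAt.localInverse _ _ _ hη' with hκd
  have hκ : AnalyticAt ℝ κ 0 := by
    have := hη.analyticAt_localInverse hη'
    simpa using this
  have hκ0 : ∀ᶠ τ in 𝓝 (0:ℝ), κ (τ * ξ τ ^ ((j:ℝ)⁻¹)) = τ := HasStrictDerivAt.eventually_left_inverse _ hη'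
  have hκz : κ 0 = 0 := by simpa using hκ0.self_of_nhds
  have hζ : AnalyticAt ℝ (fun τ => υ τ / ξ τ) 0 := hυ.div hξ hξ0
  set c := υ 0 / ξ 0 with hc
  obtain ⟨τ0, h0, h⟩ := ev_pos (hXe.and (hYe.and (hκ0.and (hξ.continuousAt.eventually_const_lt hpos))))
  have hF : AnalyticAt ℝ (fun x : RR => x.2 - υ (κ (x.1 ^ l)) / ξ (κ (x.1 ^ l))) 0 := by
    refine analyticAt_snd.sub ?_
    refine AnalyticAt.fun_comp (g := fun τ => υ τ / ξ τ) (f := fun x : RR => κ (x.1 ^ l)) ?_ ?_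
    · simp [show l ≠ 0 by omega, hκz]; exact hζ
    · refine AnalyticAt.fun_comp (g := κ) (f := fun x : RR => x.1 ^ l) ?_ (analyticAt_fst.pow l)
      simpa [show l ≠ 0 by omega] using hκ
  have hm : ∃ m, FinOrd (fun x : RR => x.2 - υ (κ (x.1 ^ l)) / ξ (κ (x.1 ^ l))) m := by
    by_cases hc0 : c = 0
    · exact ⟨1, fun _ => 1, continuousAt_const, one_ne_zero, Eventually.of_forall fun z => by simp [show l ≠ 0 by omega, hκz, ← hc, hc0]⟩
    · exact ⟨0, fun z => z - c, by fun_prop, by simpa using hc0, Eventually.of_forall fun z => by simp [show l ≠ 0 by omega, hκz, ← hc]⟩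
  obtain ⟨m, hm⟩ := hm
  refine ⟨_, m, hF, hm, τ0, h0, fun τ t z a b t0 _ e1 e2 => ?_⟩
  obtain ⟨g1, g2, g3, g4⟩ := h τ a b
  have e3 : t ^ l = τ * ξ τ ^ ((j:ℝ)⁻¹) := by
    refine (pow_left_inj₀ (by positivity) (by positivity) hj).1 ?_
    rw [mul_pow, rpow_inv_natCast_pow g4.le hj, ← g1, ← e1, ← pow_mul, mul_comm]
  simp only [e3, g3]
  rw [e1, g1, g2, mul_assoc] at e2
  have := mul_left_cancel₀ (pow_ne_zero j a.ne') e2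
  rw [← this]; field_simp; ring

lemma curve_param {r₀ : ℝ} (hr₀ : 0 < r₀) {C : Set (RR)} (hC : IsPuiseuxBdryCurve r₀ C) : ∃ X Y : ℝ → ℝ, AnalyticAt ℝ X 0 ∧ AnalyticAt ℝ Y 0 ∧
    X 0 = 0 ∧ Y 0 = 0 ∧ ∀ τ0 > (0:ℝ), ∀ᶠ ρ in 𝓝[>] (0:ℝ), ∀ p ∈ C, ‖p‖ < ρ → p ≠ 0 → ∃ τ, 0 < τ ∧ τ < τ0 ∧ p = (X τ, Y τ) := by
  obtain ⟨N, h, I, σ, hN, hσ, -, hI, han, h0, hC, -⟩ := hC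
  have hh : AnalyticAt ℝ h 0 := han 0 (hI ⟨le_rfl, by positivity⟩)
  have hx : AnalyticAt ℝ (fun τ : ℝ => σ * τ ^ N) 0 := analyticAt_const.mul (analyticAt_id.pow N)
  have key : ∀ a b τ0 ρ : ℝ, 0 < τ0 → ρ < τ0 ^ N → 0 ≤ σ * a → b = h (|a| ^ ((N:ℝ)⁻¹)) → |a| < ρ → (a = 0 → b ≠ 0) →
      ∃ τ, 0 < τ ∧ τ < τ0 ∧ a = σ * τ ^ N ∧ b = h τ := by
    intro a b τ0 ρ hτ hρ hσa hb ha hab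
    have hN' : N ≠ 0 := by omega
    have ha0 : a ≠ 0 := by
      intro e
      refine hab e ?_
      rw [hb, e, abs_zero, Real.zero_rpow (by positivity), h0]
    have e : (|a| ^ ((N:ℝ)⁻¹)) ^ N = |a| := rpow_inv_natCast_pow (abs_nonneg a) hN'
    have := abs_pos.2 ha0
    refine ⟨|a| ^ ((N:ℝ)⁻¹), by positivity, ?_, ?_, hb⟩
    · refine lt_of_pow_lt_pow_left₀ N hτ.le ?_
      rw [e]; linarith
    · rw [e]
      rcases hσ with rfl | rfl
      · rw [one_mul] at *; rw [abs_of_nonneg hσa]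
      · rw [abs_of_nonpos (by linarith)]; ring
  rcases hC with rfl | rfl
  · refine ⟨_, h, hx, hh, by simp [show N ≠ 0 by omega], h0, fun τ0 hτ => ?_⟩
    filter_upwards [mem_nhdsWithin_of_mem_nhds (Iio_mem_nhds (pow_pos hτ N))] with ρ hρ p hp hpρ hp0
    obtain ⟨τ, a, b, c, d⟩ := key p.1 p.2 τ0 ρ hτ hρ hp.2.1 hp.2.2 ((norm_fst_le p).trans_lt hpρ) (fun e1 e2 => hp0 (Prod.ext e1 e2))
    exact ⟨τ, a, b, Prod.ext c d⟩
  · refine ⟨h, _, hh, hx, h0, by simp [show N ≠ 0 by omega], fun τ0 hτ => ?_⟩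
    filter_upwards [mem_nhdsWithin_of_mem_nhds (Iio_mem_nhds (pow_pos hτ N))] with ρ hρ p hp hpρ hp0
    obtain ⟨τ, a, b, c, d⟩ := key p.2 p.1 τ0 ρ hτ hρ hp.2.1 hp.2.2 ((norm_snd_le p).trans_lt hpρ) (fun e1 e2 => hp0 (Prod.ext e2 e1))
    exact ⟨τ, a, b, Prod.ext d c⟩

lemma conn_frontier {Z s : Set (RR)} (hZ : IsPreconnected Z) (h : ∀ p ∈ Z, p ∉ frontier s) : Z ⊆ s ∨ Disjoint Z s := by
  have hsub : Z ⊆ interior s ∪ (closure s)ᶜ := by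
    intro p hp
    by_cases h1 : p ∈ interior s
    · exact Or.inl h1
    · exact Or.inr fun h2 => h p hp ⟨h2, h1⟩
  have hd : Disjoint (interior s) (closure s)ᶜ := disjoint_left.2 fun p a b => b (subset_closure (interior_subset a))
  by_cases hn : (Z ∩ interior s).Nonempty
  · exact Or.inl ((hZ.subset_left_of_subset_union isOpen_interior isClosed_closure.isOpen_compl hd hsub hn).trans interior_subset)
  · refine Or.inr (disjoint_left.2 fun p hp hps => ?_)
    rcases hsub hp with h1 | h1
    · exact hn ⟨p, hp, h1⟩
    · exact h1 (subset_closure hps)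

lemma domain_curves {E : Set (RR)} (hE : IsStdDomain E) : MeasurableSet E ∧ ∃ (κ : Type) (_ : Fintype κ) (X Y : κ → ℝ → ℝ),
    (∀ c, AnalyticAt ℝ (X c) 0 ∧ AnalyticAt ℝ (Y c) 0 ∧ X c 0 = 0 ∧ Y c 0 = 0) ∧
    ∀ τ0 > (0:ℝ), ∀ᶠ ρ in 𝓝[>] (0:ℝ), ∀ Z : Set (RR), (∀ p ∈ Z, ‖p‖ < ρ ∧ p ≠ 0) → IsPreconnected Z →
      (∀ p ∈ Z, ∀ c τ, 0 < τ → τ < τ0 → p ≠ (X c τ, Y c τ)) → Z ⊆ E ∨ Disjoint Z E := by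
  have hball : ∀ r₀ > (0:ℝ), ∀ p : RR, ‖p‖ < r₀ / 2 → p.1 ^ 2 + p.2 ^ 2 < r₀ ^ 2 := by
    intro r₀ h0 p hp
    have h1 := (norm_fst_le p).trans_lt hp
    have h2 := (norm_snd_le p).trans_lt hp
    rw [norm_eq_abs] at h1 h2
    have h3 := sq_lt_sq' (by linarith [(abs_lt.1 h1).1]) (abs_lt.1 h1).2
    have h4 := sq_lt_sq' (by linarith [(abs_lt.1 h2).1]) (abs_lt.1 h2).2
    nlinarith
  rcases hE with ⟨r₀, h0, rfl⟩ | ⟨r₀, h0, m, Es, Cs, rfl, -, hEs, hCs, -⟩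
  · refine ⟨(isOpen_lt (by fun_prop) (by fun_prop)).measurableSet, Empty, inferInstance, fun _ => id, fun _ => id, by simp, fun τ0 _ => ?_⟩
    filter_upwards [mem_nhdsWithin_of_mem_nhds (Iio_mem_nhds (half_pos h0))] with ρ hρ Z hZ _ _
    exact Or.inl fun p hp => hball r₀ h0 p ((hZ p hp).1.trans hρ)
  · choose X Y hX hY hX0 hY0 hc using fun c : Fin m × Fin 2 => curve_param h0 (hCs c.1 c.2)
    refine ⟨MeasurableSet.iUnion fun i => (hEs i).1.measurableSet, Fin m × Fin 2, inferInstance, X, Y,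
      fun c => ⟨hX c, hY c, hX0 c, hY0 c⟩, fun τ0 hτ => ?_⟩
    filter_upwards [mem_nhdsWithin_of_mem_nhds (Iio_mem_nhds (half_pos h0)), eventually_all.2 fun c => hc c τ0 hτ] with ρ hρ hcρ Z hZ hZc hZn
    have hi : ∀ i, Z ⊆ Es i ∨ Disjoint Z (Es i) := by
      refine fun i => conn_frontier hZc fun p hp hf => ?_
      have hno : ∀ j, p ∉ Cs i j := fun j hj => by
        obtain ⟨τ, a, b, e⟩ := hcρ (i, j) p hj (hZ p hp).1 (hZ p hp).2
        exact hZn p hp (i, j) τ a b e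
      rcases (hEs i).2.2.2 hf with (h1 | h1) | h1
      · exact hno 0 h1
      · exact hno 1 h1
      · exact absurd (hball r₀ h0 p ((hZ p hp).1.trans hρ)) (not_lt.2 (le_of_eq (show p.1 ^ 2 + p.2 ^ 2 = r₀ ^ 2 from h1).symm))
    by_cases hex : ∃ i, Z ⊆ Es i
    · obtain ⟨i, h⟩ := hex
      exact Or.inl (h.trans (subset_iUnion Es i))
    · push Not at hex
      exact Or.inr (disjoint_iUnion_right.2 fun i => (hi i).resolve_left (hex i))

def Rot (ω x : RR) : RR := (x.1 * ω.1 + x.2 * ω.2, x.1 * ω.2 - x.2 * ω.1)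

def Ch (ω : RR) (q : ℕ) (x : RR) : RR := Rot ω (x.1 ^ q, x.1 ^ q * x.2)

lemma unit_sq {ω : RR} (h : nrm2 ω = 1) : ω.1 ^ 2 + ω.2 ^ 2 = 1 := by
  unfold nrm2 at h
  rwa [Real.sqrt_eq_one] at h

lemma rot_rot {ω : RR} (h : nrm2 ω = 1) (x : RR) : Rot ω (Rot ω x) = x := by
  have h := unit_sq h
  ext
  · simp only [Rot]; linear_combination x.1 * h
  · simp only [Rot]; linear_combination x.2 * h

lemma ch_an (ω : RR) (q : ℕ) (x : RR) : AnalyticAt ℝ (Ch ω q) x := by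
  unfold Ch Rot
  have h1 : AnalyticAt ℝ (fun x : RR => x.1) x := analyticAt_fst
  have h2 : AnalyticAt ℝ (fun x : RR => x.2) x := analyticAt_snd
  exact AnalyticAt.prod (((h1.pow q).mul analyticAt_const).add (((h1.pow q).mul h2).mul analyticAt_const))
    (((h1.pow q).mul analyticAt_const).sub (((h1.pow q).mul h2).mul analyticAt_const))

lemma ch_cont (ω : RR) (q : ℕ) : Continuous (Ch ω q) := by unfold Ch Rot; fun_prop

lemma ch_zero (ω : RR) {q : ℕ} (hq : 1 ≤ q) (z : ℝ) : Ch ω q (0, z) = 0 := by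
  have : q ≠ 0 := by omega
  simp [Ch, Rot, this]

lemma rot_cont (ω : RR) : Continuous (Rot ω) := by unfold Rot; fun_prop

lemma ch_ne {ω : RR} (h : nrm2 ω = 1) {q : ℕ} {x : RR} (hx : 0 < x.1) : Ch ω q x ≠ 0 := by
  intro e
  have := congrArg (fun y => (Rot ω y).1) e
  simp only [Ch, rot_rot h] at this
  have h2 : 0 < x.1 ^ q := by positivity
  simp [Rot] at this
  exact hx.ne' this.1

lemma sector_fn {f : RR → ℝ} (hf : AnalyticAt ℝ f 0) (h0 : ¬ ∀ᶠ p in 𝓝 (0:RR), f p = 0) {ω : RR} (hω : nrm2 ω = 1)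
    {q : ℕ} (hq : 1 ≤ q) : ∃ (k : ℕ) (G : RR → ℝ) (m : ℕ), AnalyticAt ℝ G 0 ∧ FinOrd G m ∧
      ∀ᶠ x in 𝓝 (0:RR), f (Ch ω q x) = x.1 ^ k * G x := by
  have hc0 : Ch ω q (0:RR) = 0 := ch_zero ω hq 0
  have hq0 : q ≠ 0 := by omega
  have hfc : AnalyticAt ℝ (fun x => f (Ch ω q x)) 0 := AnalyticAt.fun_comp (g := f) (f := Ch ω q) (by rw [hc0]; exact hf) (ch_an ω q 0)
  have hn : ¬ ∀ᶠ x in 𝓝 (0:RR), f (Ch ω q x) = 0 := by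
    intro hev
    obtain ⟨η, hη, hb⟩ := Metric.eventually_nhds_iff_ball.1 hf.eventually_analyticAt
    have hev2 : ∀ᶠ x in 𝓝 (0:RR), (∀ᶠ y in 𝓝 x, f (Ch ω q y) = 0) ∧ Ch ω q x ∈ ball (0:RR) η := by
      refine hev.eventually_nhds.and ?_
      have : Tendsto (Ch ω q) (𝓝 0) (𝓝 0) := by simpa [hc0] using (ch_cont ω q).tendsto 0
      exact this (ball_mem_nhds 0 hη)
    have ht : Tendsto (fun t : ℝ => ((t, 0) : RR)) (𝓝 0) (𝓝 0) := by
      have : Continuous (fun t : ℝ => ((t, 0) : RR)) := by fun_prop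
      exact this.tendsto 0
    obtain ⟨τ, hτ, hτ'⟩ := ev_pos (ht.eventually hev2)
    obtain ⟨e1, e2⟩ := hτ' (τ / 2) (by linarith) (by linarith)
    have hτp : 0 < (τ / 2) ^ q := by positivity
    let inv : RR → RR := fun p => ((Rot ω p).1 ^ ((q:ℝ)⁻¹), (Rot ω p).2 / (Rot ω p).1)
    have hR : Rot ω (Ch ω q (τ / 2, 0)) = ((τ / 2) ^ q, (τ / 2) ^ q * 0) := rot_rot hω _
    have hi0 : inv (Ch ω q (τ / 2, 0)) = (τ / 2, 0) := by
      simp only [inv, hR]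
      rw [Real.pow_rpow_inv_natCast (by linarith) hq0]; simp
    have h1 : ContinuousAt (fun p => (Rot ω p).1) (Ch ω q (τ / 2, 0)) := (continuous_fst.comp (rot_cont ω)).continuousAt
    have h2 : ContinuousAt (fun p => (Rot ω p).2) (Ch ω q (τ / 2, 0)) := (continuous_snd.comp (rot_cont ω)).continuousAt
    have hi : ContinuousAt inv (Ch ω q (τ / 2, 0)) :=
      (h1.rpow_const (Or.inr (by positivity))).prodMk (h2.div h1 (by rw [hR]; exact hτp.ne'))
    have e3 : ∀ᶠ p in 𝓝 (Ch ω q (τ / 2, 0)), f p = 0 := by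
      have e4 := hi.tendsto
      rw [hi0] at e4
      filter_upwards [e4.eventually e1, h1.eventually (lt_mem_nhds (show 0 < (Rot ω (Ch ω q (τ / 2, 0))).1 by rw [hR]; exact hτp))] with p hp hp2
      have : Ch ω q (inv p) = p := by
        have e : (((inv p).1 ^ q, (inv p).1 ^ q * (inv p).2) : RR) = Rot ω p := by
          have e5 : (inv p).1 ^ q = (Rot ω p).1 := rpow_inv_natCast_pow hp2.le hq0
          rw [e5]
          exact Prod.ext rfl (mul_div_cancel₀ _ hp2.ne')
        rw [Ch, e, rot_rot hω]
      rwa [this] at hp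
    have := AnalyticOnNhd.eqOn_zero_of_preconnected_of_eventuallyEq_zero (fun x hx => hb x hx) (convex_ball (0:RR) η).isPreconnected e2 e3
    exact h0 (by filter_upwards [ball_mem_nhds (0:RR) hη] with p hp using this hp)
  obtain ⟨k, G, hG, hk, hGn⟩ := tdiv_exists hfc hn
  have hG1 : AnalyticAt ℝ (fun z : ℝ => G (0, z)) 0 :=
    AnalyticAt.fun_comp (g := G) (f := fun z : ℝ => ((0:ℝ), z)) hG (AnalyticAt.prod analyticAt_const analyticAt_id)
  obtain ⟨m, r, hr, hr0, hm⟩ := order_exists hG1 hGn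
  exact ⟨k, G, m, hG, ⟨r, hr.continuousAt, hr0, hm⟩, hk⟩

set_option maxHeartbeats 1600000 in
lemma sector_data {n : ℕ} {f : Fin n → RR → ℝ} {γ : Fin n → ℝ} {E : Set (RR)} (hsf : StandardForm n f γ E)
    {ω : RR} (hω : nrm2 ω = 1) : ∃ (ι : Type) (_ : Fintype ι) (D : EData ι), D.OK ∧ D.P = D.q ∧ (∀ x, D.F D.i0 x = x.2) ∧
      ∃ ρ > 0, ∀ t z : ℝ, 0 < t → t < ρ → |z| < ρ → D.wt (t, z) = t ^ (D.q - 1) * t ^ D.q * stdFun n f γ E (Ch ω D.q (t, z)) := by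
  obtain ⟨hEm, κ, hκ, X, Y, hXY, hdom⟩ := domain_curves hsf.domain
  obtain ⟨U, hU, hfa⟩ := hsf.analytic
  have hcf : ∀ c, ∃ j : ℕ, 1 ≤ j ∧ ∀ l, 1 ≤ l → ∃ (F : RR → ℝ) (m : ℕ), AnalyticAt ℝ F 0 ∧ FinOrd F m ∧
      ∃ τ0 > 0, ∀ τ t z : ℝ, 0 < τ → τ < τ0 → 0 < t → |z| < 1 → t ^ (j * l) = (Rot ω (X c τ, Y c τ)).1 →
        t ^ (j * l) * z = (Rot ω (X c τ, Y c τ)).2 → F (t, z) = 0 := by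
    intro c
    obtain ⟨h1, h2, h3, h4⟩ := hXY c
    refine curve_fn (X := fun τ => (Rot ω (X c τ, Y c τ)).1) (Y := fun τ => (Rot ω (X c τ, Y c τ)).2) ?_ ?_ ?_
    · exact (h1.mul analyticAt_const).add (h2.mul analyticAt_const)
    · exact (h1.mul analyticAt_const).sub (h2.mul analyticAt_const)
    · simp [Rot, h3, h4]
  choose j hj hjl using hcf
  let q := ∏ c, j c
  have hq : 1 ≤ q := Nat.succ_le_of_lt (Finset.prod_pos fun c _ => Nat.lt_of_succ_le (hj c))
  have hl : ∀ c, 1 ≤ q / j c ∧ j c * (q / j c) = q := by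
    intro c
    have hd : j c ∣ q := Finset.dvd_prod_of_mem j (Finset.mem_univ c)
    exact ⟨Nat.div_pos (Nat.le_of_dvd hq hd) (hj c), Nat.mul_div_cancel' hd⟩
  choose Fc mc hFc hmc τ0 hτ0 hz using fun c => hjl c (q / j c) (hl c).1
  simp only [(hl _).2] at hz
  choose k G mG hG hmG hk using fun i => sector_fn (hfa i 0 (mem_of_mem_nhds hU)) (hsf.nontriv i) hω hq
  let D : EData (Option (Fin n ⊕ κ)) :=
    { F := fun o => o.elim (fun x => x.2) (Sum.elim G Fc)
      m := fun o => o.elim 1 (Sum.elim mG mc)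
      γ := fun o => o.elim 0 (Sum.elim γ fun _ => 0)
      i0 := none
      b := (q - 1 : ℕ) + q + ∑ i, k i * γ i
      P := q
      q := q
      S := Ch ω q ⁻¹' E }
  refine ⟨_, inferInstance, D, ⟨?_, ?_, ?_, ?_, hq, le_rfl, fun _ => le_rfl⟩, rfl, fun _ => rfl, ?_⟩
  · rintro (_ | i | c)
    · exact analyticAt_snd
    · exact hG i
    · exact hFc c
  · rintro (_ | i | c)
    · exact ⟨fun _ => 1, continuousAt_const, one_ne_zero, by simp [D]⟩
    · exact hmG i
    · exact hmc c
  · exact (ch_cont ω q).measurable hEm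
  · obtain ⟨τ, hτ, hτc⟩ : ∃ τ > 0, ∀ c, τ ≤ τ0 c := by
      have : ∀ᶠ τ in 𝓝[>] (0:ℝ), ∀ c, τ < τ0 c := eventually_all.2 fun c => mem_nhdsWithin_of_mem_nhds (Iio_mem_nhds (hτ0 c))
      obtain ⟨τ, h1, h2⟩ := (this.and self_mem_nhdsWithin).exists
      exact ⟨τ, h2, fun c => (h1 c).le⟩
    obtain ⟨ρ', h1, hρ'⟩ := ((hdom τ hτ).and self_mem_nhdsWithin).exists
    have hc : ∀ᶠ x in 𝓝 (0:RR), ‖Ch ω q x‖ < ρ' := by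
      have : Tendsto (fun x => ‖Ch ω q x‖) (𝓝 0) (𝓝 0) := by
        have := (ch_cont ω q).norm.tendsto 0
        rwa [show Ch ω q (0:RR) = 0 from ch_zero ω hq 0, norm_zero] at this
      exact this (Iio_mem_nhds hρ')
    obtain ⟨η, hη, hb⟩ := Metric.eventually_nhds_iff_ball.1 hc
    refine ⟨min η 1, by positivity, fun Z hZ hZc hZn => ?_⟩
    have hbx : ∀ x ∈ Z, 0 < x.1 ∧ |x.2| < 1 ∧ x ∈ ball (0:RR) η := by
      intro x hx
      obtain ⟨⟨a, b⟩, c⟩ := hZ hx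
      have c : |x.2| < min η 1 := abs_lt.2 c
      refine ⟨a, c.trans_le (min_le_right _ _), ?_⟩
      rw [mem_ball_zero_iff, Prod.norm_def, max_lt_iff, norm_eq_abs, norm_eq_abs, abs_of_pos a]
      exact ⟨b.trans_le (min_le_left _ _), c.trans_le (min_le_left _ _)⟩
    suffices h : Ch ω q '' Z ⊆ E ∨ Disjoint (Ch ω q '' Z) E by
      rcases h with h | h
      · exact Or.inl (image_subset_iff.1 h)
      · exact Or.inr (disjoint_left.2 fun x hx hxs => disjoint_left.1 h (mem_image_of_mem _ hx) hxs)
    refine h1 (Ch ω q '' Z) ?_ (hZc.image _ (ch_cont ω q).continuousOn) ?_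
    · rintro _ ⟨x, hx, rfl⟩
      exact ⟨hb x (hbx x hx).2.2, ch_ne hω (hbx x hx).1⟩
    · rintro _ ⟨x, hx, rfl⟩ c τ' ha hb' he
      have hr : Rot ω (X c τ', Y c τ') = (x.1 ^ q, x.1 ^ q * x.2) := by rw [← he, Ch, rot_rot hω]
      refine hZn (some (Sum.inr c)) x hx ?_
      exact hz c τ' x.1 x.2 ha (hb'.trans_le (hτc c)) (hbx x hx).1 (hbx x hx).2.1 (by rw [hr]) (by rw [hr])
  · obtain ⟨η, hη, hb⟩ := Metric.eventually_nhds_iff_ball.1 (eventually_all.2 hk)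
    refine ⟨η, hη, fun t z ht htη hzη => ?_⟩
    have hm : ((t, z) : RR) ∈ ball (0:RR) η := by
      rw [mem_ball_zero_iff, Prod.norm_def, max_lt_iff, norm_eq_abs, norm_eq_abs, abs_of_pos ht]
      exact ⟨htη, hzη⟩
    have hb := hb _ hm
    change (Ch ω q ⁻¹' E).indicator _ (t, z) = t ^ (q - 1) * t ^ q * E.indicator _ (Ch ω q (t, z))
    by_cases hE : Ch ω q (t, z) ∈ E
    · rw [indicator_of_mem (show (t, z) ∈ Ch ω q ⁻¹' E from hE), indicator_of_mem hE]
      simp only [D, Fintype.prod_option, Fintype.prod_sum_type, Option.elim_none, Option.elim_some, Sum.elim_inl, Sum.elim_inr,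
        rpow_zero, Finset.prod_const_one, one_mul, mul_one]
      rw [rpow_add ht, rpow_add ht, rpow_natCast, rpow_natCast, rpow_sum_of_pos ht, mul_assoc, ← Finset.prod_mul_distrib]
      congr 1
      refine Finset.prod_congr rfl fun i _ => ?_
      rw [hb i, abs_mul, mul_rpow (abs_nonneg _) (abs_nonneg _), abs_of_pos (pow_pos ht _), rpow_mul ht.le, rpow_natCast]
    · rw [indicator_of_notMem (show (t, z) ∉ Ch ω q ⁻¹' E from hE), indicator_of_notMem hE, mul_zero]

lemma rot_mp {ω : RR} (hω : nrm2 ω = 1) : MeasurePreserving (Rot ω) := by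
  refine ⟨(rot_cont ω).measurable, ?_⟩
  have h := unit_sq hω
  let Q := Matrix.toLin (Module.Basis.finTwoProd ℝ) (Module.Basis.finTwoProd ℝ) !![ω.1, ω.2; ω.2, -ω.1]
  have hQ : (Q : RR → RR) = Rot ω := by
    funext x
    simp only [Q, Matrix.toLin_finTwoProd_apply, Rot]
    ext <;> simp <;> ring
  have hd : LinearMap.det Q = -1 := by
    simp only [Q, LinearMap.det_toLin, Matrix.det_fin_two_of]; linarith
  rw [← hQ, Measure.map_linearMap_addHaar_eq_smul_addHaar volume (by rw [hd]; norm_num), hd]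
  simp

def rotME {ω : RR} (hω : nrm2 ω = 1) : (RR) ≃ᵐ (RR) where
  toFun := Rot ω
  invFun := Rot ω
  left_inv := rot_rot hω
  right_inv := rot_rot hω
  measurable_toFun := (rot_cont ω).measurable
  measurable_invFun := (rot_cont ω).measurable

lemma rot_me {ω : RR} (hω : nrm2 ω = 1) : MeasurableEmbedding (Rot ω) := (rotME hω).measurableEmbedding

lemma unit_abs {ω : RR} (hω : nrm2 ω = 1) : |ω.1| ≤ 1 ∧ |ω.2| ≤ 1 := by
  have h := unit_sq hω
  exact ⟨abs_le_of_sq_le_sq (by nlinarith) zero_le_one, abs_le_of_sq_le_sq (by nlinarith) zero_le_one⟩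

lemma perp_unit {ω : RR} (hω : nrm2 ω = 1) : nrm2 (perp2 ω) = 1 := by
  have h := unit_sq hω
  rw [nrm2, perp2, Real.sqrt_eq_one]; simp only; linarith

lemma dot_norm_le {u : RR} (hu : nrm2 u = 1) (p : RR) : |dot2 p u| ≤ 2 * ‖p‖ := by
  obtain ⟨h1, h2⟩ := unit_abs hu
  have h3 := norm_fst_le p
  have h4 := norm_snd_le p
  rw [norm_eq_abs] at h3 h4
  unfold dot2
  refine (abs_add_le _ _).trans ?_
  rw [abs_mul, abs_mul]
  have := mul_le_mul h3 h1 (abs_nonneg _) (norm_nonneg p)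
  have := mul_le_mul h4 h2 (abs_nonneg _) (norm_nonneg p)
  linarith

lemma dot_sub (p q u : RR) : dot2 (p - q) u = dot2 p u - dot2 q u := by simp [dot2]; ring

lemma dot_self {ω : RR} (hω : nrm2 ω = 1) : dot2 ω ω = 1 := by
  have h := unit_sq hω
  simp only [dot2]; linarith

lemma near_dir {w ω : RR} (hω : nrm2 ω = 1) {r : ℝ} (hr : r ≤ 1 / 8) (h : dist w ω < r) :
    3 / 4 ≤ dot2 w ω ∧ |dot2 w (perp2 ω)| < 2 * r := by
  rw [dist_eq_norm] at h
  have h1 := dot_norm_le hω (w - ω)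
  have h2 := dot_norm_le (perp_unit hω) (w - ω)
  rw [dot_sub, dot_self hω] at h1
  rw [dot_sub, show dot2 ω (perp2 ω) = 0 by simp [dot2, perp2]; ring, sub_zero] at h2
  exact ⟨by linarith [(abs_le.1 h1).1], by linarith⟩

def dirn (p : RR) : RR := (nrm2 p)⁻¹ • p

lemma nrm_rot {ω : RR} (hω : nrm2 ω = 1) (x : RR) : nrm2 (Rot ω x) = nrm2 x := by
  have h := unit_sq hω
  unfold nrm2
  congr 1
  simp only [Rot]; linear_combination (x.1 ^ 2 + x.2 ^ 2) * h

lemma ch_smul (ω : RR) (q : ℕ) (x : RR) : Ch ω q x = x.1 ^ q • Rot ω (1, x.2) := by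
  ext <;> simp [Ch, Rot] <;> ring

lemma dirn_smul {c : ℝ} (hc : 0 < c) (p : RR) : dirn (c • p) = dirn p := by
  have : nrm2 (c • p) = c * nrm2 p := by
    unfold nrm2
    rw [← Real.sqrt_sq hc.le, ← Real.sqrt_mul (sq_nonneg c), Real.sqrt_sq hc.le]
    congr 1; simp; ring
  rw [dirn, dirn, this, smul_smul]
  congr 1; field_simp

lemma dot_rot {ω : RR} (x v : RR) : dot2 (Rot ω x) v = dot2 v ω * x.1 + dot2 v (perp2 ω) * x.2 := by
  simp [dot2, Rot, perp2]; ring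

lemma dot_rot1 {ω : RR} (hω : nrm2 ω = 1) (x : RR) : dot2 (Rot ω x) ω = x.1 := by
  rw [dot_rot, dot_self hω]; simp only [dot2, perp2]; ring

lemma dot_rot2 {ω : RR} (hω : nrm2 ω = 1) (x : RR) : dot2 (Rot ω x) (perp2 ω) = x.2 := by
  have := dot_self (perp_unit hω)
  rw [dot_rot, this]; simp only [dot2, perp2]; ring

structure Amp (B s : ℝ) (a : RR → ℝ) : Prop where
  cd : ∀ p : RR, p ≠ 0 → ContDiffAt ℝ 1 a p
  b0 : ∀ p : RR, p ≠ 0 → |a p| ≤ B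
  b1 : ∀ p : RR, p ≠ 0 → ‖p‖ * ‖fderiv ℝ a p‖ ≤ B
  supp : ∀ p : RR, s ≤ ‖p‖ → a p = 0

lemma dirX {χ : RR → ℝ} (hχ : ContDiff ℝ 1 χ) {ω : RR} (hω : nrm2 ω = 1) {r : ℝ} (hr0 : 0 < r) (hr : r ≤ 1 / 8)
    (hz : ∀ z, r ≤ dist z ω → χ z = 0) : ContDiff ℝ 1 (fun z : ℝ => χ (dirn (Rot ω (1, z)))) ∧
    (∀ z : ℝ, 4 * r ≤ |z| → χ (dirn (Rot ω (1, z))) = 0) ∧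
    ∃ M : ℝ, 0 ≤ M ∧ ∀ z, |deriv (fun z : ℝ => χ (dirn (Rot ω (1, z)))) z| ≤ M := by
  have hN : ∀ z : ℝ, nrm2 (Rot ω (1, z)) = √(1 + z ^ 2) := fun z => by rw [nrm_rot hω]; simp [nrm2]
  have h1 : ContDiff ℝ 1 (fun z : ℝ => χ (dirn (Rot ω (1, z)))) := by
    refine hχ.comp ?_
    unfold dirn
    simp only [hN]
    refine ContDiff.smul (ContDiff.inv (ContDiff.sqrt (by fun_prop) (fun z => by positivity)) (fun z => by positivity)) ?_
    unfold Rot; fun_prop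
  have h2 : ∀ z : ℝ, 4 * r ≤ |z| → χ (dirn (Rot ω (1, z))) = 0 := by
    intro z hzr
    apply hz
    by_contra hcon
    obtain ⟨a, b⟩ := near_dir hω hr (not_le.1 hcon)
    have hd : ∀ u, dot2 (dirn (Rot ω (1, z))) u = (√(1 + z ^ 2))⁻¹ * dot2 (Rot ω (1, z)) u := by
      intro u; rw [dirn, hN]; simp [dot2]; ring
    rw [hd, dot_rot1 hω, mul_one] at a
    rw [hd, dot_rot2 hω] at b
    simp only at b
    rw [abs_mul, abs_of_pos (by positivity)] at b
    nlinarith [abs_nonneg z]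
  refine ⟨h1, h2, ?_⟩
  have hcs : HasCompactSupport (fun z : ℝ => χ (dirn (Rot ω (1, z)))) := by
    refine HasCompactSupport.of_support_subset_isCompact (isCompact_Icc (a := -(4 * r)) (b := 4 * r)) fun z hz' => ?_
    by_contra hcon
    refine hz' (h2 z ?_)
    by_contra h
    exact hcon (abs_le.1 (not_le.1 h).le)
  obtain ⟨M, hM⟩ := (h1.continuous_deriv le_rfl).bounded_above_of_compact_support hcs.deriv
  exact ⟨M, (norm_nonneg _).trans (hM 0), hM⟩

lemma ch_ge {ω : RR} (hω : nrm2 ω = 1) (y : RR) : y.1 ≤ 2 * ‖Rot ω y‖ := by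
  have := dot_norm_le hω (Rot ω y)
  rw [dot_rot1 hω] at this
  exact (le_abs_self _).trans this

set_option maxHeartbeats 800000 in
lemma amp_adm {ω : RR} (hω : nrm2 ω = 1) {q : ℕ} (hq : 1 ≤ q) {B r' : ℝ} (hr' : 0 < r') (hB : 0 ≤ B) {a : RR → ℝ} (ha : Amp B (r' ^ q / 2) a)
    {X : ℝ → ℝ} (hX : ContDiff ℝ 1 X) (hX1 : ∀ z, |X z| ≤ 1) {M : ℝ} (hM0 : 0 ≤ M) (hM : ∀ z, |deriv X z| ≤ M) (hXs : ∀ z, r' ≤ |z| → X z = 0) :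
    Adm (q * (q + 2) * B * (1 + M)) r' (fun x => q * a (Ch ω q x) * X x.2) := by
  have hq1 : (1:ℝ) ≤ q := by exact_mod_cast hq
  have hC : ∀ x : RR, ∃ L : RR →L[ℝ] RR, HasFDerivAt (Ch ω q) L x ∧ (0 < x.1 → x.1 • L (1, 0) = (q:ℝ) • Ch ω q x) ∧ L (0, 1) = x.1 ^ q • Rot ω (0, 1) := by
    intro x
    have h1 : HasFDerivAt (fun y : RR => y.1) (ContinuousLinearMap.fst ℝ ℝ ℝ) x := hasFDerivAt_fst
    have h2 : HasFDerivAt (fun y : RR => y.2) (ContinuousLinearMap.snd ℝ ℝ ℝ) x := hasFDerivAt_snd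
    have h3 : HasFDerivAt (fun y : RR => y.1 ^ q) _ x := (hasDerivAt_pow q x.1).comp_hasFDerivAt x h1
    have h4 : HasFDerivAt (fun y : RR => y.1 ^ q * y.2) _ x := h3.mul h2
    have h5 : HasFDerivAt (Ch ω q) _ x := ((h3.mul_const ω.1).add (h4.mul_const ω.2)).prodMk ((h3.mul_const ω.2).sub (h4.mul_const ω.1))
    have e : ∀ hx : 0 < x.1, x.1 ^ q = x.1 * x.1 ^ (q - 1) := fun hx => by rw [← pow_succ']; congr 1; omega
    refine ⟨_, h5, fun hx => ?_, ?_⟩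
    · ext <;> simp [Ch, Rot, e hx] <;> ring
    · ext <;> simp [Rot] <;> ring
  have hmain : ∀ x : RR, 0 < x.1 → ContDiffAt ℝ 1 (fun x : RR => q * a (Ch ω q x) * X x.2) x ∧
      ∃ L : RR →L[ℝ] RR, (x.1 • L (1, 0) = (q:ℝ) • Ch ω q x) ∧ L (0, 1) = x.1 ^ q • Rot ω (0, 1) ∧
      fderiv ℝ (fun x : RR => q * a (Ch ω q x) * X x.2) x (1, 0) = q * fderiv ℝ a (Ch ω q x) (L (1, 0)) * X x.2 ∧
      fderiv ℝ (fun x : RR => q * a (Ch ω q x) * X x.2) x (0, 1) = q * fderiv ℝ a (Ch ω q x) (L (0, 1)) * X x.2 + q * a (Ch ω q x) * deriv X x.2 := by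
    intro x hx
    have hne := ch_ne hω (q := q) hx
    have hca := ha.cd _ hne
    refine ⟨?_, ?_⟩
    · exact (contDiffAt_const.mul (hca.comp x (ch_an ω q x).contDiffAt)).mul (hX.contDiffAt.comp x contDiffAt_snd)
    · obtain ⟨L, hL, h1, h2⟩ := hC x
      refine ⟨L, h1 hx, h2, ?_⟩
      have e1 : HasFDerivAt (fun x => a (Ch ω q x)) _ x := HasFDerivAt.comp (g := a) (f := Ch ω q) x (hca.differentiableAt one_ne_zero).hasFDerivAt hL
      have e0 : HasFDerivAt (fun y : RR => y.2) (ContinuousLinearMap.snd ℝ ℝ ℝ) x := hasFDerivAt_snd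
      have e2 : HasFDerivAt (fun x : RR => X x.2) _ x := (hX.differentiable one_ne_zero x.2).hasDerivAt.comp_hasFDerivAt x e0
      have e3 : HasFDerivAt (fun x : RR => q * a (Ch ω q x) * X x.2) _ x := (e1.const_mul (q:ℝ)).mul e2
      rw [e3.fderiv]
      constructor
      · simp; ring
      · simp; ring
  have hle : 0 ≤ q * B := by positivity
  have hle2 : 0 ≤ q * B * M := by positivity
  have hle3 : q * B * 1 ≤ q * B * q := by gcongr
  have hle4 : q * B * M * 1 ≤ q * B * M * q := by gcongr
  have hchn : ∀ x : RR, 0 < x.1 → x.1 ^ q ≤ 2 * ‖Ch ω q x‖ := fun x hx => by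
    have := ch_ge hω (x.1 ^ q, x.1 ^ q * x.2); exact this
  refine ⟨fun x hx => (hmain x hx).1, fun x hx => ?_, fun x hx => ?_, fun x hx => ?_, fun x hx h => ?_⟩
  · rw [abs_mul, abs_mul, Nat.abs_cast]
    have h1 := ha.b0 _ (ch_ne hω (q := q) hx)
    calc (q:ℝ) * |a (Ch ω q x)| * |X x.2| ≤ q * B * 1 := by gcongr; exact hX1 _
      _ ≤ _ := by nlinarith
  · obtain ⟨-, L, h1, h2, h3, h4⟩ := hmain x hx
    rw [h3]
    have e : x.1 * (q * fderiv ℝ a (Ch ω q x) (L (1, 0)) * X x.2) = q * fderiv ℝ a (Ch ω q x) (x.1 • L (1, 0)) * X x.2 := by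
      rw [map_smul, smul_eq_mul]; ring
    rw [e, h1, map_smul, smul_eq_mul, abs_mul, abs_mul, abs_mul, Nat.abs_cast]
    have h5 : |fderiv ℝ a (Ch ω q x) (Ch ω q x)| ≤ B := by
      refine ((fderiv ℝ a (Ch ω q x)).le_opNorm _).trans ?_
      rw [mul_comm]; exact ha.b1 _ (ch_ne hω hx)
    calc (q:ℝ) * (q * |fderiv ℝ a (Ch ω q x) (Ch ω q x)|) * |X x.2| ≤ q * (q * B) * 1 := by gcongr; exact hX1 _
      _ ≤ _ := by nlinarith
  · obtain ⟨-, L, h1, h2, h3, h4⟩ := hmain x hx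
    rw [h4, h2]
    have h5 : |fderiv ℝ a (Ch ω q x) (x.1 ^ q • Rot ω (0, 1))| ≤ 2 * B := by
      refine ((fderiv ℝ a (Ch ω q x)).le_opNorm _).trans ?_
      have h6 : ‖x.1 ^ q • Rot ω (0, 1)‖ ≤ 2 * ‖Ch ω q x‖ := by
        rw [norm_smul, norm_eq_abs, abs_of_pos (by positivity)]
        have : ‖Rot ω (0, 1)‖ ≤ 1 := by
          rw [Prod.norm_def, max_le_iff]; simpa [Rot] using (unit_abs hω).symm
        nlinarith [hchn x hx, norm_nonneg (Rot ω (0, 1)), pow_pos hx q]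
      have := ha.b1 _ (ch_ne hω (q := q) hx)
      nlinarith [norm_nonneg (fderiv ℝ a (Ch ω q x))]
    refine (abs_add_le _ _).trans ?_
    rw [abs_mul, abs_mul, abs_mul, abs_mul, Nat.abs_cast]
    have h1 := ha.b0 _ (ch_ne hω (q := q) hx)
    have e1 : (q:ℝ) * |fderiv ℝ a (Ch ω q x) (x.1 ^ q • Rot ω (0, 1))| * |X x.2| ≤ q * (2 * B) * 1 := by gcongr; exact hX1 _
    have e2 : (q:ℝ) * |a (Ch ω q x)| * |deriv X x.2| ≤ q * B * M := by gcongr; exact hM _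
    nlinarith
  · rcases h with h | h
    · have h1 : r' ^ q ≤ x.1 ^ q := by gcongr
      rw [ha.supp (Ch ω q x) (by linarith [hchn x hx])]; simp
    · rw [hXs _ h, mul_zero]

lemma std_nonneg {n : ℕ} (f : Fin n → RR → ℝ) (γ : Fin n → ℝ) (E : Set (RR)) (p : RR) : 0 ≤ stdFun n f γ E p :=
  indicator_nonneg (fun _ _ => Finset.prod_nonneg fun _ _ => rpow_nonneg (abs_nonneg _) _) p

lemma vc_sector {vs ω : RR} (hω : nrm2 ω = 1) (hvs : nrm2 vs = 1) : ∃ (T : Bool) (c0 : ℝ), 0 < c0 ∧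
    (∀ v, nrm2 v = 1 → dist v vs < c0 / 2 → Vc T c0 (dot2 v ω) (dot2 v (perp2 ω))) ∧
    ∀ (t z : ℝ), 0 ≤ t → |z| ≤ 1 → |dot2 (Rot ω (t, t * z)) vs| ≤ 2 * (if T then |t * z| else t) := by
  have hsum : ∀ v, nrm2 v = 1 → dot2 v ω ^ 2 + dot2 v (perp2 ω) ^ 2 = 1 := by
    intro v hv
    have h1 := unit_sq hω
    have h2 := unit_sq hv
    simp only [dot2, perp2]
    linear_combination (v.1 ^ 2 + v.2 ^ 2) * h1 + h2
  have hle : ∀ v, nrm2 v = 1 → |dot2 v ω| ≤ 1 ∧ |dot2 v (perp2 ω)| ≤ 1 := fun v hv =>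
    ⟨abs_le_of_sq_le_sq (by nlinarith [hsum v hv]) zero_le_one, abs_le_of_sq_le_sq (by nlinarith [hsum v hv]) zero_le_one⟩
  have hdif : ∀ u v c, nrm2 u = 1 → dist v vs < c / 2 → |dot2 vs u| - c ≤ |dot2 v u| := by
    intro u v c hu hv
    rw [dist_eq_norm] at hv
    have h1 := dot_norm_le hu (v - vs)
    rw [dot_sub] at h1
    have h2 := abs_sub_abs_le_abs_sub (dot2 vs u) (dot2 v u)
    rw [abs_sub_comm] at h2
    linarith
  by_cases h0 : dot2 vs ω = 0
  · have h1 : |dot2 vs (perp2 ω)| = 1 := by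
      have := hsum vs hvs
      rw [h0] at this
      rw [← sq_eq_sq₀ (abs_nonneg _) zero_le_one, sq_abs]; linarith
    refine ⟨true, 1 / 2, by norm_num, fun v hv hd => ?_, fun t z ht hz => ?_⟩
    · have := hdif (perp2 ω) v _ (perp_unit hω) hd
      simp only [Vc, if_true]; linarith
    · rw [dot_rot, h0, zero_mul, zero_add, abs_mul, h1]
      simp only [if_true]
      linarith [abs_nonneg (t * z)]
  · have h1 := abs_pos.2 h0
    refine ⟨false, |dot2 vs ω| / 2, by positivity, fun v hv hd => ?_, fun t z ht hz => ?_⟩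
    · have := hdif ω v _ hω hd
      simp only [Vc, Bool.false_eq_true, if_false]
      exact ⟨by linarith, (hle v hv).2⟩
    · rw [dot_rot]
      simp only [Bool.false_eq_true, if_false]
      refine (abs_add_le _ _).trans ?_
      rw [abs_mul, abs_mul, abs_mul, abs_of_nonneg ht]
      have := mul_le_mul_of_nonneg_right (hle vs hvs).1 ht
      have : |dot2 vs (perp2 ω)| * (t * |z|) ≤ 1 * (t * 1) := by gcongr; exact (hle vs hvs).2
      linarith

set_option maxHeartbeats 1600000 in
lemma sector_est {n : ℕ} {f : Fin n → RR → ℝ} {γ : Fin n → ℝ} {E : Set (RR)} (hsf : StandardForm n f γ E)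
    {ω vs : RR} (hω : nrm2 ω = 1) (hvs : nrm2 vs = 1) {R : ℝ} (hR : 0 < R) : ∃ r > (0:ℝ), ∃ ν > (0:ℝ), ∃ s > (0:ℝ),
    ∀ χ : RR → ℝ, ContDiff ℝ 1 χ → (∀ z, |χ z| ≤ 1) → (∀ z, r ≤ dist z ω → χ z = 0) → ∀ B, 0 ≤ B → ∃ C : ℝ, 0 ≤ C ∧
    ∀ (lam : ℝ) (v : RR) (a : RR → ℝ), 0 < lam → nrm2 v = 1 → dist v vs < ν → Amp B s a →
      ‖∫ p, ((χ (dirn p) * a p * stdFun n f γ E p : ℝ) : ℂ) * Complex.exp (Complex.I * ((lam * dot2 p v : ℝ) : ℂ))‖ₑ ≤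
        ENNReal.ofReal C * ∫⁻ p in disk2 R, ENNReal.ofReal (stdFun n f γ E p * gain (lam * |dot2 p vs|)) := by
  obtain ⟨ι, hι, D, hD, hPq, hF0, ρ, hρ, hwt⟩ := sector_data hsf hω
  obtain ⟨T, c0, hc0, hVc, hdot⟩ := vc_sector hω hvs
  obtain ⟨r0, hr0, hr0'⟩ : ∃ r0 > 0, r0 ≤ ρ ∧ r0 ≤ 1 ∧ r0 ≤ R / 2 := ⟨min ρ (min 1 (R / 2)), by positivity, min_le_left _ _,
    (min_le_right _ _).trans (min_le_left _ _), (min_le_right _ _).trans (min_le_right _ _)⟩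
  obtain ⟨r', hr', hr'0, hest⟩ := est_all T _ D hD rfl c0 hc0 r0 hr0
  have hq := hD.hq
  set q := D.q with hqdef
  have hq1 : (1:ℝ) ≤ q := by exact_mod_cast hq
  have hPsi : ∀ x, Rot ω (Psi (fun _ => 0) q q x) = Ch ω q x := fun x => by simp [Psi, Ch]
  refine ⟨min (1 / 8) (r' / 4), by positivity, c0 / 2, by positivity, r' ^ q / 2, by positivity, fun χ hχ hχ1 hχz B hB => ?_⟩
  obtain ⟨hX, hXz, M, hM0, hM⟩ := dirX hχ hω (by positivity) (min_le_left _ _) hχz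
  have hXz' : ∀ z : ℝ, r' ≤ |z| → χ (dirn (Rot ω (1, z))) = 0 := fun z hz => hXz z (by linarith [min_le_right (1 / 8) (r' / 4)])
  obtain ⟨C, hC, hCe⟩ := hest (q * (q + 2) * B * (1 + M)) (by positivity)
  refine ⟨C * 2, by positivity, fun lam v a hlam hv hd ha => ?_⟩
  have hadm := amp_adm hω hq hr' hB ha hX (fun z => hχ1 _) hM0 hM hXz'
  have hE := hCe lam _ _ _ hlam (hVc v hv hd) hadm
  set G : RR → ℂ := fun p => ((χ (dirn p) * a p * stdFun n f γ E p : ℝ) : ℂ) * Complex.exp (Complex.I * ((lam * dot2 p v : ℝ) : ℂ)) with hG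
  have hbox : ∀ x ∈ Ioc 0 r' ×ˢ (univ : Set ℝ), 0 < x.1 ∧ DifferentiableAt ℝ (fun _ : ℝ => (0:ℝ)) (x.1 ^ q) := fun x hx => ⟨hx.1.1, by fun_prop⟩
  have eI : ∫ p, G p = ∫ x in Ioi (0:ℝ) ×ˢ (univ : Set ℝ), (((q * a (Ch ω q x) * χ (dirn (Rot ω (1, x.2)))) * D.wt x : ℝ) : ℂ) *
      Complex.exp (Complex.I * ((lam * D.ph (dot2 v ω) (dot2 v (perp2 ω)) x : ℝ) : ℂ)) := by
    rw [← (rot_mp hω).integral_comp (rot_me hω) G,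
      ← setIntegral_eq_integral_of_forall_compl_eq_zero (s := Ioc 0 (r' ^ q) ×ˢ (univ : Set ℝ)) ?_,
      ← psi_image (h := fun _ => 0) (p := q) hq hr',
      (psi_cov hq (measurableSet_Ioc.prod MeasurableSet.univ) hbox).1,
      setIntegral_eq_of_subset_of_forall_sdiff_eq_zero (s := Ioc 0 r' ×ˢ (univ : Set ℝ)) (t := Ioi (0:ℝ) ×ˢ (univ : Set ℝ)) (measurableSet_Ioi.prod MeasurableSet.univ) (prod_mono (fun x hx => hx.1) subset_rfl) ?_]
    · refine setIntegral_congr_fun (measurableSet_Ioc.prod MeasurableSet.univ) fun x hx => ?_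
      obtain ⟨⟨h1, h2⟩, -⟩ := hx
      simp only [hG, hPsi]
      have hdr : dirn (Ch ω q x) = dirn (Rot ω (1, x.2)) := by rw [ch_smul, dirn_smul (by positivity)]
      have hph : dot2 (Ch ω q x) v = D.ph (dot2 v ω) (dot2 v (perp2 ω)) x := by rw [Ch, dot_rot, EData.ph, hPq, hF0]
      rw [hph, hdr]
      by_cases hc : r' ≤ x.1 ∨ r' ≤ |x.2|
      · have hz := hadm.supp x h1 hc
        simp only [mul_eq_zero, Nat.cast_eq_zero, show q ≠ 0 by omega, false_or] at hz
        rcases hz with hz | hz <;> simp [hz]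
      · push Not at hc
        have hw := hwt x.1 x.2 h1 (by linarith) (by linarith)
        change D.wt x = _ * stdFun n f γ E (Ch ω q x) at hw
        rw [hw, Complex.real_smul]
        push_cast; ring
    · rintro x ⟨⟨h1, h2⟩, h3⟩
      have h4 : r' ≤ x.1 := by
        by_contra h; exact h3 ⟨⟨h1, (not_le.1 h).le⟩, mem_univ _⟩
      have hz := hadm.supp x h1 (Or.inl h4)
      simp only [hz]; simp
    · intro y hy
      simp only [hG]
      by_cases h1 : 0 < y.1
      · have h2 : r' ^ q < y.1 := by
          by_contra h; exact hy ⟨⟨h1, not_lt.1 h⟩, mem_univ _⟩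
        rw [ha.supp (Rot ω y) (by linarith [ch_ge hω y])]; simp
      · have h2 : χ (dirn (Rot ω y)) = 0 := by
          refine hχz _ ?_
          by_contra hcon
          have h3 := (near_dir hω (min_le_left _ _) (not_le.1 hcon)).1
          have h4 : dot2 (dirn (Rot ω y)) ω = (nrm2 (Rot ω y))⁻¹ * dot2 (Rot ω y) ω := by simp [dirn, dot2]; ring
          rw [h4, dot_rot1 hω] at h3
          have h5 : 0 ≤ (nrm2 (Rot ω y))⁻¹ := inv_nonneg.2 (Real.sqrt_nonneg _)
          nlinarith [not_lt.1 h1]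
        rw [h2]; simp
  rw [eI]
  refine hE.trans ?_
  rw [ENNReal.ofReal_mul hC, mul_assoc]
  refine mul_le_mul_right ?_ _
  rw [← (rot_mp hω).setLIntegral_comp_preimage_emb (rot_me hω) _ (disk2 R)]
  set A := Ioo (0:ℝ) r0 ×ˢ Ioo (-r0) r0
  have hAm : MeasurableSet A := measurableSet_Ioo.prod measurableSet_Ioo
  have hsub : Psi (fun _ => 0) q q '' A ⊆ Rot ω ⁻¹' disk2 R := by
    rintro _ ⟨x, ⟨⟨h1, h2⟩, h3⟩, rfl⟩
    have h4 : nrm2 (Rot ω (Psi (fun _ => 0) q q x)) = nrm2 (Psi (fun _ => 0) q q x) := nrm_rot hω _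
    simp only [nrm2] at h4
    rw [Real.sqrt_inj (by positivity) (by positivity)] at h4
    change (Rot ω (Psi (fun _ => 0) q q x)).1 ^ 2 + (Rot ω (Psi (fun _ => 0) q q x)).2 ^ 2 < R ^ 2
    rw [h4]
    simp only [Psi, zero_add]
    have h5 : x.1 ^ q ≤ x.1 := pow_le_of_le_one h1.le (by linarith) (by omega)
    have h6 : 0 < x.1 ^ q := by positivity
    have h7 : x.2 ^ 2 ≤ 1 := by rw [sq_le_one_iff_abs_le_one]; exact (abs_lt.2 h3).le.trans (by linarith)
    have h8 : (x.1 ^ q) ^ 2 < (R / 2) ^ 2 := by gcongr; linarith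
    nlinarith
  refine le_trans ?_ (mul_le_mul_right (lintegral_mono_set hsub) _)
  rw [(psi_cov hq hAm (fun x hx => ⟨hx.1.1, by fun_prop⟩)).2, ← lintegral_const_mul' _ _ ENNReal.ofReal_ne_top]
  refine setLIntegral_mono' hAm fun x hx => ?_
  obtain ⟨⟨h1, h2⟩, h3⟩ := hx
  have h3 : |x.2| < r0 := abs_lt.2 h3
  have hw := hwt x.1 x.2 h1 (by linarith) (by linarith)
  change D.wt x = _ * stdFun n f γ E (Ch ω q x) at hw
  have hg := std_nonneg f γ E (Ch ω q x)
  have ht : 0 < x.1 ^ q := by positivity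
  have ht' : 0 < x.1 ^ (q - 1) := by positivity
  rw [hPsi, ← ENNReal.ofReal_mul (by positivity), ← ENNReal.ofReal_mul (by norm_num), hw]
  refine ENNReal.ofReal_le_ofReal ?_
  have hgn : gain (lam * D.H T x) ≤ 2 * gain (lam * |dot2 (Ch ω q x) vs|) := by
    have h4 := hdot (x.1 ^ q) x.2 ht.le (by linarith)
    have h5 : D.H T x = if T then |x.1 ^ q * x.2| else x.1 ^ q := by rw [EData.H, hPq, hF0]
    rw [h5]
    have h6 : 0 ≤ if T then |x.1 ^ q * x.2| else x.1 ^ q := by split_ifs <;> positivity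
    refine gain_scale' (by norm_num) (by positivity) (by positivity) ?_
    have := mul_le_mul_of_nonneg_left h4 hlam.le
    change lam * |dot2 (Rot ω (x.1 ^ q, x.1 ^ q * x.2)) vs| ≤ _
    linarith
  have hgn0 := gain_nonneg (lam * |dot2 (Ch ω q x) vs|)
  calc x.1 ^ (q - 1) * x.1 ^ q * stdFun n f γ E (Ch ω q x) * gain (lam * D.H T x)
      ≤ x.1 ^ (q - 1) * x.1 ^ q * stdFun n f γ E (Ch ω q x) * (2 * gain (lam * |dot2 (Ch ω q x) vs|)) := by gcongr
    _ = 2 * (1 * x.1 ^ (q - 1) * x.1 ^ q * (stdFun n f γ E (Ch ω q x) * gain (lam * |dot2 (Ch ω q x) vs|))) := by ring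
    _ ≤ _ := by gcongr

lemma disk_strip {v : RR} (hv : nrm2 v = 1) {r c : ℝ} (hr : 0 < r) (hrc : r ≤ c) : disk2 r ⊆ strip2 v r c := by
  intro p hp
  have hp : p.1 ^ 2 + p.2 ^ 2 < r ^ 2 := hp
  have h : dot2 p v ^ 2 + dot2 p (perp2 v) ^ 2 = p.1 ^ 2 + p.2 ^ 2 := by
    have := unit_sq hv
    simp only [dot2, perp2]; linear_combination (p.1 ^ 2 + p.2 ^ 2) * this
  have h1 : |dot2 p v| < r := abs_lt_of_sq_lt_sq (by nlinarith [sq_nonneg (dot2 p (perp2 v))]) hr.le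
  have h2 : |dot2 p (perp2 v)| < r := abs_lt_of_sq_lt_sq (by nlinarith [sq_nonneg (dot2 p v)]) hr.le
  exact ⟨h1, h2.trans_le hrc⟩

lemma strip_sub {v : RR} (hv : nrm2 v = 1) {U : Set (RR)} (hU : U ∈ 𝓝 (0:RR)) :
    ∃ c0 > (0:ℝ), ∀ c r, c < c0 → r ≤ c → strip2 v r c ⊆ U := by
  obtain ⟨η, hη, hb⟩ := Metric.mem_nhds_iff.1 hU
  refine ⟨η / 2, by positivity, fun c r hc hr p hp => hb ?_⟩
  obtain ⟨h1, h2⟩ := hp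
  obtain ⟨a1, a2⟩ := unit_abs hv
  have h := unit_sq hv
  have key : ∀ x y : ℝ, |x| ≤ 1 → |y| ≤ 1 → |x * dot2 p v + y * dot2 p (perp2 v)| < η := by
    intro x y hx hy
    refine (abs_add_le _ _).trans_lt ?_
    rw [abs_mul, abs_mul]
    have := mul_le_mul_of_nonneg_right hx (abs_nonneg (dot2 p v))
    have := mul_le_mul_of_nonneg_right hy (abs_nonneg (dot2 p (perp2 v)))
    linarith
  rw [mem_ball_zero_iff, Prod.norm_def, max_lt_iff, norm_eq_abs, norm_eq_abs]
  have e1 : p.1 = v.1 * dot2 p v + v.2 * dot2 p (perp2 v) := by simp only [dot2, perp2]; linear_combination (-p.1) * h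
  have e2 : p.2 = v.2 * dot2 p v + (-v.1) * dot2 p (perp2 v) := by simp only [dot2, perp2]; linear_combination (-p.2) * h
  exact ⟨by rw [e1]; exact key _ _ a1 a2, by rw [e2]; exact key _ _ a2 (by rwa [abs_neg])⟩

lemma delta_lt {g : RR → ℝ} (hg0 : ∀ p, 0 ≤ g p) {U : Set (RR)} (hU : U ∈ 𝓝 (0:RR)) (hg : IntegrableOn g U) {ε : ℝ} {d : ℕ}
    (hball : BallBound g ε d) {v : RR} (hv : nrm2 v = 1) {δ : ℝ} {e : ℕ} (hs : StripBound g v δ e) : δ ≤ ε := by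
  by_contra hcon
  push Not at hcon
  obtain ⟨-, -, c₁, hc₁, c₂, -, c₃, hc₃, hb⟩ := hball
  obtain ⟨-, he, cv, hcv, hs⟩ := hs
  obtain ⟨c0, hc0, hsub⟩ := strip_sub hv hU
  have hcp : 0 < min cv c0 / 2 := by positivity
  obtain ⟨a, -, b, hb0, hs⟩ := hs (min cv c0 / 2) hcp (by linarith [min_le_left cv c0])
  have hkey : ∀ᶠ r in 𝓝[>] (0:ℝ), c₁ ≤ b * (r ^ (δ - ε) * |log r|) := by
    filter_upwards [self_mem_nhdsWithin, mem_nhdsWithin_of_mem_nhds (Iio_mem_nhds hcp), mem_nhdsWithin_of_mem_nhds (Iio_mem_nhds hc₃),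
      mem_nhdsWithin_of_mem_nhds (Iio_mem_nhds (exp_pos (-1)))] with r h1 h2 h3 h4
    have h1 : 0 < r := h1
    have hl : 1 ≤ |log r| := by
      have : log r < -1 := by rw [log_lt_iff_lt_exp h1]; exact h4
      rw [abs_of_neg (by linarith)]; linarith
    have hmono : ∫ p in disk2 r, g p ≤ ∫ p in strip2 v r (min cv c0 / 2), g p :=
      setIntegral_mono_set (hg.mono_set (hsub _ _ (by linarith [min_le_right cv c0]) (le_of_lt h2))) (Eventually.of_forall hg0)
        (disk_strip hv h1 (le_of_lt h2)).eventuallyLE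
    have h5 := ((hb r h1 h3).1.trans hmono).trans (hs r h1 h2).2
    have h6 : c₁ * r ^ ε ≤ c₁ * r ^ ε * |log r| ^ d := le_mul_of_one_le_right (by positivity) (one_le_pow₀ hl)
    have h7 : b * r ^ δ * |log r| ^ e ≤ b * r ^ δ * |log r| := by
      gcongr; exact (pow_le_pow_right₀ hl he).trans_eq (pow_one _)
    have h8 : r ^ δ = r ^ (δ - ε) * r ^ ε := by rw [← rpow_add h1]; ring_nf
    rw [h8] at h7 h5
    have h9 : 0 < r ^ ε := by positivity
    refine le_of_mul_le_mul_right ?_ h9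
    linarith
  have hlim : Tendsto (fun r : ℝ => b * (r ^ (δ - ε) * |log r|)) (𝓝[>] 0) (𝓝 0) := by
    have h1 := (tendsto_log_mul_rpow_nhdsGT_zero (sub_pos.2 hcon)).abs.const_mul b
    rw [abs_zero, mul_zero] at h1
    refine h1.congr' ?_
    filter_upwards [self_mem_nhdsWithin] with r hr
    have hr : 0 < r := hr
    rw [abs_mul, abs_of_pos (rpow_pos_of_pos hr _), mul_comm |log r|]
  exact absurd (ge_of_tendsto hlim hkey) (not_le.2 hc₁)

lemma gain_tsum {mu : ℝ} (h : 0 ≤ mu) : ENNReal.ofReal (gain mu) ≤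
    ∑' k : ℕ, if mu < 2 ^ k then ENNReal.ofReal (2 * (√2)⁻¹ ^ k) else 0 := by
  have hs : (1:ℝ) ≤ √2 := by rw [Real.one_le_sqrt]; norm_num
  have hs2 : √2 ≤ 2 := by rw [Real.sqrt_le_left] <;> norm_num
  by_cases h1 : mu < 1
  · refine le_trans ?_ (ENNReal.le_tsum 0)
    rw [if_pos (by simpa using h1)]
    refine ENNReal.ofReal_le_ofReal ((gain_le_one h).trans (by norm_num))
  · obtain ⟨k, hk1, hk2⟩ := exists_nat_pow_near (not_lt.1 h1) (by norm_num : (1:ℝ) < 2)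
    refine le_trans ?_ (ENNReal.le_tsum (k + 1))
    rw [if_pos hk2]
    refine ENNReal.ofReal_le_ofReal ?_
    have e : (√2) ^ k = √(2 ^ k) := by rw [Real.sqrt_eq_rpow, Real.sqrt_eq_rpow, ← rpow_natCast, ← rpow_natCast, ← rpow_mul (by norm_num), ← rpow_mul (by norm_num), mul_comm]
    have h2 : (√2) ^ k ≤ √(1 + mu) := by rw [e]; exact Real.sqrt_le_sqrt (by linarith)
    calc gain mu ≤ ((√2) ^ k)⁻¹ := inv_anti₀ (by positivity) h2
      _ = √2 * (√2)⁻¹ ^ (k + 1) := by rw [inv_pow, pow_succ]; field_simp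
      _ ≤ _ := by gcongr

set_option maxHeartbeats 1600000 in
lemma strip_gain {g : RR → ℝ} (hg0 : ∀ p, 0 ≤ g p) {U : Set (RR)} (hU : U ∈ 𝓝 (0:RR)) (hg : IntegrableOn g U) {v : RR} (hv : nrm2 v = 1)
    {δ : ℝ} {e : ℕ} (hs : StripBound g v δ e) (hδ : δ < 1 / 2) : ∃ R > (0:ℝ), ∃ K : ℝ, 0 ≤ K ∧ ∀ lam : ℝ, 2 ≤ lam →
      ∫⁻ p in disk2 R, ENNReal.ofReal (g p * gain (lam * |dot2 p v|)) ≤ ENNReal.ofReal (K * lam ^ (-δ) * log lam ^ e) := by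
  obtain ⟨hδ0, he, cv, hcv, hs⟩ := hs
  obtain ⟨c0, hc0, hsub⟩ := strip_sub hv hU
  obtain ⟨c, hc, hc1, hc2, hc3⟩ : ∃ c > 0, c < cv ∧ c < c0 ∧ c < 1 := by
    have hp : 0 < min cv (min c0 1) := by positivity
    refine ⟨min cv (min c0 1) / 2, by positivity, ?_, ?_, ?_⟩
    · linarith [min_le_left cv (min c0 1)]
    · linarith [min_le_right cv (min c0 1), min_le_left c0 1]
    · linarith [min_le_right cv (min c0 1), min_le_right c0 1]
  obtain ⟨a, -, b, hb0, hs⟩ := hs c hc hc1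
  have hint : ∀ r, r ≤ c → IntegrableOn g (strip2 v r c) := fun r hr => hg.mono_set (hsub c r hc2 hr)
  set J := ∫ p in strip2 v c c, g p with hJ
  have hJ0 : 0 ≤ J := integral_nonneg hg0
  set K0 := b + 2 * J * c ^ (-δ) with hK0
  have hK00 : 0 ≤ K0 := by positivity
  have hdm : MeasurableSet (disk2 c) := (isOpen_lt (by fun_prop) (by fun_prop)).measurableSet
  have hgm : AEMeasurable g (volume.restrict (disk2 c)) := ((hint c le_rfl).mono_set (disk_strip hv hc le_rfl)).aestronglyMeasurable.aemeasurable
  have hm : ∀ lam r : ℝ, 2 ≤ lam → 0 < r → lam⁻¹ ≤ r → ∫⁻ p in disk2 c ∩ {p | |dot2 p v| < r}, ENNReal.ofReal (g p) ≤ ENNReal.ofReal (K0 * r ^ δ * log lam ^ e) := by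
    intro lam r hl hr hlr
    have hlog : 1 / 2 ≤ log lam := by
      have := log_le_log (by norm_num) hl
      linarith [log_two_gt_d9]
    by_cases hrc : r < c
    · have hss : disk2 c ∩ {p | |dot2 p v| < r} ⊆ strip2 v r c := fun p hp => ⟨hp.2, (disk_strip hv hc le_rfl hp.1).2⟩
      refine (lintegral_mono_set hss).trans ?_
      rw [← ofReal_integral_eq_lintegral_ofReal (hint r hrc.le) (Eventually.of_forall hg0)]
      refine ENNReal.ofReal_le_ofReal ((hs r hr hrc).2.trans ?_)
      have h1 : |log r| ≤ log lam := by
        rw [abs_of_neg (log_neg hr (by linarith)), ← log_inv]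
        exact log_le_log (by positivity) (by rw [inv_le_comm₀ hr (by linarith)]; exact hlr)
      have h2 : b ≤ K0 := by
        have : 0 ≤ 2 * J * c ^ (-δ) := by positivity
        linarith
      gcongr
    · refine (lintegral_mono_set (inter_subset_left.trans (disk_strip hv hc le_rfl))).trans ?_
      rw [← ofReal_integral_eq_lintegral_ofReal (hint c le_rfl) (Eventually.of_forall hg0)]
      refine ENNReal.ofReal_le_ofReal ?_
      have h1 : 1 / 2 ≤ log lam ^ e := by
        interval_cases e
        · norm_num
        · simpa using hlog
      have h2 : 1 ≤ c ^ (-δ) * r ^ δ := by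
        rw [rpow_neg hc.le, inv_mul_eq_div, one_le_div (by positivity)]
        exact rpow_le_rpow hc.le (not_lt.1 hrc) hδ0.le
      calc J = 2 * J * 1 * (1 / 2) := by ring
        _ ≤ 2 * J * (c ^ (-δ) * r ^ δ) * log lam ^ e := by gcongr
        _ = (2 * J * c ^ (-δ)) * r ^ δ * log lam ^ e := by ring
        _ ≤ _ := by gcongr; linarith
  have hs1 : (0:ℝ) < √2 := by positivity
  set x := (2:ℝ) ^ δ * (√2)⁻¹ with hx
  have hx0 : 0 ≤ x := by positivity
  have hx1 : x < 1 := by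
    rw [hx, ← div_eq_mul_inv, div_lt_one hs1, Real.sqrt_eq_rpow]
    exact rpow_lt_rpow_of_exponent_lt (by norm_num) hδ
  refine ⟨c, hc, 2 * K0 * (1 - x)⁻¹, mul_nonneg (by positivity) (inv_nonneg.2 (by linarith)), fun lam hl => ?_⟩
  have hlam : 0 < lam := by linarith
  have hlog : 0 ≤ log lam := log_nonneg (by linarith)
  have hpt : ∀ p, ENNReal.ofReal (g p * gain (lam * |dot2 p v|)) ≤
      ∑' k : ℕ, ENNReal.ofReal (2 * (√2)⁻¹ ^ k) * {p | |dot2 p v| < 2 ^ k / lam}.indicator (fun p => ENNReal.ofReal (g p)) p := by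
    intro p
    rw [ENNReal.ofReal_mul (hg0 p)]
    refine (mul_le_mul_right (gain_tsum (by positivity)) _).trans ?_
    rw [← ENNReal.tsum_mul_left]
    refine ENNReal.tsum_le_tsum fun k => ?_
    by_cases h : lam * |dot2 p v| < 2 ^ k
    · rw [if_pos h, indicator_of_mem (show p ∈ {p : RR | |dot2 p v| < 2 ^ k / lam} from show |dot2 p v| < 2 ^ k / lam by rw [lt_div_iff₀ hlam]; linarith), mul_comm]
    · rw [if_neg h, mul_zero]; exact zero_le
  have hms : ∀ k : ℕ, MeasurableSet {p : RR | |dot2 p v| < 2 ^ k / lam} := fun k =>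
    (isOpen_lt (by unfold dot2; fun_prop) continuous_const).measurableSet
  calc ∫⁻ p in disk2 c, ENNReal.ofReal (g p * gain (lam * |dot2 p v|))
      ≤ ∫⁻ p in disk2 c, ∑' k : ℕ, ENNReal.ofReal (2 * (√2)⁻¹ ^ k) * {p | |dot2 p v| < 2 ^ k / lam}.indicator (fun p => ENNReal.ofReal (g p)) p := lintegral_mono hpt
    _ = ∑' k : ℕ, ENNReal.ofReal (2 * (√2)⁻¹ ^ k) * ∫⁻ p in disk2 c ∩ {p | |dot2 p v| < 2 ^ k / lam}, ENNReal.ofReal (g p) := by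
      rw [lintegral_tsum fun k => (hgm.ennreal_ofReal.indicator (hms k)).const_mul _]
      refine tsum_congr fun k => ?_
      rw [lintegral_const_mul' _ _ ENNReal.ofReal_ne_top, lintegral_indicator (hms k), Measure.restrict_restrict (hms k), inter_comm]
    _ ≤ ∑' k : ℕ, ENNReal.ofReal (2 * K0 * lam ^ (-δ) * log lam ^ e * x ^ k) := by
      refine ENNReal.tsum_le_tsum fun k => ?_
      have h2 : (1:ℝ) ≤ 2 ^ k := one_le_pow₀ (by norm_num)
      refine (mul_le_mul_right (hm lam (2 ^ k / lam) hl (by positivity) (by rw [inv_eq_one_div]; gcongr)) _).trans (le_of_eq ?_)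
      rw [← ENNReal.ofReal_mul (by positivity)]
      congr 1
      rw [Real.div_rpow (by positivity) hlam.le, hx, mul_pow, ← rpow_natCast ((2:ℝ) ^ δ) k, ← rpow_natCast 2 k, ← rpow_mul (by norm_num), ← rpow_mul (by norm_num),
        rpow_neg hlam.le, mul_comm (k:ℝ) δ]
      ring
    _ = ENNReal.ofReal (2 * K0 * (1 - x)⁻¹ * lam ^ (-δ) * log lam ^ e) := by
      rw [← ENNReal.ofReal_tsum_of_nonneg (fun k => by positivity) ((summable_geometric_of_lt_one hx0 hx1).mul_left _), tsum_mul_left, tsum_geometric_of_lt_one hx0 hx1]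
      congr 1; ring

lemma final_cmp {δv δm : ℝ} {ev em : ℕ} (h0 : 0 < δm) (h1 : δm ≤ δv) (he : ev ≤ 1) (h2 : δv = δm → ev ≤ em) :
    ∃ K : ℝ, 0 ≤ K ∧ ∀ lam : ℝ, 2 ≤ lam → lam ^ (-δv) * log lam ^ ev ≤ K * ((2 + lam) ^ (-δm) * log (2 + lam) ^ em) := by
  have hA : ∀ lam : ℝ, 2 ≤ lam → lam ^ (-δm) ≤ 2 ^ δm * (2 + lam) ^ (-δm) ∧ 1 ≤ log (2 + lam) ∧ 0 ≤ log lam ∧ log lam ≤ log (2 + lam) := by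
    intro lam hl
    have hl0 : 0 < lam := by linarith
    refine ⟨?_, ?_, log_nonneg (by linarith), log_le_log hl0 (by linarith)⟩
    · rw [rpow_neg hl0.le, rpow_neg (by linarith), ← div_eq_mul_inv, inv_eq_one_div, div_le_div_iff₀ (by positivity) (by positivity), one_mul,
        ← mul_rpow (by norm_num) hl0.le]
      exact rpow_le_rpow (by linarith) (by linarith) h0.le
    · have := log_le_log (by norm_num) (show (4:ℝ) ≤ 2 + lam by linarith)
      have h4 : log 4 = 2 * log 2 := by rw [show (4:ℝ) = 2 ^ 2 by norm_num, log_pow]; norm_num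
      linarith [log_two_gt_d9]
  rcases h1.eq_or_lt with h | h
  · subst h
    refine ⟨2 ^ δm, by positivity, fun lam hl => ?_⟩
    obtain ⟨a, b, c, d⟩ := hA lam hl
    have : log lam ^ ev ≤ log (2 + lam) ^ em := (pow_le_pow_left₀ c d ev).trans (pow_le_pow_right₀ b (h2 rfl))
    rw [← mul_assoc]
    gcongr
  · have hη : 0 < δv - δm := by linarith
    refine ⟨2 ^ δm * (1 + 1 / (δv - δm)), by positivity, fun lam hl => ?_⟩
    obtain ⟨a, b, c, d⟩ := hA lam hl
    have hl0 : 0 < lam := by linarith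
    have h3 : log lam ^ ev ≤ (1 + 1 / (δv - δm)) * lam ^ (δv - δm) := by
      have h4 : 1 ≤ lam ^ (δv - δm) := Real.one_le_rpow (by linarith) hη.le
      have h5 := log_le_rpow_div hl0.le hη
      have h6 : 0 ≤ 1 / (δv - δm) * lam ^ (δv - δm) := by positivity
      interval_cases ev
      · rw [pow_zero]; linarith
      · rw [pow_one]
        have : lam ^ (δv - δm) / (δv - δm) = 1 / (δv - δm) * lam ^ (δv - δm) := by ring
        linarith
    have h7 : 1 ≤ log (2 + lam) ^ em := one_le_pow₀ b
    calc lam ^ (-δv) * log lam ^ ev ≤ lam ^ (-δv) * ((1 + 1 / (δv - δm)) * lam ^ (δv - δm)) := by gcongr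
      _ = (1 + 1 / (δv - δm)) * lam ^ (-δm) := by
        rw [show -δm = -δv + (δv - δm) by ring, rpow_add hl0]; ring
      _ ≤ (1 + 1 / (δv - δm)) * (2 ^ δm * (2 + lam) ^ (-δm) * 1) := by rw [mul_one]; gcongr
      _ ≤ (1 + 1 / (δv - δm)) * (2 ^ δm * (2 + lam) ^ (-δm) * log (2 + lam) ^ em) := by gcongr
      _ = _ := by ring

lemma norm_le_nrm2 (p : RR) : ‖p‖ ≤ nrm2 p := by
  rw [Prod.norm_def, max_le_iff, norm_eq_abs, norm_eq_abs]
  exact ⟨Real.abs_le_sqrt (by nlinarith [sq_nonneg p.2]), Real.abs_le_sqrt (by nlinarith [sq_nonneg p.1])⟩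

lemma nrm2_cont : Continuous nrm2 := by unfold nrm2; fun_prop

lemma circ_compact : IsCompact {p : RR | nrm2 p = 1} := by
  refine Metric.isCompact_of_isClosed_isBounded (isClosed_eq nrm2_cont continuous_const) ?_
  refine (isBounded_closedBall (x := (0:RR)) (r := 1)).subset fun p hp => ?_
  rw [mem_closedBall_zero_iff]
  exact (norm_le_nrm2 p).trans_eq hp

lemma dirn_meas : Measurable dirn := by unfold dirn; exact (nrm2_cont.measurable.inv).smul measurable_id

lemma nrm_smul {c : ℝ} (hc : 0 ≤ c) (p : RR) : nrm2 (c • p) = c * nrm2 p := by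
  unfold nrm2
  rw [← Real.sqrt_sq hc, ← Real.sqrt_mul (sq_nonneg c), Real.sqrt_sq hc]
  congr 1; simp; ring

lemma dirn_unit {p : RR} (hp : p ≠ 0) : nrm2 (dirn p) = 1 := by
  have h : 0 < nrm2 p := (norm_pos_iff.2 hp).trans_le (norm_le_nrm2 p)
  rw [dirn, nrm_smul (by positivity)]; field_simp

lemma min_exists {τ : Type} (t : Finset τ) (k : τ → ℝ) (h : ∀ j ∈ t, 0 < k j) : ∃ c > (0:ℝ), ∀ j ∈ t, c ≤ k j := by
  have : ∀ᶠ c in 𝓝[>] (0:ℝ), ∀ j ∈ t, c < k j := (Finset.eventually_all t).2 fun j hj => mem_nhdsWithin_of_mem_nhds (Iio_mem_nhds (h j hj))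
  obtain ⟨c, h1, h2⟩ := (this.and self_mem_nhdsWithin).exists
  exact ⟨c, h2, fun j hj => (h1 j hj).le⟩

lemma Amp.mono {B s s' : ℝ} {a : RR → ℝ} (h : Amp B s a) (hs : s ≤ s') : Amp B s' a :=
  ⟨h.cd, h.b0, h.b1, fun p hp => h.supp p (hs.trans hp)⟩

set_option maxHeartbeats 800000 in
lemma dir_est {n : ℕ} {f : Fin n → RR → ℝ} {γ : Fin n → ℝ} {E : Set (RR)} (hsf : StandardForm n f γ E) {vs : RR} (hvs : nrm2 vs = 1)
    {δv δm : ℝ} {ev em : ℕ} (hs : StripBound (stdFun n f γ E) vs δv ev) (hδ : δv < 1 / 2) (h0 : 0 < δm) (h1 : δm ≤ δv) (h2 : δv = δm → ev ≤ em) :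
    ∃ ν > (0:ℝ), ∃ s > (0:ℝ), ∀ B, 0 ≤ B → ∃ C : ℝ, 0 ≤ C ∧
    ∀ (lam : ℝ) (v : RR) (a : RR → ℝ), 2 ≤ lam → nrm2 v = 1 → dist v vs < ν → Amp B s a →
      ‖∫ p, ((a p * stdFun n f γ E p : ℝ) : ℂ) * Complex.exp (Complex.I * ((lam * dot2 p v : ℝ) : ℂ))‖ ≤
        C * ((2 + lam) ^ (-δm) * log (2 + lam) ^ em) := by
  obtain ⟨V, hV, hgV⟩ := hsf.integ
  obtain ⟨R, hR, K, hK, hKl⟩ := strip_gain (std_nonneg f γ E) hV hgV hvs hs hδ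
  obtain ⟨K', hK', hcmp⟩ := final_cmp h0 h1 hs.2.1 h2
  choose! r hr ν hν s hs' hest using fun (ω : RR) (hω : nrm2 ω = 1) => sector_est hsf hω hvs hR
  obtain ⟨t, χ, htK, hχ, -, hsum⟩ := pou circ_compact (r := r) (fun ω hω => hr ω hω)
  obtain ⟨ν0, hν0, hν1⟩ := min_exists t ν fun j hj => hν j (htK j hj)
  obtain ⟨s0, hs0, hs1⟩ := min_exists t s fun j hj => hs' j (htK j hj)
  refine ⟨ν0, hν0, s0, hs0, fun B hB => ?_⟩
  have hC : ∀ j, ∃ C : ℝ, j ∈ t → 0 ≤ C ∧ ∀ (lam : ℝ) (v : RR) (a : RR → ℝ), 0 < lam → nrm2 v = 1 → dist v vs < ν j → Amp B (s j) a →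
      ‖∫ p, ((χ j (dirn p) * a p * stdFun n f γ E p : ℝ) : ℂ) * Complex.exp (Complex.I * ((lam * dot2 p v : ℝ) : ℂ))‖ₑ ≤
        ENNReal.ofReal C * ∫⁻ p in disk2 R, ENNReal.ofReal (stdFun n f γ E p * gain (lam * |dot2 p vs|)) := by
    intro j
    by_cases hj : j ∈ t
    · obtain ⟨c1, c2, -, c3⟩ := hχ j hj
      obtain ⟨C, hC⟩ := hest j (htK j hj) (χ j) c1 c2 c3 B hB
      exact ⟨C, fun _ => hC⟩
    · exact ⟨0, fun h => absurd h hj⟩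
  choose C hC using hC
  have hC0 : 0 ≤ ∑ j ∈ t, C j := Finset.sum_nonneg fun j hj => (hC j hj).1
  refine ⟨(∑ j ∈ t, C j) * K * K', by positivity, fun lam v a hl hv hd ha => ?_⟩
  have hl0 : 0 < lam := by linarith
  have hlog : 0 ≤ log lam := log_nonneg (by linarith)
  have hlog' : 0 ≤ log (2 + lam) := log_nonneg (by linarith)
  set F : RR → ℂ := fun p => ((a p * stdFun n f γ E p : ℝ) : ℂ) * Complex.exp (Complex.I * ((lam * dot2 p v : ℝ) : ℂ)) with hF
  by_cases hint : Integrable F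
  swap
  · rw [integral_undef hint, norm_zero]; positivity
  have hij : ∀ j ∈ t, Integrable fun p => (χ j (dirn p) : ℂ) * F p := by
    intro j hj
    refine hint.bdd_mul (c := 1) ?_ (Eventually.of_forall fun p => ?_)
    · exact (Complex.measurable_ofReal.comp ((hχ j hj).1.continuous.measurable.comp dirn_meas)).aestronglyMeasurable
    · rw [Complex.norm_real]; exact (hχ j hj).2.1 _
  have e : ∫ p, F p = ∑ j ∈ t, ∫ p, (χ j (dirn p) : ℂ) * F p := by
    rw [← integral_finsetSum _ hij]
    refine integral_congr_ae ?_
    have : ∀ᵐ p : RR, p ≠ 0 := by simp [ae_iff]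
    filter_upwards [this] with p hp
    have h3 := hsum (dirn p) (dirn_unit hp)
    rw [← Finset.sum_mul, ← Complex.ofReal_sum, h3]; simp
  have hj : ∀ j ∈ t, ‖∫ p, (χ j (dirn p) : ℂ) * F p‖ ≤ C j * (K * lam ^ (-δv) * log lam ^ ev) := by
    intro j hj
    have h4 := (hC j hj).2 lam v a hl0 hv (hd.trans_le (hν1 j hj)) (ha.mono (hs1 j hj))
    have h5 := h4.trans (mul_le_mul_right (hKl lam hl) _)
    rw [← ENNReal.ofReal_mul (hC j hj).1, ← ofReal_norm] at h5
    have hnn : 0 ≤ C j * (K * lam ^ (-δv) * log lam ^ ev) := mul_nonneg (hC j hj).1 (by positivity)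
    have h6 := (ENNReal.ofReal_le_ofReal_iff hnn).1 h5
    refine le_of_eq_of_le ?_ h6
    congr 2
    funext p
    simp only [hF]; push_cast; ring
  rw [e]
  refine (norm_sum_le _ _).trans ((Finset.sum_le_sum hj).trans ?_)
  rw [← Finset.sum_mul]
  have := hcmp lam hl
  calc (∑ j ∈ t, C j) * (K * lam ^ (-δv) * log lam ^ ev) = (∑ j ∈ t, C j) * K * (lam ^ (-δv) * log lam ^ ev) := by ring
    _ ≤ (∑ j ∈ t, C j) * K * (K' * ((2 + lam) ^ (-δm) * log (2 + lam) ^ em)) := by gcongr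
    _ = _ := by ring

lemma amp_of_bump {α : RR → ℝ} {A : ℝ} (hA : 0 < A) (hα : AlphaBound α A) {φ : RR → ℝ} {x₀ y₀ r : ℝ} (hr : 0 < r) (hφ : IsBump φ x₀ y₀ r) :
    (∀ p, r ≤ ‖p‖ → φ ((x₀, y₀) + p) = 0) ∧ ∃ B, 0 ≤ B ∧ Amp B r (fun p => φ ((x₀, y₀) + p) * α p) := by
  obtain ⟨h1, h2, -, h4⟩ := hφ
  obtain ⟨a1, a2, a3⟩ := hα
  have hz : ∀ p, r ≤ ‖p‖ → φ ((x₀, y₀) + p) = 0 := by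
    intro p hp
    by_contra hne
    have h5 : (x₀, y₀) + p ∈ {p : RR | (p.1 - x₀) ^ 2 + (p.2 - y₀) ^ 2 < r ^ 2} := h4 (subset_tsupport _ hne)
    have h5 : (x₀ + p.1 - x₀) ^ 2 + (y₀ + p.2 - y₀) ^ 2 < r ^ 2 := h5
    rw [add_sub_cancel_left, add_sub_cancel_left] at h5
    have h6 := hp.trans (norm_le_nrm2 p)
    have h7 : nrm2 p < r := by rw [nrm2, Real.sqrt_lt' hr]; exact h5
    linarith
  set ψ : RR → ℝ := fun p => φ ((x₀, y₀) + p) with hψ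
  have hψ1 : ContDiff ℝ 1 ψ := (h1.of_le (by exact_mod_cast le_top)).comp (contDiff_const.add contDiff_id)
  have hψc : HasCompactSupport ψ := by
    refine HasCompactSupport.of_support_subset_isCompact (isCompact_closedBall (0:RR) r) fun p hp => ?_
    rw [mem_closedBall_zero_iff]
    by_contra hcon
    exact hp (hz p (not_le.1 hcon).le)
  obtain ⟨M, hM⟩ := hψ1.continuous.bounded_above_of_compact_support hψc
  obtain ⟨M', hM'⟩ := (continuous_norm.smul (hψ1.continuous_fderiv one_ne_zero)).bounded_above_of_compact_support ((hψc.fderiv ℝ).smul_left (f := fun p : RR => ‖p‖))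
  have hM0 := (norm_nonneg _).trans (hM 0)
  have hM'0 := (norm_nonneg _).trans (hM' 0)
  have hac : ∀ p : RR, p ≠ 0 → ContDiffAt ℝ 1 α p := fun p hp => a1.contDiffAt (isOpen_compl_singleton.mem_nhds hp)
  refine ⟨hz, (M + M') * A, by positivity, fun p hp => hψ1.contDiffAt.mul (hac p hp), fun p hp => ?_, fun p hp => ?_, fun p hp => ?_⟩
  · rw [abs_mul]
    have := hM p
    rw [norm_eq_abs] at this
    have h3 := mul_le_mul this (a2 p) (abs_nonneg _) hM0
    nlinarith
  · have e1 := (hψ1.differentiable one_ne_zero p).hasFDerivAt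
    have e2 := ((hac p hp).differentiableAt one_ne_zero).hasFDerivAt
    have e3 : HasFDerivAt (fun p => ψ p * α p) _ p := e1.mul e2
    rw [e3.fderiv]
    have hn := norm_pos_iff.2 hp
    have hn2 := norm_le_nrm2 p
    have h5 : ‖p‖ * ‖fderiv ℝ α p‖ ≤ A := by
      calc ‖p‖ * ‖fderiv ℝ α p‖ ≤ nrm2 p * (A * (nrm2 p)⁻¹) := mul_le_mul hn2 (a3 p hp) (norm_nonneg _) (Real.sqrt_nonneg _)
        _ = A := by have := hn.trans_le hn2; field_simp
    have h6 : ‖‖p‖ • fderiv ℝ ψ p‖ ≤ M' := hM' p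
    rw [norm_smul, norm_norm] at h6
    have h7 := hM p
    rw [norm_eq_abs] at h7
    have h8 := a2 p
    calc ‖p‖ * ‖ψ p • fderiv ℝ α p + α p • fderiv ℝ ψ p‖ ≤ ‖p‖ * (|ψ p| * ‖fderiv ℝ α p‖ + |α p| * ‖fderiv ℝ ψ p‖) := by
          gcongr
          refine (norm_add_le _ _).trans ?_
          rw [norm_smul, norm_smul, norm_eq_abs, norm_eq_abs]
      _ = |ψ p| * (‖p‖ * ‖fderiv ℝ α p‖) + |α p| * (‖p‖ * ‖fderiv ℝ ψ p‖) := by ring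
      _ ≤ M * A + A * M' := by gcongr
      _ = _ := by ring
  · change φ ((x₀, y₀) + p) * α p = 0
    rw [hz p hp, zero_mul]

/-- **Theorem 1.3 b).** In the local multiplier setup with ball exponent `ε < 1/2`, let `δ`
be the minimum of the strip exponents `δ_v` over all unit directions `v` and `e` the
maximum of `e_v` over the minimizing directions. Then for bump functions `φ` with
sufficiently small support there is `C'` such that for all `(t,u)`,
`|K_φ(t,u)| ≤ C' (2+|(t,u)|)^{−δ} (ln(2+|(t,u)|))^{e}`. -/
theorem kernel_bound_global {n : ℕ} (f : Fin n → ℝ × ℝ → ℝ)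
    (γ : Fin n → ℝ) (E : Set (ℝ × ℝ)) (hsf : StandardForm n f γ E)
    (x₀ y₀ A : ℝ) (hA : 0 < A) (α m : ℝ × ℝ → ℝ) (hα : AlphaBound α A)
    (U : Set (ℝ × ℝ)) (hU : U ∈ 𝓝 (0:ℝ×ℝ))
    (hm : ∀ p ∈ U, m ((x₀, y₀) + p) = α p * stdFun n f γ E p)
    (ε : ℝ) (d : ℕ) (hball : BallBound (stdFun n f γ E) ε d) (hε : ε < 1/2)
    (δ : ℝ × ℝ → ℝ) (e : ℝ × ℝ → ℕ)
    (hstrip : ∀ v : ℝ × ℝ, nrm2 v = 1 → StripBound (stdFun n f γ E) v (δ v) (e v))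
    (δm : ℝ) (em : ℕ)
    (hδm : (∃ v, nrm2 v = 1 ∧ δ v = δm) ∧ ∀ v, nrm2 v = 1 → δm ≤ δ v)
    (hem : (∃ v, nrm2 v = 1 ∧ δ v = δm ∧ e v = em) ∧
      ∀ v, nrm2 v = 1 → δ v = δm → e v ≤ em) :
    ∃ r₁ > (0:ℝ), ∀ φ : ℝ × ℝ → ℝ, IsBump φ x₀ y₀ r₁ →
      ∃ C' > (0:ℝ), ∀ t u : ℝ,
        ‖Kphi φ m t u‖ ≤ C' * (2 + nrm2 (t, u)) ^ (-δm) *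
          (Real.log (2 + nrm2 (t, u))) ^ em := by

  classical
  have h0 : 0 < δm := by
    obtain ⟨v, hv, hd⟩ := hδm.1
    rw [← hd]; exact (hstrip v hv).1
  have hem1 : em ≤ 1 := by
    obtain ⟨v, hv, -, hd⟩ := hem.1
    rw [← hd]; exact (hstrip v hv).2.1
  obtain ⟨V, hV, hVi⟩ := hsf.integ
  have hde : ∀ v, nrm2 v = 1 → _ := fun v hv => dir_est hsf hv (hstrip v hv)
    ((delta_lt (std_nonneg f γ E) hV hVi hball hv (hstrip v hv)).trans_lt hε) h0 (hδm.2 v hv) (hem.2 v hv)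
  choose! ν hν s hs hC using hde
  obtain ⟨t, ht, htc⟩ := circ_compact.elim_nhds_subcover (fun v => ball v (ν v)) fun v hv => ball_mem_nhds v (hν v hv)
  obtain ⟨s0, hs0, hs0t⟩ := min_exists t s fun j hj => hs j (ht j hj)
  obtain ⟨η, hη, hηU⟩ := Metric.mem_nhds_iff.1 hU
  have hr : 0 < min s0 η := lt_min hs0 hη
  refine ⟨min s0 η, hr, fun φ hφ => ?_⟩
  obtain ⟨hz, B, hB, hamp⟩ := amp_of_bump hA hα hr hφ
  have hCB : ∀ j, nrm2 j = 1 → _ := fun j hj => hC j hj B hB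
  choose! C hC0 hCb using hCB
  set J := ∫ p, ‖φ p * m p‖ with hJ
  have hJ0 : 0 ≤ J := integral_nonneg fun p => norm_nonneg _
  have hS : 0 ≤ ∑ j ∈ t, C j := Finset.sum_nonneg fun j hj => hC0 j (ht j hj)
  have h4 : (0:ℝ) < 4 ^ δm := rpow_pos_of_pos (by norm_num) _
  refine ⟨(∑ j ∈ t, C j) + 2 * J * 4 ^ δm + 1, by positivity, fun a b => ?_⟩
  have hn0 : 0 ≤ nrm2 (a, b) := Real.sqrt_nonneg _
  have hl0 : 0 < log (2 + nrm2 (a, b)) := log_pos (by linarith)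
  have hp0 : 0 < (2 + nrm2 (a, b)) ^ (-δm) := rpow_pos_of_pos (by linarith) _
  have hX : 0 < (2 + nrm2 (a, b)) ^ (-δm) * log (2 + nrm2 (a, b)) ^ em := by positivity
  rw [mul_assoc]
  rcases lt_or_ge (nrm2 (a, b)) 2 with hlt | hge
  · have h1 : ‖Kphi φ m a b‖ ≤ J := by
      unfold Kphi oscInt
      rw [Measure.restrict_univ]
      refine (norm_integral_le_integral_norm _).trans_eq (integral_congr_ae (ae_of_all _ fun p => ?_))
      have : ‖Complex.exp (Complex.I * ((a : ℂ) * (p.1 : ℂ) + (b : ℂ) * (p.2 : ℂ)))‖ = 1 := by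
        have := Complex.norm_exp_ofReal_mul_I (a * p.1 + b * p.2)
        rw [mul_comm] at this
        push_cast at this
        exact this
      simp only [norm_mul, this, mul_one, Complex.norm_real]
    have h2 : (4:ℝ) ^ (-δm) ≤ (2 + nrm2 (a, b)) ^ (-δm) :=
      rpow_le_rpow_of_nonpos (by linarith) (by linarith) (by linarith)
    have h3 : (1 / 2 : ℝ) ≤ log (2 + nrm2 (a, b)) ^ em := by
      have : log 2 ≤ log (2 + nrm2 (a, b)) := log_le_log (by norm_num) (by linarith)
      have := log_two_gt_d9
      interval_cases em
      · norm_num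
      · rw [pow_one]; linarith
    have h5 : (4:ℝ) ^ δm * 4 ^ (-δm) = 1 := by
      rw [← rpow_add (by norm_num)]; simp
    have h6 : (4:ℝ) ^ (-δm) * (1 / 2) ≤ (2 + nrm2 (a, b)) ^ (-δm) * log (2 + nrm2 (a, b)) ^ em :=
      mul_le_mul h2 h3 (by norm_num) hp0.le
    calc ‖Kphi φ m a b‖ ≤ J := h1
      _ = 2 * J * 4 ^ δm * ((4:ℝ) ^ (-δm) * (1 / 2)) := by linear_combination -J * h5
      _ ≤ 2 * J * 4 ^ δm * ((2 + nrm2 (a, b)) ^ (-δm) * log (2 + nrm2 (a, b)) ^ em) := by gcongr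
      _ ≤ _ := mul_le_mul_of_nonneg_right (by linarith) hX.le
  · have hne : ((a, b) : RR) ≠ 0 := by
      intro h
      rw [h] at hge
      norm_num [nrm2] at hge
    have hv := dirn_unit hne
    obtain ⟨j, hjt, hj⟩ := mem_iUnion₂.1 (htc (show dirn (a, b) ∈ {p : RR | nrm2 p = 1} from hv))
    have h1 := hCb j (ht j hjt) (nrm2 (a, b)) (dirn (a, b)) _ hge hv (mem_ball.1 hj) (hamp.mono ((min_le_left _ _).trans (hs0t j hjt)))
    have h2 : ‖Kphi φ m a b‖ = ‖∫ p, (((φ ((x₀, y₀) + p) * α p) * stdFun n f γ E p : ℝ) : ℂ) * Complex.exp (Complex.I * ((nrm2 (a, b) * dot2 p (dirn (a, b)) : ℝ) : ℂ))‖ := by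
      unfold Kphi oscInt
      rw [Measure.restrict_univ, ← integral_add_left_eq_self _ ((x₀, y₀) : RR)]
      have hu : ‖Complex.exp (Complex.I * ((a : ℂ) * (x₀ : ℂ) + (b : ℂ) * (y₀ : ℂ)))‖ = 1 := by
        have := Complex.norm_exp_ofReal_mul_I (a * x₀ + b * y₀)
        rw [mul_comm] at this
        push_cast at this
        exact this
      rw [← one_mul ‖∫ p, (((φ ((x₀, y₀) + p) * α p) * stdFun n f γ E p : ℝ) : ℂ) * Complex.exp (Complex.I * ((nrm2 (a, b) * dot2 p (dirn (a, b)) : ℝ) : ℂ))‖, ← hu, ← norm_mul, ← integral_const_mul]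
      congr 1
      refine integral_congr_ae (ae_of_all _ fun p => ?_)
      have hd : nrm2 (a, b) * dot2 p (dirn (a, b)) = a * p.1 + b * p.2 := by
        have : nrm2 (a, b) ≠ 0 := by linarith
        simp only [dot2, dirn, Prod.smul_mk, smul_eq_mul]
        field_simp
      have hm' : φ ((x₀, y₀) + p) * m ((x₀, y₀) + p) = φ ((x₀, y₀) + p) * α p * stdFun n f γ E p := by
        by_cases hp : p ∈ U
        · rw [hm p hp]; ring
        · have : min s0 η ≤ ‖p‖ := by
            by_contra hcon
            exact hp (hηU (mem_ball_zero_iff.2 ((not_le.1 hcon).trans_le (min_le_right _ _))))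
          rw [hz p this]; ring
      simp only [hd, hm']
      rw [mul_left_comm, ← Complex.exp_add]
      congr 2
      simp only [Prod.fst_add, Prod.snd_add]
      push_cast
      ring
    rw [h2]
    refine h1.trans (mul_le_mul_of_nonneg_right ?_ hX.le)
    have h3 := Finset.single_le_sum (f := C) (fun j hj => hC0 j (ht j hj)) hjt
    have : 0 ≤ 2 * J * 4 ^ δm := by positivity
    linarith
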